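/- Let Γ be a finitely generated free group and j, ρ : Γ → PSL(2,ℝ) homomorphisms such that the action γ·x = ρ(γ) x j(γ)⁻¹ of Γ on PSL(2,ℝ) is properly discontinuous and admits a fundamental domain bounded by pairwise disjoint right AdS crooked planes. Then there exist: (a) a collection 𝒜 of geodesic lines of ℍ with j(γ)·α ∈ 𝒜 for all γ ∈ Γ and α ∈ 𝒜, such that any two distinct members of 𝒜 are disjoint and share no endpoint, every compact subset of ℍ meets only finitely many members of 𝒜, and j(Γ) acts freely and transitively on the set of connected components of ℍ ∖ ⋃_{α∈𝒜} α; (b) a family (g_α)_{α∈𝒜} of elements of PSL(2,ℝ) with g_{j(γ)·α} = ρ(γ) g_α j(γ)⁻¹ for all γ ∈ Γ and α ∈ 𝒜; (c) a constant K > 0 such that d(g_α·x, g_{α'}·x') ≤ d(x, x') − K for all distinct α, α' ∈ 𝒜 and all x ∈ α, x' ∈ α'. -/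

import Mathlib

noncomputable section

open Filter Topology Pointwise
open scoped UpperHalfPlane

/-- `SL(2,ℝ)`. -/
abbrev SL2 := Matrix.SpecialLinearGroup (Fin 2) ℝ

instance : TopologicalSpace SL2 :=
  TopologicalSpace.induced (fun A : SL2 => (A : Matrix (Fin 2) (Fin 2) ℝ)) inferInstance

/-- `PSL(2,ℝ) = SL(2,ℝ)/{±I}`. -/
abbrev PSL2 := SL2 ⧸ Subgroup.center SL2

/-- The Möbius action of an element of `PSL(2,ℝ)` on the upper half-plane,
computed via an (arbitrary) lift to `SL(2,ℝ)`; this is well defined since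
`-I` acts trivially. -/
def pslSMul (g : PSL2) (z : ℍ) : ℍ := (Quotient.out g) • z

/-- Image of a subset of `ℍ` under the Möbius action of `g ∈ PSL(2,ℝ)`. -/
def pslImg (g : PSL2) (s : Set ℍ) : Set ℍ := pslSMul g '' s

/-- A geodesic line of `ℍ`: the image of an isometric embedding of `ℝ` into `ℍ`. -/
def IsGeodesicLine (l : Set ℍ) : Prop := ∃ γ : ℝ → ℍ, Isometry γ ∧ Set.range γ = l

/-- The embedding of `ℍ` into the one-point compactification of `ℂ`. -/
def embH (z : ℍ) : OnePoint ℂ := ((z : ℂ) : OnePoint ℂ)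

/-- The embedding of `∂∞ℍ = ℝ ∪ {∞}` into the one-point compactification of `ℂ`. -/
def toC : OnePoint ℝ → OnePoint ℂ := OnePoint.map Complex.ofReal

/-- The vector `v(ξ) ∈ ℝ²` associated with a boundary point `ξ ∈ ℝ ∪ {∞}`:
`v(ξ) = (ξ, 1)` for `ξ ∈ ℝ` and `v(∞) = (1, 0)`. -/
def bvec (ξ : OnePoint ℝ) : Fin 2 → ℝ := Option.elim ξ ![1, 0] (fun r => ![r, 1])

/-- The extended Möbius action of `PSL(2,ℝ)` on `∂∞ℍ = ℝ ∪ {∞}`. -/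
def bdSMul (g : PSL2) (ξ : OnePoint ℝ) : OnePoint ℝ :=
  let w := ((Quotient.out g : SL2) : Matrix (Fin 2) (Fin 2) ℝ).mulVec (bvec ξ)
  if w 1 = 0 then OnePoint.infty else ((w 0 / w 1 : ℝ) : OnePoint ℝ)

/-- `ξ ∈ ℝ ∪ {∞}` is an endpoint of the geodesic line `l`: some isometric
parametrization of `l` tends to `ξ` (in the one-point compactification of `ℂ`). -/
def IsEndpoint (l : Set ℍ) (ξ : OnePoint ℝ) : Prop :=
  ∃ γ : ℝ → ℍ, Isometry γ ∧ Set.range γ = l ∧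
    Tendsto (fun t => embH (γ t)) atTop (𝓝 (toC ξ))

/-- `h ∈ PSL(2,ℝ)` has a nonattracting fixed point at `ξ ∈ ℝ ∪ {∞}`. -/
def HasNonattracting (h : PSL2) (ξ : OnePoint ℝ) : Prop :=
  ∃ A : SL2, (QuotientGroup.mk A : PSL2) = h ∧
    ∃ μ : ℝ, |μ| ≤ 1 ∧ (A : Matrix (Fin 2) (Fin 2) ℝ).mulVec (bvec ξ) = μ • bvec ξ

/-- `h ∈ PSL(2,ℝ)` has a nonrepelling fixed point at `ξ ∈ ℝ ∪ {∞}`. -/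
def HasNonrepelling (h : PSL2) (ξ : OnePoint ℝ) : Prop :=
  ∃ A : SL2, (QuotientGroup.mk A : PSL2) = h ∧
    ∃ μ : ℝ, 1 ≤ |μ| ∧ (A : Matrix (Fin 2) (Fin 2) ℝ).mulVec (bvec ξ) = μ • bvec ξ

/-- The right AdS crooked plane `C*(l)` centered at the identity. -/
def rightCrooked (l : Set ℍ) : Set PSL2 :=
  {h | (∃ x ∈ l, pslSMul h x = x) ∨ ∃ ξ, IsEndpoint l ξ ∧ HasNonattracting h ξ}

/-- The left AdS crooked plane `C(l)` centered at the identity. -/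
def leftCrooked (l : Set ℍ) : Set PSL2 :=
  {h | (∃ x ∈ l, pslSMul h x = x) ∨ ∃ ξ, IsEndpoint l ξ ∧ HasNonrepelling h ξ}

/-- A general right AdS crooked plane: a set of the form `g·C*(l)`. -/
def IsRightCrookedPlane (S : Set PSL2) : Prop :=
  ∃ (g : PSL2) (l : Set ℍ), IsGeodesicLine l ∧ S = (g * ·) '' rightCrooked l

/-- A general left AdS crooked plane: a set of the form `C(l)·g`. -/
def IsLeftCrookedPlane (S : Set PSL2) : Prop :=
  ∃ (g : PSL2) (l : Set ℍ), IsGeodesicLine l ∧ S = (· * g) '' leftCrooked l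

variable {Γ : Type*} [Group Γ]

/-- The action `γ·x = ρ(γ) x j(γ)⁻¹` of `Γ` on `PSL(2,ℝ)`, applied to a set. -/
def actImg (j ρ : Γ →* PSL2) (γ : Γ) (S : Set PSL2) : Set PSL2 :=
  (fun x => ρ γ * x * (j γ)⁻¹) '' S

/-- The action `γ·x = ρ(γ) x j(γ)⁻¹` is properly discontinuous. -/
def ProperlyDisc (j ρ : Γ →* PSL2) : Prop :=
  ∀ K : Set PSL2, IsCompact K → {γ : Γ | (actImg j ρ γ K ∩ K).Nonempty}.Finite

/-- `R` is a fundamental domain for the action `γ·x = ρ(γ) x j(γ)⁻¹`: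
`R` is closed, its translates cover `PSL(2,ℝ)`, and the interiors of the
translates are pairwise disjoint. -/
def IsFundDom (j ρ : Γ →* PSL2) (R : Set PSL2) : Prop :=
  IsClosed R ∧ (⋃ γ : Γ, actImg j ρ γ R) = Set.univ ∧
    Pairwise fun γ₁ γ₂ : Γ =>
      Disjoint (interior (actImg j ρ γ₁ R)) (interior (actImg j ρ γ₂ R))

/-- The action admits a fundamental domain bounded by pairwise disjoint
right AdS crooked planes. -/
def AdmitsRightCrookedFD (j ρ : Γ →* PSL2) : Prop :=
  ∃ (m : ℕ) (D : Fin m → Set PSL2), (∀ i, IsRightCrookedPlane (D i)) ∧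
    (∀ (γ γ' : Γ) (i i' : Fin m),
      actImg j ρ γ (D i) = actImg j ρ γ' (D i') ∨
      Disjoint (actImg j ρ γ (D i)) (actImg j ρ γ' (D i'))) ∧
    ∃ x ∈ (⋃ (γ : Γ) (i : Fin m), actImg j ρ γ (D i))ᶜ,
      IsFundDom j ρ
        (closure (connectedComponentIn (⋃ (γ : Γ) (i : Fin m), actImg j ρ γ (D i))ᶜ x))

/-- The action admits a fundamental domain bounded by pairwise disjoint
left AdS crooked planes. -/
def AdmitsLeftCrookedFD (j ρ : Γ →* PSL2) : Prop :=
  ∃ (m : ℕ) (D : Fin m → Set PSL2), (∀ i, IsLeftCrookedPlane (D i)) ∧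
    (∀ (γ γ' : Γ) (i i' : Fin m),
      actImg j ρ γ (D i) = actImg j ρ γ' (D i') ∨
      Disjoint (actImg j ρ γ (D i)) (actImg j ρ γ' (D i'))) ∧
    ∃ x ∈ (⋃ (γ : Γ) (i : Fin m), actImg j ρ γ (D i))ᶜ,
      IsFundDom j ρ
        (closure (connectedComponentIn (⋃ (γ : Γ) (i : Fin m), actImg j ρ γ (D i))ᶜ x))

/-- The translation length `λ(g) = inf_{p ∈ ℍ} d(p, g·p)`. -/
def transLength (g : PSL2) : ℝ := ⨅ p : ℍ, dist p (pslSMul g p)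

/-- `U` is a connected component of `S`. -/
def IsCC (S U : Set ℍ) : Prop := ∃ x ∈ S, connectedComponentIn S x = U

/-- `ξ ∈ ℝ ∪ {∞}` is an ideal point of `U ⊆ ℍ`: a limit of a sequence of points
of `U` in the one-point compactification of `ℂ`. -/
def IsIdealPoint (U : Set ℍ) (ξ : OnePoint ℝ) : Prop :=
  ∃ u : ℕ → ℍ, (∀ n, u n ∈ U) ∧ Tendsto (fun n => embH (u n)) atTop (𝓝 (toC ξ))

/-- The closed right crooked half-space `H̄*₊(l, U)`. -/
def closedRHS (l U : Set ℍ) : Set PSL2 :=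
  {h | (∃ x ∈ l ∪ U, pslSMul h x = x) ∨ ∃ ξ, IsIdealPoint U ξ ∧ HasNonattracting h ξ}

/-- The open right crooked half-space `H*₊(l, U)`. -/
def openRHS (l U : Set ℍ) : Set PSL2 :=
  {h | h ≠ 1 ∧ ((∃ x ∈ U, pslSMul h x = x) ∨
    ∃ ξ, IsIdealPoint U ξ ∧ ¬ IsEndpoint l ξ ∧ HasNonattracting h ξ)}

/-- The circle of (Euclidean) radius `c` in `ℍ` centered at `0`; for suitable `c`
this is a geodesic line of `ℍ`. -/
def circ (c : ℝ) : Set ℍ := {z : ℍ | ‖(z : ℂ)‖ = c}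

/-- The stem quadrant `SQ(ℓ)` for `ℓ = {|z| = 1/R}` transversely oriented towards `0`. -/
def SQell (R : ℝ) : Set PSL2 :=
  {h | ∃ (A : SL2) (α β v : ℝ), (QuotientGroup.mk A : PSL2) = h ∧
    (A : Matrix (Fin 2) (Fin 2) ℝ) = !![α, -v/R; v*R, β] ∧
    |α| < |β| ∧ 2*|v| < |α - β|}

/-- The inverse stem quadrant `SQ(ℓ')⁻¹` for `ℓ' = {|z| = R}` transversely
oriented towards `∞`. -/
def SQell'inv (R : ℝ) : Set PSL2 :=
  {h | ∃ (A : SL2) (α β v : ℝ), (QuotientGroup.mk A : PSL2) = h ∧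
    (A : Matrix (Fin 2) (Fin 2) ℝ) = !![α, v*R; -v/R, β] ∧
    |α| < |β| ∧ 2*|v| < |α - β|}

/-- The stem quadrant `SQ(ℓ')`. -/
def SQell' (R : ℝ) : Set PSL2 := {h | h⁻¹ ∈ SQell'inv R}


/-! ### Basics on PSL2 and its action -/

/-- quotient map -/
abbrev pmk (A : SL2) : PSL2 := QuotientGroup.mk A

instance sl2TG : IsTopologicalGroup SL2 where
  continuous_inv := continuous_induced_rng.mpr continuous_induced_dom.matrix_adjugate
  continuous_mul := continuous_induced_rng.mpr <|
    (continuous_induced_dom.comp continuous_fst).mul (continuous_induced_dom.comp continuous_snd)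

lemma sl2_cont_iff {X : Type*} [TopologicalSpace X] (f : X → SL2) :
    Continuous f ↔ Continuous (fun x => (f x : Matrix (Fin 2) (Fin 2) ℝ)) :=
  continuous_induced_rng

lemma sl2_cont_entry (i j : Fin 2) : Continuous (fun A : SL2 => A i j) := by
  have : Continuous (fun A : SL2 => (A : Matrix (Fin 2) (Fin 2) ℝ)) := continuous_induced_dom
  exact this.matrix_elem i j

lemma pmk_cont : Continuous pmk := continuous_quotient_mk'

/-- build an SL2 matrix -/
def mkSL (a b c d : ℝ) (h : a * d - b * c = 1) : SL2 :=
  ⟨!![a, b; c, d], by rw [Matrix.det_fin_two_of]; exact h⟩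

@[simp] lemma mkSL_00 (a b c d : ℝ) (h) : mkSL a b c d h 0 0 = a := rfl
@[simp] lemma mkSL_01 (a b c d : ℝ) (h) : mkSL a b c d h 0 1 = b := rfl
@[simp] lemma mkSL_10 (a b c d : ℝ) (h) : mkSL a b c d h 1 0 = c := rfl
@[simp] lemma mkSL_11 (a b c d : ℝ) (h) : mkSL a b c d h 1 1 = d := rfl

lemma sl2_det (A : SL2) : A 0 0 * A 1 1 - A 0 1 * A 1 0 = 1 := by
  have := A.det_coe
  rwa [Matrix.det_fin_two] at this

lemma sl2_ext {A B : SL2} (h00 : A 0 0 = B 0 0) (h01 : A 0 1 = B 0 1) (h10 : A 1 0 = B 1 0)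
    (h11 : A 1 1 = B 1 1) : A = B := by
  apply Matrix.SpecialLinearGroup.ext
  intro i j
  fin_cases i <;> fin_cases j <;> assumption

lemma mkSL_cont {X : Type*} [TopologicalSpace X] {a b c d : X → ℝ}
    (h : ∀ x, a x * d x - b x * c x = 1) (ha : Continuous a) (hb : Continuous b)
    (hc : Continuous c) (hd : Continuous d) :
    Continuous (fun x => mkSL (a x) (b x) (c x) (d x) (h x)) := by
  rw [sl2_cont_iff]
  refine continuous_matrix ?_
  intro i j
  fin_cases i <;> fin_cases j <;> assumption

@[simp] lemma sl2_mul_00 (A B : SL2) : (A * B) 0 0 = A 0 0 * B 0 0 + A 0 1 * B 1 0 := by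
  simp [Matrix.SpecialLinearGroup.coe_mul, Matrix.mul_apply, Fin.sum_univ_two]
@[simp] lemma sl2_mul_01 (A B : SL2) : (A * B) 0 1 = A 0 0 * B 0 1 + A 0 1 * B 1 1 := by
  simp [Matrix.SpecialLinearGroup.coe_mul, Matrix.mul_apply, Fin.sum_univ_two]
@[simp] lemma sl2_mul_10 (A B : SL2) : (A * B) 1 0 = A 1 0 * B 0 0 + A 1 1 * B 1 0 := by
  simp [Matrix.SpecialLinearGroup.coe_mul, Matrix.mul_apply, Fin.sum_univ_two]
@[simp] lemma sl2_mul_11 (A B : SL2) : (A * B) 1 1 = A 1 0 * B 0 1 + A 1 1 * B 1 1 := by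
  simp [Matrix.SpecialLinearGroup.coe_mul, Matrix.mul_apply, Fin.sum_univ_two]

@[simp] lemma sl2_inv_00 (A : SL2) : (A⁻¹) 0 0 = A 1 1 := by
  rw [Matrix.SpecialLinearGroup.SL2_inv_expl]; rfl
@[simp] lemma sl2_inv_01 (A : SL2) : (A⁻¹) 0 1 = - A 0 1 := by
  rw [Matrix.SpecialLinearGroup.SL2_inv_expl]; rfl
@[simp] lemma sl2_inv_10 (A : SL2) : (A⁻¹) 1 0 = - A 1 0 := by
  rw [Matrix.SpecialLinearGroup.SL2_inv_expl]; rfl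
@[simp] lemma sl2_inv_11 (A : SL2) : (A⁻¹) 1 1 = A 0 0 := by
  rw [Matrix.SpecialLinearGroup.SL2_inv_expl]; rfl

lemma sl2_neg_entry (A : SL2) (i j : Fin 2) : (-A) i j = - A i j := by
  simp

lemma mem_center_sl2 (A : SL2) : A ∈ Subgroup.center SL2 ↔ A = 1 ∨ A = -1 := by
  rw [Matrix.SpecialLinearGroup.mem_center_iff]
  constructor
  · rintro ⟨r, hr, h⟩
    have hr' : r = 1 ∨ r = -1 := by
      simp at hr
      exact hr
    rcases hr' with rfl | rfl
    · left
      ext i j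
      have := congrFun (congrFun h i) j
      rw [← this]; simp [Matrix.scalar_apply, Matrix.one_apply, Matrix.diagonal_apply]
    · right
      ext i j
      have := congrFun (congrFun h i) j
      rw [← this]
      simp [Matrix.scalar_apply, Matrix.one_apply, Matrix.diagonal_apply]
      split_ifs <;> simp
  · rintro (rfl | rfl)
    · exact ⟨1, by simp, by simp⟩
    · refine ⟨-1, by simp, ?_⟩
      ext i j
      simp [Matrix.one_apply, Matrix.diagonal_apply]
      split_ifs <;> simp

lemma pmk_eq_iff (A B : SL2) : pmk A = pmk B ↔ B = A ∨ B = -A := by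
  rw [QuotientGroup.eq, mem_center_sl2]
  constructor
  · rintro (h | h)
    · left; exact (inv_mul_eq_one.mp h).symm
    · right
      have : B = A * (A⁻¹ * B) := by group
      rw [this, h]; simp
  · rintro (h | h)
    · left; rw [h]; simp
    · right; rw [h]; simp

lemma pmk_neg (A : SL2) : pmk (-A) = pmk A := ((pmk_eq_iff _ _).2 (Or.inr (by simp)))

lemma pmk_surj (h : PSL2) : ∃ A : SL2, pmk A = h := QuotientGroup.mk_surjective h

lemma pmk_mul (A B : SL2) : pmk (A * B) = pmk A * pmk B := rfl
lemma pmk_inv (A : SL2) : pmk (A⁻¹) = (pmk A)⁻¹ := rfl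
lemma pmk_one : pmk 1 = 1 := rfl

lemma neg_smulH (A : SL2) (z : ℍ) : (-A) • z = A • z := by
  ext1
  rw [UpperHalfPlane.coe_specialLinearGroup_apply, UpperHalfPlane.coe_specialLinearGroup_apply]
  simp only [sl2_neg_entry, map_neg, Complex.ofReal_neg]
  rw [show (-((algebraMap ℝ ℝ (A 0 0) : ℝ):ℂ) * (z:ℂ) + -((algebraMap ℝ ℝ (A 0 1) : ℝ):ℂ)) =
    -(((algebraMap ℝ ℝ (A 0 0) : ℝ):ℂ) * (z:ℂ) + ((algebraMap ℝ ℝ (A 0 1) : ℝ):ℂ)) by ring,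
    show (-((algebraMap ℝ ℝ (A 1 0) : ℝ):ℂ) * (z:ℂ) + -((algebraMap ℝ ℝ (A 1 1) : ℝ):ℂ)) =
    -(((algebraMap ℝ ℝ (A 1 0) : ℝ):ℂ) * (z:ℂ) + ((algebraMap ℝ ℝ (A 1 1) : ℝ):ℂ)) by ring,
    neg_div_neg_eq]

lemma pslSMul_pmk (A : SL2) (z : ℍ) : pslSMul (pmk A) z = A • z := by
  unfold pslSMul
  have h : pmk (Quotient.out (pmk A)) = pmk A := Quotient.out_eq _
  rcases (pmk_eq_iff _ _).1 h with h | h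
  · rw [← h]
  · conv_rhs => rw [h]
    rw [neg_smulH]

instance pslAction : MulAction PSL2 ℍ where
  smul := pslSMul
  one_smul z := by
    change pslSMul 1 z = z
    rw [← pmk_one, pslSMul_pmk, one_smul]
  mul_smul g h z := by
    change pslSMul (g * h) z = pslSMul g (pslSMul h z)
    obtain ⟨A, rfl⟩ := pmk_surj g
    obtain ⟨B, rfl⟩ := pmk_surj h
    rw [← pmk_mul, pslSMul_pmk, pslSMul_pmk, pslSMul_pmk, mul_smul]

lemma pslSMul_eq (g : PSL2) (z : ℍ) : pslSMul g z = g • z := rfl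

lemma pmk_smul (A : SL2) (z : ℍ) : pmk A • z = A • z := pslSMul_pmk A z

lemma pdist (g : PSL2) (z w : ℍ) : dist (g • z) (g • w) = dist z w := by
  obtain ⟨A, rfl⟩ := pmk_surj g
  rw [pmk_smul, pmk_smul, dist_smul]

lemma pdist_inv (g : PSL2) (z w : ℍ) : dist (g⁻¹ • z) w = dist z (g • w) := by
  rw [← pdist g, smul_inv_smul]

instance pslIsom : IsIsometricSMul PSL2 ℍ := ⟨fun g => Isometry.of_dist_eq (pdist g)⟩

lemma sl2_smul_coe (A : SL2) (z : ℍ) : ((A • z : ℍ) : ℂ) =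
    ((A 0 0 : ℂ) * z + (A 0 1 : ℂ)) / ((A 1 0 : ℂ) * z + (A 1 1 : ℂ)) := by
  rw [UpperHalfPlane.coe_specialLinearGroup_apply]; rfl

/-- squared norm of the denominator -/
def den (A : SL2) (z : ℍ) : ℝ := (A 1 0 * z.re + A 1 1) ^ 2 + (A 1 0 * z.im) ^ 2

/-- squared norm of the numerator -/
def nume (A : SL2) (z : ℍ) : ℝ := (A 0 0 * z.re + A 0 1) ^ 2 + (A 0 0 * z.im) ^ 2

lemma den_pos (A : SL2) (z : ℍ) : 0 < den A z := by
  unfold den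
  have hz := z.im_pos
  by_cases hc : A 1 0 = 0
  · have := sl2_det A
    have hd : A 1 1 ≠ 0 := by
      intro h; rw [hc, h] at this; simp at this
    rw [hc]; simp; positivity
  · have : A 1 0 * z.im ≠ 0 := mul_ne_zero hc hz.ne'
    positivity

lemma nume_pos (A : SL2) (z : ℍ) : 0 < nume A z := by
  unfold nume
  have hz := z.im_pos
  by_cases hc : A 0 0 = 0
  · have := sl2_det A
    have hd : A 0 1 ≠ 0 := by
      intro h; rw [hc, h] at this; simp at this
    rw [hc]; simp; positivity
  · have : A 0 0 * z.im ≠ 0 := mul_ne_zero hc hz.ne'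
    positivity

lemma smul_im (A : SL2) (z : ℍ) : (A • z).im = z.im / den A z := by
  have h := sl2_smul_coe A z
  have h1 : (A • z).im = ((A • z : ℍ) : ℂ).im := rfl
  rw [h1, h, Complex.div_im]
  have hd := sl2_det A
  simp only [Complex.normSq_apply, Complex.add_re, Complex.add_im, Complex.mul_re, Complex.mul_im,
    Complex.ofReal_re, Complex.ofReal_im, UpperHalfPlane.coe_re, UpperHalfPlane.coe_im]
  have hp := den_pos A z
  rw [← sub_div, show (A 1 0 * z.re - 0 * z.im + A 1 1) * (A 1 0 * z.re - 0 * z.im + A 1 1) +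
    (A 1 0 * z.im + 0 * z.re + 0) * (A 1 0 * z.im + 0 * z.re + 0) = den A z by unfold den; ring]
  congr 1
  linear_combination z.im * hd

lemma smul_re (A : SL2) (z : ℍ) : (A • z).re =
    ((A 0 0 * z.re + A 0 1) * (A 1 0 * z.re + A 1 1) + A 0 0 * A 1 0 * z.im ^ 2) / den A z := by
  have h := sl2_smul_coe A z
  have h1 : (A • z).re = ((A • z : ℍ) : ℂ).re := rfl
  rw [h1, h, Complex.div_re]
  simp only [Complex.normSq_apply, Complex.add_re, Complex.add_im, Complex.mul_re, Complex.mul_im,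
    Complex.ofReal_re, Complex.ofReal_im, UpperHalfPlane.coe_re, UpperHalfPlane.coe_im]
  have hp := den_pos A z
  rw [← add_div, show (A 1 0 * z.re - 0 * z.im + A 1 1) * (A 1 0 * z.re - 0 * z.im + A 1 1) +
    (A 1 0 * z.im + 0 * z.re + 0) * (A 1 0 * z.im + 0 * z.re + 0) = den A z by unfold den; ring]
  congr 1
  ring

/-- |z|² -/
def nsq (z : ℍ) : ℝ := z.re ^ 2 + z.im ^ 2

lemma nsq_pos (z : ℍ) : 0 < nsq z := by have := z.im_pos; unfold nsq; positivity

lemma smul_nsq (A : SL2) (z : ℍ) : nsq (A • z) = nume A z / den A z := by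
  have hp := den_pos A z
  unfold nsq
  rw [smul_re, smul_im]
  field_simp
  unfold nume den
  have hd := sl2_det A
  linear_combination (-z.im ^ 2 * (A 0 0 * A 1 1 - A 0 1 * A 1 0 + 1)) * hd

lemma uhp_ext {z w : ℍ} (h1 : z.re = w.re) (h2 : z.im = w.im) : z = w :=
  UpperHalfPlane.ext (Complex.ext h1 h2)

lemma cosh_dist_eq (z w : ℍ) : Real.cosh (dist z w) =
    ((z.re - w.re) ^ 2 + z.im ^ 2 + w.im ^ 2) / (2 * z.im * w.im) :=
  UpperHalfPlane.cosh_dist' z w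

/-- the vertical geodesic -/
def vert (t : ℝ) : ℍ := ⟨⟨0, Real.exp t⟩, Real.exp_pos t⟩

@[simp] lemma vert_re (t : ℝ) : (vert t).re = 0 := rfl
@[simp] lemma vert_im (t : ℝ) : (vert t).im = Real.exp t := rfl

lemma vert_isometry : Isometry vert := UpperHalfPlane.isometry_vertical_line 0

lemma cosh_dist_vert (z : ℍ) (t : ℝ) : Real.cosh (dist z (vert t)) =
    (Real.exp (-t) * nsq z + Real.exp t) / (2 * z.im) := by
  rw [cosh_dist_eq, vert_re, vert_im, Real.exp_neg]
  have := z.im_pos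
  have := Real.exp_pos t
  unfold nsq
  field_simp
  ring

/-- `w` rotation by a half turn -/
def wSL : SL2 := mkSL 0 (-1) 1 0 (by norm_num)

lemma wSL_vert (t : ℝ) : wSL • vert t = vert (-t) := by
  apply uhp_ext
  · rw [smul_re]; simp [wSL]
  · rw [smul_im]; simp [wSL, den, Real.exp_neg]
    have := Real.exp_pos t
    field_simp

lemma wSL_re (z : ℍ) : (wSL • z).re = - z.re / nsq z := by
  rw [smul_re]; simp [wSL, den, nsq]
lemma wSL_im (z : ℍ) : (wSL • z).im = z.im / nsq z := by
  rw [smul_im]; simp [wSL, den, nsq]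
lemma wSL_nsq (z : ℍ) : nsq (wSL • z) = 1 / nsq z := by
  rw [smul_nsq]; simp [wSL, nume, den, nsq]

lemma cosh_dist_I (A : SL2) : Real.cosh (dist (A • vert 0) (vert 0)) =
    (A 0 0 ^ 2 + A 0 1 ^ 2 + A 1 0 ^ 2 + A 1 1 ^ 2) / 2 := by
  have hp := den_pos A (vert 0)
  rw [cosh_dist_vert, smul_nsq, smul_im]
  have hd : den A (vert 0) = A 1 0 ^ 2 + A 1 1 ^ 2 := by simp [den]; ring
  have hn : nume A (vert 0) = A 0 0 ^ 2 + A 0 1 ^ 2 := by simp [nume]; ring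
  rw [hn]
  simp only [neg_zero, Real.exp_zero, vert_im]
  field_simp
  rw [hd]; ring

/-- cosh of distances between two lines -/
lemma cosh_dist_lines (A : SL2) (s t : ℝ) : Real.cosh (dist (A • vert t) (vert s)) =
    (A 0 0 ^ 2 * Real.exp (t - s) + A 0 1 ^ 2 * Real.exp (-s - t) + A 1 0 ^ 2 * Real.exp (s + t)
      + A 1 1 ^ 2 * Real.exp (s - t)) / 2 := by
  have hp := den_pos A (vert t)
  rw [cosh_dist_vert, smul_nsq, smul_im]
  have hd : den A (vert t) = A 1 0 ^ 2 * Real.exp t ^ 2 + A 1 1 ^ 2 := by simp [den]; ring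
  have hn : nume A (vert t) = A 0 0 ^ 2 * Real.exp t ^ 2 + A 0 1 ^ 2 := by simp [nume]; ring
  rw [hn]
  simp only [vert_im]
  have e1 : Real.exp (t - s) = Real.exp t / Real.exp s := Real.exp_sub t s
  have e2 : Real.exp (s - t) = Real.exp s / Real.exp t := Real.exp_sub s t
  have e3 : Real.exp (-s - t) = 1 / (Real.exp s * Real.exp t) := by
    rw [Real.exp_sub, Real.exp_neg]; field_simp
  rw [e1, e2, e3, Real.exp_add, Real.exp_neg]
  have := Real.exp_pos t
  have := Real.exp_pos s
  field_simp
  rw [hd]; ring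


/-! ### Topology of PSL2, normal forms -/

instance psl2TG : IsTopologicalGroup PSL2 := inferInstance

def uni (t : ℝ) : SL2 := mkSL 1 t 0 1 (by ring)
def lni (t : ℝ) : SL2 := mkSL 1 0 t 1 (by ring)

lemma uni_cont : Continuous uni :=
  mkSL_cont (fun t => by ring) continuous_const continuous_id continuous_const continuous_const
lemma lni_cont : Continuous lni :=
  mkSL_cont (fun t => by ring) continuous_const continuous_const continuous_id continuous_const

lemma uni_zero : uni 0 = 1 := by apply sl2_ext <;> simp [uni]
lemma lni_zero : lni 0 = 1 := by apply sl2_ext <;> simp [lni]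

lemma sl2_join (A : SL2) : ∃ f : ℝ → SL2, Continuous f ∧ f 0 = 1 ∧ f 1 = A := by
  have key : ∀ A : SL2, A 1 0 ≠ 0 → ∃ f : ℝ → SL2, Continuous f ∧ f 0 = 1 ∧ f 1 = A := by
    intro A hA
    refine ⟨fun t => uni (t * ((A 0 0 - 1) / A 1 0)) * lni (t * A 1 0) *
      uni (t * ((A 1 1 - 1) / A 1 0)), ?_, ?_, ?_⟩
    · exact ((uni_cont.comp (continuous_id.mul continuous_const)).mul
        (lni_cont.comp (continuous_id.mul continuous_const))).mul
        (uni_cont.comp (continuous_id.mul continuous_const))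
    · simp [uni_zero, lni_zero]
    · have hd := sl2_det A
      apply sl2_ext
      · simp [uni, lni]; field_simp; ring
      · simp [uni, lni]; field_simp
        linear_combination hd
      · simp [uni, lni]
      · simp [uni, lni]; field_simp; ring
  by_cases h : A 1 0 = 0
  · obtain ⟨f, hf, h0, h1⟩ := key (lni 1 * A) (by
      have hd := sl2_det A
      simp [lni, h]
      intro h'; rw [h', h] at hd; simp at hd)
    refine ⟨fun t => lni (-t) * f t, (lni_cont.comp continuous_neg).mul hf, ?_, ?_⟩
    · simp [lni_zero, h0]
    · simp only [h1, ← mul_assoc]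
      have : lni (-1) * lni 1 = 1 := by apply sl2_ext <;> simp [lni]
      rw [this, one_mul]
  · exact key A h

instance psl2_preconn : PreconnectedSpace PSL2 := by
  constructor
  apply isPreconnected_of_forall (1 : PSL2)
  intro y _
  obtain ⟨A, rfl⟩ := pmk_surj y
  obtain ⟨f, hf, h0, h1⟩ := sl2_join A
  refine ⟨Set.range (fun t => pmk (f t)), Set.subset_univ _, ⟨0, by simp [h0]⟩, ⟨1, by simp [h1]⟩, ?_⟩
  exact isPreconnected_range (pmk_cont.comp hf)

lemma sl2_transI (z : ℍ) : ∃ g : PSL2, g • vert 0 = z := by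
  refine ⟨pmk z.toSL2R, ?_⟩
  rw [pmk_smul]
  have : vert 0 = UpperHalfPlane.I := by
    apply uhp_ext <;> simp
  rw [this, UpperHalfPlane.toSL2R_smul_I]

lemma compact_box (B : ℝ) : IsCompact (pmk '' {A : SL2 | ∀ i j, |A i j| ≤ B}) := by
  let T : Set (ℝ × ℝ × ℝ × ℝ) := {v | v.1 * v.2.2.2 - v.2.1 * v.2.2.1 = 1} ∩
    (Set.Icc (-B) B ×ˢ (Set.Icc (-B) B ×ˢ (Set.Icc (-B) B ×ˢ Set.Icc (-B) B)))
  have hT : IsCompact T := by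
    apply IsCompact.inter_left
    · exact isCompact_Icc.prod (isCompact_Icc.prod (isCompact_Icc.prod isCompact_Icc))
    · exact isClosed_eq (by fun_prop) continuous_const
  have : CompactSpace T := isCompact_iff_compactSpace.1 hT
  have hc : Continuous (fun v : T => pmk (mkSL v.1.1 v.1.2.1 v.1.2.2.1 v.1.2.2.2 v.2.1)) := by
    apply pmk_cont.comp
    apply mkSL_cont (fun v : T => v.2.1) <;> fun_prop
  have h2 := isCompact_range hc
  convert h2 using 1
  ext h
  constructor
  · rintro ⟨A, hA, rfl⟩
    refine ⟨⟨(A 0 0, A 0 1, A 1 0, A 1 1), sl2_det A, ?_⟩, ?_⟩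
    · exact ⟨abs_le.1 (hA _ _), abs_le.1 (hA _ _), abs_le.1 (hA _ _), abs_le.1 (hA _ _)⟩
    · simp only
      congr 1
      apply sl2_ext <;> rfl
  · rintro ⟨⟨v, hv1, hv2⟩, rfl⟩
    refine ⟨_, ?_, rfl⟩
    intro i j
    rw [abs_le]
    obtain ⟨h1, h2, h3, h4⟩ := hv2
    fin_cases i <;> fin_cases j
    · exact h1
    · exact h2
    · exact h3
    · exact h4

lemma compact_dist (x y : ℍ) (C : ℝ) : ∃ K : Set PSL2, IsCompact K ∧
    ∀ h : PSL2, dist (h • x) y ≤ C → h ∈ K := by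
  obtain ⟨g, hg⟩ := sl2_transI x
  obtain ⟨g', hg'⟩ := sl2_transI y
  let B := 2 * Real.cosh C + 1
  refine ⟨(fun k => g' * k * g⁻¹) '' (pmk '' {A : SL2 | ∀ i j, |A i j| ≤ B}),
    (compact_box B).image (by fun_prop), ?_⟩
  intro h hh
  refine ⟨g'⁻¹ * h * g, ?_, by group⟩
  obtain ⟨A, hA⟩ := pmk_surj (g'⁻¹ * h * g)
  refine ⟨A, ?_, hA⟩
  have h1 : dist (A • vert 0) (vert 0) ≤ C := by
    rw [← pmk_smul, hA, mul_smul, mul_smul, hg, pdist_inv, hg']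
    exact hh
  have h2 : Real.cosh (dist (A • vert 0) (vert 0)) ≤ Real.cosh C := by
    rw [Real.cosh_le_cosh, abs_of_nonneg dist_nonneg]
    exact h1.trans (le_abs_self _)
  rw [cosh_dist_I] at h2
  intro i j
  have h3 : A i j ^ 2 ≤ 2 * Real.cosh C := by
    have := sq_nonneg (A 0 0)
    have := sq_nonneg (A 0 1)
    have := sq_nonneg (A 1 0)
    have := sq_nonneg (A 1 1)
    fin_cases i <;> fin_cases j <;> simp <;> linarith
  have := Real.one_le_cosh C
  apply abs_le_of_sq_le_sq _ (by positivity)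
  change _ ≤ (2 * Real.cosh C + 1) ^ 2
  nlinarith

lemma cosh_contr {d d' κ : ℝ} (hd : 0 ≤ d) (hd' : 0 ≤ d') (hκ : 0 ≤ κ)
    (h : Real.cosh d' ≤ Real.exp (-κ) * Real.cosh d) : d' ≤ d - κ := by
  have e1 : Real.exp (-κ) * Real.cosh d = (Real.exp (d - κ) + Real.exp (-d - κ)) / 2 := by
    rw [Real.cosh_eq, show d - κ = -κ + d by ring, show -d - κ = -κ + -d by ring, Real.exp_add,
      Real.exp_add]; ring
  rw [e1] at h
  rcases lt_or_ge d κ with hlt | hge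
  · exfalso
    have h1 := Real.one_le_cosh d'
    have h2 : Real.exp (d - κ) < 1 := Real.exp_lt_one_iff.2 (by linarith)
    have h3 : Real.exp (-d - κ) ≤ 1 := Real.exp_le_one_iff.2 (by linarith)
    linarith
  · have h4 : Real.exp (-d - κ) ≤ Real.exp (-(d - κ)) := Real.exp_le_exp.2 (by linarith)
    have h5 : Real.cosh d' ≤ Real.cosh (d - κ) := by
      rw [Real.cosh_eq (d - κ)]; linarith
    rw [Real.cosh_le_cosh, abs_of_nonneg hd', abs_of_nonneg (by linarith)] at h5
    exact h5

def rot (θ : ℝ) : SL2 := mkSL (Real.cos θ) (-Real.sin θ) (Real.sin θ) (Real.cos θ) (by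
  have := Real.sin_sq_add_cos_sq θ; nlinarith)

lemma rot_vert0 (θ : ℝ) : rot θ • vert 0 = vert 0 := by
  have h := Real.sin_sq_add_cos_sq θ
  apply uhp_ext
  · rw [smul_re]; simp [rot]; ring_nf; simp
  · rw [smul_im]; simp [rot, den]

lemma vert_of_re {z : ℍ} (h : z.re = 0) : z = vert (Real.log z.im) := by
  apply uhp_ext
  · rw [h, vert_re]
  · rw [vert_im, Real.exp_log z.im_pos]

lemma two_point (z w : ℍ) : ∃ h : PSL2, h • z = vert 0 ∧ h • w = vert (dist z w) := by
  obtain ⟨g, hg⟩ := sl2_transI z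
  set w' := g⁻¹ • w with hw'
  have hcont : Continuous (fun θ : ℝ => (rot θ • w').re) := by
    have : (fun θ : ℝ => (rot θ • w').re) = fun θ => ((Real.cos θ * w'.re + -Real.sin θ) *
      (Real.sin θ * w'.re + Real.cos θ) + Real.cos θ * Real.sin θ * w'.im ^ 2) /
      ((Real.sin θ * w'.re + Real.cos θ) ^ 2 + (Real.sin θ * w'.im) ^ 2) := by
      funext θ; rw [smul_re]; simp [rot, den]
    rw [this]
    apply Continuous.div (by fun_prop) (by fun_prop)
    intro θ
    exact (den_pos (rot θ) w').ne'
  have h0 : (rot 0 • w').re = w'.re := by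
    rw [smul_re]; simp [rot, den]
  have h1 : (rot (Real.pi / 2) • w').re = - w'.re / nsq w' := by
    rw [smul_re]; simp [rot, den, nsq]
  have hex : ∃ θ : ℝ, (rot θ • w').re = 0 := by
    have hn := nsq_pos w'
    have hp : (0 : ℝ) ≤ Real.pi / 2 := by positivity
    rcases le_total 0 w'.re with hr | hr
    · have : (0 : ℝ) ∈ Set.Icc ((rot (Real.pi / 2) • w').re) ((rot 0 • w').re) := by
        rw [h0, h1]; refine ⟨?_, hr⟩
        exact div_nonpos_of_nonpos_of_nonneg (by linarith) hn.le
      obtain ⟨θ, _, hθ⟩ := intermediate_value_Icc' hp hcont.continuousOn this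
      exact ⟨θ, hθ⟩
    · have : (0 : ℝ) ∈ Set.Icc ((rot 0 • w').re) ((rot (Real.pi / 2) • w').re) := by
        rw [h0, h1]; refine ⟨hr, ?_⟩
        exact div_nonneg (by linarith) hn.le
      obtain ⟨θ, _, hθ⟩ := intermediate_value_Icc hp hcont.continuousOn this
      exact ⟨θ, hθ⟩
  obtain ⟨θ, hθ⟩ := hex
  have e := vert_of_re hθ
  set t := Real.log (rot θ • w').im
  have hz : (pmk (rot θ) * g⁻¹) • z = vert 0 := by
    rw [mul_smul, ← hg, inv_smul_smul, pmk_smul, rot_vert0]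
  have hw : (pmk (rot θ) * g⁻¹) • w = vert t := by
    rw [mul_smul, ← hw', pmk_smul, e]
  have hdist : dist z w = |t| := by
    rw [← pdist (pmk (rot θ) * g⁻¹), hz, hw, vert_isometry.dist_eq, Real.dist_eq]
    simp
  rcases le_total 0 t with ht | ht
  · refine ⟨_, hz, ?_⟩
    rw [hw, hdist, abs_of_nonneg ht]
  · refine ⟨pmk wSL * (pmk (rot θ) * g⁻¹), ?_, ?_⟩
    · rw [mul_smul, hz, pmk_smul, wSL_vert, neg_zero]
    · rw [mul_smul, hw, pmk_smul, wSL_vert, hdist, abs_of_nonpos ht]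

lemma isometry_eq (γ : ℝ → ℍ) (hγ : Isometry γ) : ∃ h : PSL2, ∀ t, γ t = h • vert t := by
  obtain ⟨k, hk0, hk1⟩ := two_point (γ 0) (γ 1)
  have hd : dist (γ 0) (γ 1) = 1 := by rw [hγ.dist_eq]; simp
  rw [hd] at hk1
  refine ⟨k⁻¹, fun t => ?_⟩
  rw [eq_inv_smul_iff]
  set q := k • γ t with hq
  have d0 : Real.cosh (dist q (vert 0)) = Real.cosh t := by
    rw [hq, ← hk0, pdist, hγ.dist_eq, Real.dist_eq, Real.cosh_abs, sub_zero]
  have d1 : Real.cosh (dist q (vert 1)) = Real.cosh (t - 1) := by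
    rw [hq, ← hk1, pdist, hγ.dist_eq, Real.dist_eq, Real.cosh_abs]
  rw [cosh_dist_vert] at d0 d1
  have hy := q.im_pos
  rw [Real.cosh_eq] at d0 d1
  simp only [neg_zero, Real.exp_zero, one_mul] at d0
  rw [show -(t - 1) = -t + 1 by ring, show t - 1 = t + -1 by ring, Real.exp_add, Real.exp_add] at d1
  have he : Real.exp (-1) * Real.exp 1 = 1 := by rw [← Real.exp_add]; simp
  have he1 : (1 : ℝ) < Real.exp 1 := by simp
  have het : Real.exp t * Real.exp (-t) = 1 := by rw [← Real.exp_add]; simp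
  set a := Real.exp 1
  set b := Real.exp (-1)
  set u := Real.exp t with hu
  set v := Real.exp (-t)
  have hb : b < 1 := by nlinarith
  rw [div_eq_div_iff (by positivity) (by norm_num)] at d0 d1
  have f1 : nsq q + 1 = (u + v) * q.im := by linarith
  have f2 : b * nsq q + a = (u * b + v * a) * q.im := by linarith
  have f3 : (a - b) * 1 = (a - b) * (v * q.im) := by linear_combination f2 - b * f1
  have f4 : 1 = v * q.im := mul_left_cancel₀ (by linarith) f3
  have f5 : q.im = u := by
    calc q.im = (u * v) * q.im := by rw [het]; ring
      _ = u * (v * q.im) := by ring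
      _ = u := by rw [← f4]; ring
  have f6 : nsq q = u * q.im := by linarith
  apply uhp_ext
  · rw [vert_re]
    unfold nsq at f6
    rw [f5] at f6
    have : q.re ^ 2 = 0 := by linarith [f6]
    exact pow_eq_zero_iff (two_ne_zero) |>.1 this
  · rw [f5, vert_im]


/-! ### Lines, endpoints and the standard crooked plane -/

def lineOf (h : PSL2) : Set ℍ := Set.range (fun t => h • vert t)

lemma lineOf_isom (h : PSL2) : Isometry (fun t => h • vert t) :=
  (isometry_smul ℍ h).comp vert_isometry

lemma lineOf_geod (h : PSL2) : IsGeodesicLine (lineOf h) := ⟨_, lineOf_isom h, rfl⟩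

lemma geod_lineOf {l : Set ℍ} (hl : IsGeodesicLine l) : ∃ h, l = lineOf h := by
  obtain ⟨γ, hγ, rfl⟩ := hl
  obtain ⟨h, hh⟩ := isometry_eq γ hγ
  exact ⟨h, by unfold lineOf; congr 1; funext t; exact hh t⟩

lemma re_vert (A : SL2) (t : ℝ) : (A • vert t).re =
    (A 0 0 * A 1 0 * Real.exp t ^ 2 + A 0 1 * A 1 1) / den A (vert t) := by
  rw [smul_re]; simp; ring

lemma re_vert_zero {A : SL2} (h : ∀ t, (A • vert t).re = 0) :
    A 0 0 * A 1 0 = 0 ∧ A 0 1 * A 1 1 = 0 := by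
  have h0 : ∀ t, A 0 0 * A 1 0 * Real.exp t ^ 2 + A 0 1 * A 1 1 = 0 := by
    intro t
    have := h t
    rw [re_vert, div_eq_zero_iff] at this
    exact this.resolve_right (den_pos _ _).ne'
  have a := h0 0
  have b := h0 1
  have he1 : (1 : ℝ) < Real.exp 1 := by simp
  simp only [Real.exp_zero] at a
  have : A 0 0 * A 1 0 * (Real.exp 1 ^ 2 - 1) = 0 := by linear_combination b - a
  have h3 : Real.exp 1 ^ 2 - 1 ≠ 0 := by nlinarith
  have h4 := (mul_eq_zero.1 this).resolve_right h3
  exact ⟨h4, by rw [h4] at a; linarith⟩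

lemma diag_or_anti {A : SL2} (h1 : A 0 0 * A 1 0 = 0) (h2 : A 0 1 * A 1 1 = 0) :
    (A 1 0 = 0 ∧ A 0 1 = 0) ∨ (A 0 0 = 0 ∧ A 1 1 = 0) := by
  have hd := sl2_det A
  rcases mul_eq_zero.1 h1 with h | h
  · right
    refine ⟨h, ?_⟩
    rcases mul_eq_zero.1 h2 with h' | h'
    · rw [h, h'] at hd; simp at hd
    · exact h'
  · left
    refine ⟨h, ?_⟩
    rcases mul_eq_zero.1 h2 with h' | h'
    · exact h'
    · rw [h, h'] at hd; simp at hd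

lemma lineOf_eq {A B : SL2} (h : lineOf (pmk A) = lineOf (pmk B)) :
    ((A⁻¹ * B) 1 0 = 0 ∧ (A⁻¹ * B) 0 1 = 0) ∨ ((A⁻¹ * B) 0 0 = 0 ∧ (A⁻¹ * B) 1 1 = 0) := by
  have : ∀ t, ((A⁻¹ * B) • vert t).re = 0 := by
    intro t
    have : pmk B • vert t ∈ lineOf (pmk A) := by rw [h]; exact ⟨t, rfl⟩
    obtain ⟨s, hs⟩ := this
    simp only [pmk_smul] at hs
    rw [mul_smul, ← hs, inv_smul_smul, vert_re]
  obtain ⟨h1, h2⟩ := re_vert_zero this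
  exact diag_or_anti h1 h2

def dirpt (a c : ℝ) : OnePoint ℝ := if c = 0 then OnePoint.infty else ((a / c : ℝ) : OnePoint ℝ)

lemma bvec_infty : bvec OnePoint.infty = ![1, 0] := rfl
lemma bvec_coe (r : ℝ) : bvec (r : OnePoint ℝ) = ![r, 1] := rfl

lemma dirpt_spec {a c : ℝ} (h : a ≠ 0 ∨ c ≠ 0) : ∃ k : ℝ, k ≠ 0 ∧ a = k * bvec (dirpt a c) 0 ∧
    c = k * bvec (dirpt a c) 1 := by
  unfold dirpt
  split_ifs with hc
  · rw [bvec_infty]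
    exact ⟨a, h.resolve_right (by simpa using hc), by simp, by simp [hc]⟩
  · rw [bvec_coe]
    refine ⟨c, hc, ?_, by simp⟩
    simp; field_simp

lemma dirpt_uniq {a c k : ℝ} {ξ : OnePoint ℝ} (hk : k ≠ 0) (h0 : a = k * bvec ξ 0)
    (h1 : c = k * bvec ξ 1) : ξ = dirpt a c := by
  induction ξ using OnePoint.rec with
  | infty =>
    rw [bvec_infty] at h0 h1
    simp at h1
    simp [dirpt, h1]
  | coe r =>
    rw [bvec_coe] at h0 h1
    simp at h0 h1
    unfold dirpt
    rw [if_neg (by rw [h1]; exact hk), h0, h1]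
    congr 1
    field_simp

lemma dirpt_scale {a c k : ℝ} (hk : k ≠ 0) : dirpt (k * a) (k * c) = dirpt a c := by
  unfold dirpt
  by_cases hc : c = 0
  · simp [hc]
  · rw [if_neg hc, if_neg (mul_ne_zero hk hc), mul_div_mul_left _ _ hk]

lemma toC_inj : Function.Injective toC := by
  unfold toC
  exact Option.map_injective Complex.ofReal_injective

lemma lim_vert (A : SL2) : Tendsto (fun t => embH (A • vert t)) atTop
    (𝓝 (toC (dirpt (A 0 0) (A 1 0)))) := by
  have hd := sl2_det A
  have hexp : ∀ t : ℝ, ((vert t : ℍ) : ℂ) = Complex.I * (Real.exp t : ℂ) := by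
    intro t
    apply Complex.ext
    · change (0 : ℝ) = _; simp
    · change Real.exp t = _; rw [Complex.I_mul_im, Complex.ofReal_re]
  have he : ∀ t : ℝ, (Real.exp t : ℂ) * (Real.exp (-t) : ℂ) = 1 := by
    intro t; rw [← Complex.ofReal_mul, ← Real.exp_add]; simp
  unfold dirpt
  split_ifs with hc
  · have h11 : A 1 1 ≠ 0 := by intro h; rw [hc, h] at hd; simp at hd
    have h00 : A 0 0 ≠ 0 := by intro h; rw [hc, h] at hd; simp at hd
    have h1 : toC OnePoint.infty = OnePoint.infty := rfl
    rw [h1]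
    have h2 : Tendsto (fun t => ((A • vert t : ℍ) : ℂ)) atTop (coclosedCompact ℂ) := by
      rw [coclosedCompact_eq_cocompact, ← Metric.cobounded_eq_cocompact]
      apply tendsto_norm_atTop_iff_cobounded.1
      have h3 : Tendsto (fun t => (A • vert t).im) atTop atTop := by
        have : (fun t => (A • vert t).im) = fun t => Real.exp t * (1 / (A 1 1 ^ 2)) := by
          funext t; rw [smul_im]; simp [den, hc]; field_simp
        rw [this]
        exact Tendsto.atTop_mul_const (by positivity) Real.tendsto_exp_atTop
      refine tendsto_atTop_mono (fun t => ?_) h3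
      exact (le_abs_self _).trans (Complex.abs_im_le_norm _)
    exact OnePoint.tendsto_coe_infty.comp h2
  · have h1 : toC ((A 0 0 / A 1 0 : ℝ) : OnePoint ℝ) = (((A 0 0 / A 1 0 : ℝ) : ℂ) : OnePoint ℂ) := rfl
    rw [h1]
    have h2 : Tendsto (fun t => ((A • vert t : ℍ) : ℂ)) atTop (𝓝 ((A 0 0 / A 1 0 : ℝ) : ℂ)) := by
      have e : (fun t => ((A • vert t : ℍ) : ℂ)) = fun t : ℝ =>
          ((A 0 0 : ℂ) * Complex.I + (A 0 1 : ℂ) * (Real.exp (-t) : ℂ)) /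
          ((A 1 0 : ℂ) * Complex.I + (A 1 1 : ℂ) * (Real.exp (-t) : ℂ)) := by
        funext t
        rw [sl2_smul_coe, hexp]
        have hne : (Real.exp (-t) : ℂ) ≠ 0 := by
          rw [Complex.ofReal_ne_zero]; exact (Real.exp_pos _).ne'
        rw [← mul_div_mul_right _ _ hne]
        congr 1
        · linear_combination ((A 0 0 : ℂ) * Complex.I) * he t
        · linear_combination ((A 1 0 : ℂ) * Complex.I) * he t
      rw [e]
      have h3 : Tendsto (fun t : ℝ => (Real.exp (-t) : ℂ)) atTop (𝓝 0) := by
        have := (Complex.continuous_ofReal.tendsto 0).comp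
          (Real.tendsto_exp_neg_atTop_nhds_zero)
        simpa [Function.comp_def] using this
      have h4 : ((A 0 0 / A 1 0 : ℝ) : ℂ) = ((A 0 0 : ℂ) * Complex.I + (A 0 1 : ℂ) * 0) /
          ((A 1 0 : ℂ) * Complex.I + (A 1 1 : ℂ) * 0) := by
        have : (A 1 0 : ℂ) ≠ 0 := Complex.ofReal_ne_zero.2 hc
        have := Complex.I_ne_zero
        push_cast
        field_simp
        simp
        field_simp
      rw [h4]
      apply Tendsto.div
      · exact (tendsto_const_nhds).add (tendsto_const_nhds.mul h3)
      · exact (tendsto_const_nhds).add (tendsto_const_nhds.mul h3)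
      · simp
        exact hc
    exact (OnePoint.continuous_coe.tendsto _).comp h2

lemma lineOf_w (A : SL2) : lineOf (pmk (A * wSL)) = lineOf (pmk A) := by
  ext z
  simp only [lineOf, Set.mem_range, pmk_smul]
  constructor
  · rintro ⟨t, rfl⟩
    exact ⟨-t, by rw [mul_smul, wSL_vert]⟩
  · rintro ⟨t, rfl⟩
    exact ⟨-t, by rw [mul_smul, wSL_vert, neg_neg]⟩

lemma endpoint_iff (A : SL2) (ξ : OnePoint ℝ) : IsEndpoint (lineOf (pmk A)) ξ ↔
    ξ = dirpt (A 0 0) (A 1 0) ∨ ξ = dirpt (A 0 1) (A 1 1) := by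
  constructor
  · rintro ⟨γ, hγ, hr, hlim⟩
    obtain ⟨h, hh⟩ := isometry_eq γ hγ
    obtain ⟨B, rfl⟩ := pmk_surj h
    have hl : lineOf (pmk A) = lineOf (pmk B) := by
      rw [← hr]; unfold lineOf; congr 1; funext t; exact hh t
    have hD := lineOf_eq hl
    have hlim2 := lim_vert B
    have : (fun t => embH (γ t)) = fun t => embH (B • vert t) := by
      funext t; rw [hh t, pmk_smul]
    rw [this] at hlim
    have hξ := toC_inj (tendsto_nhds_unique hlim hlim2)
    have hB : B = A * (A⁻¹ * B) := by group
    have hdd := sl2_det (A⁻¹ * B)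
    have e0 : B 0 0 = A 0 0 * (A⁻¹ * B) 0 0 + A 0 1 * (A⁻¹ * B) 1 0 := by
      conv_lhs => rw [hB]
      rw [sl2_mul_00]
    have e1 : B 1 0 = A 1 0 * (A⁻¹ * B) 0 0 + A 1 1 * (A⁻¹ * B) 1 0 := by
      conv_lhs => rw [hB]
      rw [sl2_mul_10]
    rcases hD with ⟨h1, h2⟩ | ⟨h1, h2⟩
    · left
      rw [h1] at e0 e1 hdd
      rw [hξ, e0, e1, mul_zero, add_zero, mul_zero, add_zero, mul_comm (A 0 0), mul_comm (A 1 0),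
        dirpt_scale]
      intro h; rw [h] at hdd; simp at hdd
    · right
      rw [h1] at e0 e1 hdd
      rw [hξ, e0, e1, mul_zero, zero_add, mul_zero, zero_add, mul_comm (A 0 1), mul_comm (A 1 1),
        dirpt_scale]
      intro h; rw [h] at hdd; simp at hdd
  · rintro (rfl | rfl)
    · refine ⟨_, lineOf_isom (pmk A), rfl, ?_⟩
      simp only [pmk_smul]
      exact lim_vert A
    · refine ⟨_, lineOf_isom (pmk (A * wSL)), lineOf_w A, ?_⟩
      simp only [pmk_smul]
      have := lim_vert (A * wSL)
      simpa [wSL] using this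

/-- matrices in the standard crooked plane -/
def isC0 (A : SL2) : Prop := (∃ y > 0, A 0 0 = A 1 1 ∧ A 0 1 = - A 1 0 * y ^ 2) ∨
  (A 1 0 = 0 ∧ |A 0 0| ≤ 1) ∨ (A 0 1 = 0 ∧ |A 1 1| ≤ 1)

lemma isC0_neg {A : SL2} (h : isC0 A) : isC0 (-A) := by
  unfold isC0 at *
  simp only [sl2_neg_entry, abs_neg, neg_eq_zero, neg_inj]
  rcases h with ⟨y, hy, h1, h2⟩ | h | h
  · left; exact ⟨y, hy, h1, by rw [h2]; ring⟩
  · right; left; exact h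
  · right; right; exact h

def C0 : Set PSL2 := {h | ∃ A, pmk A = h ∧ isC0 A}

lemma mem_C0 (A : SL2) : pmk A ∈ C0 ↔ isC0 A := by
  constructor
  · rintro ⟨B, hB, h⟩
    rcases (pmk_eq_iff _ _).1 hB with h' | h'
    · rw [h']; exact h
    · rw [h']; exact isC0_neg h
  · intro h; exact ⟨A, rfl, h⟩

lemma fix_vert (K : SL2) (t : ℝ) : K • vert t = vert t ↔
    K 0 0 = K 1 1 ∧ K 0 1 = - K 1 0 * Real.exp t ^ 2 := by
  have hd := sl2_det K
  have hy := Real.exp_pos t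
  have hp := den_pos K (vert t)
  have hden : den K (vert t) = K 1 0 ^ 2 * Real.exp t ^ 2 + K 1 1 ^ 2 := by simp [den]; ring
  constructor
  · intro h
    have hre : (K • vert t).re = 0 := by rw [h]; rfl
    have him : (K • vert t).im = Real.exp t := by rw [h]; rfl
    rw [re_vert, div_eq_zero_iff] at hre
    have h1 := hre.resolve_right hp.ne'
    rw [smul_im, div_eq_iff hp.ne', vert_im, hden] at him
    have h2 : K 1 0 ^ 2 * Real.exp t ^ 2 + K 1 1 ^ 2 = 1 := by
      have : Real.exp t * (K 1 0 ^ 2 * Real.exp t ^ 2 + K 1 1 ^ 2) = Real.exp t * 1 := by linarith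
      exact mul_left_cancel₀ hy.ne' this
    constructor
    · linear_combination (-K 0 0) * h2 + K 1 1 * hd + K 1 0 * h1
    · linear_combination (-K 0 1) * h2 - K 1 0 * Real.exp t ^ 2 * hd + K 1 1 * h1
  · rintro ⟨h1, h2⟩
    have h3 : den K (vert t) = 1 := by
      rw [hden]; rw [h1, h2] at hd; linarith
    apply uhp_ext
    · rw [re_vert, h3, h1, h2]; simp; ring
    · rw [smul_im, h3]; simp

lemma mulVec_zero (A : SL2) (v : Fin 2 → ℝ) :
    (A : Matrix (Fin 2) (Fin 2) ℝ).mulVec v 0 = A 0 0 * v 0 + A 0 1 * v 1 := by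
  simp [Matrix.mulVec, dotProduct, Fin.sum_univ_two]
lemma mulVec_one (A : SL2) (v : Fin 2 → ℝ) :
    (A : Matrix (Fin 2) (Fin 2) ℝ).mulVec v 1 = A 1 0 * v 0 + A 1 1 * v 1 := by
  simp [Matrix.mulVec, dotProduct, Fin.sum_univ_two]

lemma nonattr_dirpt {A : SL2} {a c : ℝ} (h : a ≠ 0 ∨ c ≠ 0) (μ : ℝ) :
    (A : Matrix (Fin 2) (Fin 2) ℝ).mulVec (bvec (dirpt a c)) = μ • bvec (dirpt a c) ↔
    A 0 0 * a + A 0 1 * c = μ * a ∧ A 1 0 * a + A 1 1 * c = μ * c := by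
  obtain ⟨k, hk, h0, h1⟩ := dirpt_spec h
  set v := bvec (dirpt a c)
  constructor
  · intro h
    have e0 := congrFun h 0
    have e1 := congrFun h 1
    rw [mulVec_zero] at e0
    rw [mulVec_one] at e1
    simp at e0 e1
    rw [h0, h1]
    exact ⟨by linear_combination k * e0, by linear_combination k * e1⟩
  · rintro ⟨e0, e1⟩
    rw [h0, h1] at e0 e1
    funext i
    fin_cases i
    · change (A : Matrix (Fin 2) (Fin 2) ℝ).mulVec v 0 = (μ • v) 0
      rw [mulVec_zero]
      apply mul_left_cancel₀ hk
      rw [Pi.smul_apply, smul_eq_mul]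
      linear_combination e0
    · change (A : Matrix (Fin 2) (Fin 2) ℝ).mulVec v 1 = (μ • v) 1
      rw [mulVec_one]
      apply mul_left_cancel₀ hk
      rw [Pi.smul_apply, smul_eq_mul]
      linear_combination e1

lemma mem_rightCrooked (M : PSL2) (h : PSL2) :
    h ∈ rightCrooked (lineOf M) ↔ M⁻¹ * h * M ∈ C0 := by
  obtain ⟨M, rfl⟩ := pmk_surj M
  obtain ⟨H, rfl⟩ := pmk_surj h
  have hM := sl2_det M
  have hH := sl2_det H
  have hc1 : M 0 0 ≠ 0 ∨ M 1 0 ≠ 0 := by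
    by_contra hh; push Not at hh; rw [hh.1, hh.2] at hM; simp at hM
  have hc2 : M 0 1 ≠ 0 ∨ M 1 1 ≠ 0 := by
    by_contra hh; push Not at hh; rw [hh.1, hh.2] at hM; simp at hM
  rw [← pmk_inv, ← pmk_mul, ← pmk_mul, mem_C0]
  have a00 : (M⁻¹ * H * M) 0 0 = M 1 1 * (H 0 0 * M 0 0 + H 0 1 * M 1 0) -
    M 0 1 * (H 1 0 * M 0 0 + H 1 1 * M 1 0) := by simp; ring
  have a01 : (M⁻¹ * H * M) 0 1 = M 1 1 * (H 0 0 * M 0 1 + H 0 1 * M 1 1) -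
    M 0 1 * (H 1 0 * M 0 1 + H 1 1 * M 1 1) := by simp; ring
  have a10 : (M⁻¹ * H * M) 1 0 = -M 1 0 * (H 0 0 * M 0 0 + H 0 1 * M 1 0) +
    M 0 0 * (H 1 0 * M 0 0 + H 1 1 * M 1 0) := by simp; ring
  have a11 : (M⁻¹ * H * M) 1 1 = -M 1 0 * (H 0 0 * M 0 1 + H 0 1 * M 1 1) +
    M 0 0 * (H 1 0 * M 0 1 + H 1 1 * M 1 1) := by simp; ring
  have hfix : ∀ t, pslSMul (pmk H) (pmk M • vert t) = pmk M • vert t ↔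
      (M⁻¹ * H * M) • vert t = vert t := by
    intro t
    rw [pslSMul_pmk, pmk_smul, mul_smul, mul_smul, inv_smul_eq_iff]
  have hna : ∀ ξ, HasNonattracting (pmk H) ξ ↔ ∃ μ : ℝ, |μ| ≤ 1 ∧
      (H : Matrix (Fin 2) (Fin 2) ℝ).mulVec (bvec ξ) = μ • bvec ξ := by
    intro ξ
    constructor
    · rintro ⟨A, hA, μ, hμ, he⟩
      rcases (pmk_eq_iff _ _).1 hA with h' | h'
      · rw [h']; exact ⟨μ, hμ, he⟩
      · rw [h']
        refine ⟨-μ, by rwa [abs_neg], ?_⟩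
        rw [neg_smul, ← he, Matrix.SpecialLinearGroup.coe_neg, Matrix.neg_mulVec]
    · rintro ⟨μ, hμ, he⟩
      exact ⟨H, rfl, μ, hμ, he⟩
  constructor
  · rintro (⟨x, ⟨t, rfl⟩, hx⟩ | ⟨ξ, hξ, hn⟩)
    · simp only at hx
      rw [hfix, fix_vert] at hx
      exact Or.inl ⟨_, Real.exp_pos t, hx⟩
    · rw [hna] at hn
      obtain ⟨μ, hμ, he⟩ := hn
      right
      rcases (endpoint_iff M ξ).1 hξ with rfl | rfl
      · left
        obtain ⟨e0, e1⟩ := (nonattr_dirpt hc1 μ).1 he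
        rw [a10, a00, e0, e1]
        refine ⟨by ring, ?_⟩
        have : M 1 1 * (μ * M 0 0) - M 0 1 * (μ * M 1 0) = μ := by linear_combination μ * hM
        rwa [this]
      · right
        obtain ⟨e0, e1⟩ := (nonattr_dirpt hc2 μ).1 he
        rw [a01, a11, e0, e1]
        refine ⟨by ring, ?_⟩
        have : -M 1 0 * (μ * M 0 1) + M 0 0 * (μ * M 1 1) = μ := by linear_combination μ * hM
        rwa [this]
  · rintro (⟨y, hy, h1, h2⟩ | ⟨h1, h2⟩ | ⟨h1, h2⟩)
    · left
      refine ⟨_, ⟨Real.log y, rfl⟩, ?_⟩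
      simp only
      rw [hfix, fix_vert, Real.exp_log hy]
      exact ⟨h1, h2⟩
    · right
      refine ⟨_, (endpoint_iff M _).2 (Or.inl rfl), ?_⟩
      rw [hna]
      refine ⟨_, h2, ?_⟩
      rw [nonattr_dirpt hc1]
      rw [a10] at h1
      rw [a00]
      constructor
      · linear_combination (M 0 1) * h1 - (H 0 0 * M 0 0 + H 0 1 * M 1 0) * hM
      · linear_combination (M 1 1) * h1 - (H 1 0 * M 0 0 + H 1 1 * M 1 0) * hM
    · right
      refine ⟨_, (endpoint_iff M _).2 (Or.inr rfl), ?_⟩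
      rw [hna]
      refine ⟨_, h2, ?_⟩
      rw [nonattr_dirpt hc2]
      rw [a01] at h1
      rw [a11]
      constructor
      · linear_combination (M 0 0) * h1 - (H 0 0 * M 0 1 + H 0 1 * M 1 1) * hM
      · linear_combination (M 1 0) * h1 - (H 1 0 * M 0 1 + H 1 1 * M 1 1) * hM


/-! ### Half spaces -/

def Lens (q z : ℍ) : Prop := z.im < q.im ∧ nsq q / q.im < nsq z / z.im

def LN (a b c d x y : ℝ) : Prop :=
  (c * x + d) ^ 2 + (c * y) ^ 2 < 1 ∧ (a * x + b) ^ 2 + (a * y) ^ 2 < x ^ 2 + y ^ 2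

lemma lens_smul (A : SL2) (z : ℍ) :
    Lens (A • z) z ↔ LN (A 0 0) (A 0 1) (A 1 0) (A 1 1) z.re z.im := by
  have hp := den_pos A z
  have hz := z.im_pos
  unfold Lens LN
  rw [smul_im, smul_nsq]
  have e1 : z.im < z.im / den A z ↔ den A z < 1 := by
    rw [lt_div_iff₀ hp]
    constructor
    · intro h; nlinarith
    · intro h; nlinarith
  have e2 : nume A z / den A z / (z.im / den A z) = nume A z / z.im := by
    field_simp
  rw [e1, e2, div_lt_div_iff_of_pos_right hz]
  rfl

def Hs (s : ℝ) : Set PSL2 := {k | ∃ z : ℍ, 0 < s * z.re ∧ Lens (k • z) z}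

lemma Hs_iff (s : ℝ) (A : SL2) : pmk A ∈ Hs s ↔
    ∃ x y : ℝ, 0 < s * x ∧ 0 < y ∧ LN (A 0 0) (A 0 1) (A 1 0) (A 1 1) x y := by
  constructor
  · rintro ⟨z, hz, hl⟩
    rw [pmk_smul, lens_smul] at hl
    exact ⟨z.re, z.im, hz, z.im_pos, hl⟩
  · rintro ⟨x, y, hx, hy, hl⟩
    refine ⟨⟨⟨x, y⟩, hy⟩, hx, ?_⟩
    rw [pmk_smul, lens_smul]
    exact hl

lemma Hs_congr {s s' : ℝ} (h : 0 < s * s') : Hs s = Hs s' := by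
  have key : ∀ x : ℝ, 0 < s * x ↔ 0 < s' * x := by
    intro x
    rcases mul_pos_iff.1 h with ⟨h1, h2⟩ | ⟨h1, h2⟩
    · rw [mul_pos_iff_of_pos_left h1, mul_pos_iff_of_pos_left h2]
    · constructor <;> intro h3 <;> nlinarith
  ext k
  simp only [Hs, Set.mem_ofPred_eq, key]

lemma Hs_open (s : ℝ) : IsOpen (Hs s) := by
  have : Hs s = ⋃ z ∈ {z : ℍ | 0 < s * z.re}, {k : PSL2 | Lens (k • z) z} := by
    ext k; simp [Hs]
  rw [this]
  apply isOpen_biUnion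
  intro z _
  have hq : IsQuotientMap (pmk) := isQuotientMap_quot_mk
  rw [← hq.isOpen_preimage]
  have : pmk ⁻¹' {k : PSL2 | Lens (k • z) z} = {A : SL2 | LN (A 0 0) (A 0 1) (A 1 0) (A 1 1) z.re z.im} := by
    ext A
    simp only [Set.mem_preimage, Set.mem_ofPred_eq, pmk_smul, lens_smul]
  rw [this]
  have c00 := sl2_cont_entry 0 0
  have c01 := sl2_cont_entry 0 1
  have c10 := sl2_cont_entry 1 0
  have c11 := sl2_cont_entry 1 1
  have k1 : Continuous (fun A : SL2 => (A 1 0 * z.re + A 1 1) ^ 2 + (A 1 0 * z.im) ^ 2) :=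
    (((c10.mul continuous_const).add c11).pow 2).add ((c10.mul continuous_const).pow 2)
  have k2 : Continuous (fun A : SL2 => (A 0 0 * z.re + A 0 1) ^ 2 + (A 0 0 * z.im) ^ 2) :=
    (((c00.mul continuous_const).add c01).pow 2).add ((c00.mul continuous_const).pow 2)
  exact (isOpen_lt k1 continuous_const).inter (isOpen_lt k2 continuous_const)

lemma LN_swap {a b c d x y : ℝ} (hy : 0 < y) (h : LN a b c d x y) :
    LN d c b a (x / (x ^ 2 + y ^ 2)) (y / (x ^ 2 + y ^ 2)) := by
  have hN : 0 < x ^ 2 + y ^ 2 := by positivity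
  obtain ⟨h1, h2⟩ := h
  constructor
  · have : (b * (x / (x ^ 2 + y ^ 2)) + a) ^ 2 + (b * (y / (x ^ 2 + y ^ 2))) ^ 2 =
      ((a * x + b) ^ 2 + (a * y) ^ 2) / (x ^ 2 + y ^ 2) := by field_simp; ring
    rw [this, div_lt_one hN]; exact h2
  · have e1 : (d * (x / (x ^ 2 + y ^ 2)) + c) ^ 2 + (d * (y / (x ^ 2 + y ^ 2))) ^ 2 =
      ((c * x + d) ^ 2 + (c * y) ^ 2) / (x ^ 2 + y ^ 2) := by field_simp; ring
    have e2 : (x / (x ^ 2 + y ^ 2)) ^ 2 + (y / (x ^ 2 + y ^ 2)) ^ 2 = 1 / (x ^ 2 + y ^ 2) := by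
      field_simp
    rw [e1, e2]
    exact div_lt_div_of_pos_right h1 hN

/-- sign condition for the positive half space -/
def SG (a b c d : ℝ) : Prop := (d < a ∧ b < 0) ∨ (a < d ∧ c < 0) ∨ (a = d ∧ b < 0 ∧ c < 0)

lemma LN_sign_aux {a b c d x y : ℝ} (hd : a * d - b * c = 1) (ht : 0 ≤ a + d) (hx : 0 < x)
    (hy : 0 < y) (h : LN a b c d x y) (hb : 0 ≤ b) (hc : c < 0) : a < d := by
  by_contra hda
  push Not at hda
  obtain ⟨h1, h2⟩ := h
  have ha : 0 ≤ a := by linarith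
  have hN : 0 < x ^ 2 + y ^ 2 := by positivity
  have hab : 0 ≤ a * b * x := by positivity
  have ha2 : a ^ 2 < 1 := by
    by_contra hh
    push Not at hh
    nlinarith [sq_nonneg b]
  have k1 : 0 < c ^ 2 * (x ^ 2 + y ^ 2 - ((a * x + b) ^ 2 + (a * y) ^ 2)) :=
    mul_pos (by have := hc.ne; positivity) (by linarith)
  have k2 : 0 < (1 - a ^ 2) * (1 - ((c * x + d) ^ 2 + (c * y) ^ 2)) :=
    mul_pos (by linarith) (by linarith)
  have k3 : 0 ≤ (a - d) * (a - d - 2 * c * x) :=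
    mul_nonneg (by linarith) (by nlinarith)
  have hbc : b * c = a * d - 1 := by linarith
  have k4 : c ^ 2 * (x ^ 2 + y ^ 2 - ((a * x + b) ^ 2 + (a * y) ^ 2)) +
    (1 - a ^ 2) * (1 - ((c * x + d) ^ 2 + (c * y) ^ 2)) = -((a - d) * (a - d - 2 * c * x)) := by
    linear_combination (-2 * c * a * x - (b * c + a * d - 1)) * hbc
  linarith

lemma LN_sign {a b c d x y : ℝ} (hd : a * d - b * c = 1) (ht : 0 ≤ a + d) (hx : 0 < x)
    (hy : 0 < y) (h : LN a b c d x y) : SG a b c d := by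
  have hN : 0 < x ^ 2 + y ^ 2 := by positivity
  rcases lt_or_ge b 0 with hb | hb
  · rcases lt_or_ge c 0 with hc | hc
    · rcases lt_trichotomy a d with h' | h' | h'
      · right; left; exact ⟨h', hc⟩
      · right; right; exact ⟨h', hb, hc⟩
      · left; exact ⟨h', hb⟩
    · left
      refine ⟨LN_sign_aux (by linarith) (by linarith) ?_ ?_ (LN_swap hy h) hc hb, hb⟩ <;> positivity
  · rcases lt_or_ge c 0 with hc | hc
    · right; left
      exact ⟨LN_sign_aux hd ht hx hy h hb hc, hc⟩
    · exfalso
      obtain ⟨h1, h2⟩ := h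
      have had : 1 ≤ a * d := by nlinarith
      have ha : 0 < a := by
        by_contra hh
        push Not at hh
        have : d ≤ 0 ∨ 0 < d := le_or_gt d 0
        rcases this with h' | h'
        · have : a = 0 := by linarith
          rw [this] at had; simp at had; linarith
        · nlinarith
      have hdp : 0 < d := by
        by_contra hh; push Not at hh; nlinarith
      have k1 : 0 ≤ c * d * x := by positivity
      have k2 : 0 ≤ a * b * x := by positivity
      have d1 : d ^ 2 < 1 := by nlinarith [sq_nonneg (c * x), sq_nonneg (c * y)]
      have a1 : a ^ 2 < 1 := by
        by_contra hh
        push Not at hh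
        nlinarith [sq_nonneg b]
      have d2 : d < 1 := by nlinarith
      have a2 : a < 1 := by nlinarith
      nlinarith

lemma sign_LN_aux {a b c d : ℝ} (hd : a * d - b * c = 1) (ht : 0 ≤ a + d) (hda : d < a)
    (hb : b < 0) : ∃ x y : ℝ, 0 < x ∧ 0 < y ∧ LN a b c d x y := by
  have ha : 0 < a := by linarith
  have hr : ∃ r : ℝ, 0 < r ∧ r < 1 ∧ (d ^ 2 - 1) * r ^ 2 - (a - d) * r + 1 - a ^ 2 < 0 := by
    have hc : Continuous (fun r : ℝ => (d ^ 2 - 1) * r ^ 2 - (a - d) * r + 1 - a ^ 2) := by fun_prop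
    have h1 : (d ^ 2 - 1) * (1:ℝ) ^ 2 - (a - d) * 1 + 1 - a ^ 2 < 0 := by nlinarith
    have h2 : ∀ᶠ r in 𝓝 (1:ℝ), (d ^ 2 - 1) * r ^ 2 - (a - d) * r + 1 - a ^ 2 < 0 :=
      hc.continuousAt.eventually_lt continuousAt_const h1
    have h3 : ∀ᶠ r in 𝓝[<] (1:ℝ), (d ^ 2 - 1) * r ^ 2 - (a - d) * r + 1 - a ^ 2 < 0 :=
      nhdsWithin_le_nhds h2
    have h4 : ∀ᶠ r in 𝓝[<] (1:ℝ), r ∈ Set.Ioo (0:ℝ) 1 := Ioo_mem_nhdsLT (by norm_num)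
    obtain ⟨r, hr1, hr2⟩ := (h3.and h4).exists
    exact ⟨r, hr2.1, hr2.2, hr1⟩
  obtain ⟨r, hr0, hr1, hr⟩ := hr
  have h3 : 0 < √3 := by positivity
  have h3' : √3 ^ 2 = 3 := Real.sq_sqrt (by norm_num)
  set Q := a ^ 2 + a * r + r ^ 2 with hQ
  have hQ0 : 0 < Q := by positivity
  refine ⟨-b * (a + r / 2) / Q, -b * (r * √3 / 2) / Q, ?_, ?_, ?_, ?_⟩
  · have : 0 < -b := by linarith
    positivity
  · have : 0 < -b := by linarith
    positivity
  · have e : (c * (-b * (a + r / 2) / Q) + d) ^ 2 + (c * (-b * (r * √3 / 2) / Q)) ^ 2 =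
      1 + ((d ^ 2 - 1) * r ^ 2 - (a - d) * r + 1 - a ^ 2) / Q := by
      have hbc : b * c = a * d - 1 := by linarith
      have e1 : c * (-b * (a + r / 2) / Q) = -(a * d - 1) * (a + r / 2) / Q := by
        rw [← hbc]; ring
      have e2 : c * (-b * (r * √3 / 2) / Q) = -(a * d - 1) * (r * √3 / 2) / Q := by
        rw [← hbc]; ring
      rw [e1, e2]
      field_simp
      rw [h3', hQ]
      ring
    rw [e]
    have : ((d ^ 2 - 1) * r ^ 2 - (a - d) * r + 1 - a ^ 2) / Q < 0 := div_neg_of_neg_of_pos hr hQ0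
    linarith
  · have e1 : (-b * (a + r / 2) / Q) ^ 2 + (-b * (r * √3 / 2) / Q) ^ 2 = b ^ 2 / Q := by
      field_simp
      rw [h3', hQ]
      ring
    have e2 : (a * (-b * (a + r / 2) / Q) + b) ^ 2 + (a * (-b * (r * √3 / 2) / Q)) ^ 2 =
        r ^ 2 * (b ^ 2 / Q) := by
      field_simp
      rw [h3', hQ]
      ring
    rw [e1, e2]
    have : 0 < b ^ 2 / Q := by have : b ≠ 0 := hb.ne; positivity
    have h5 : r ^ 2 < 1 := by nlinarith
    exact mul_lt_of_lt_one_left this h5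

lemma sign_LN {a b c d : ℝ} (hd : a * d - b * c = 1) (ht : 0 ≤ a + d) (h : SG a b c d) :
    ∃ x y : ℝ, 0 < x ∧ 0 < y ∧ LN a b c d x y := by
  rcases h with ⟨h, hb⟩ | ⟨h, hc⟩ | ⟨h, hb, hc⟩
  · exact sign_LN_aux hd ht h hb
  · obtain ⟨x, y, hx, hy, hl⟩ := sign_LN_aux (a := d) (b := c) (c := b) (d := a) (by linarith)
      (by linarith) h hc
    exact ⟨_, _, by positivity, by positivity, LN_swap hy hl⟩
  · subst h
    have hbc : 0 < b * c := mul_pos_of_neg_of_neg hb hc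
    have ha : 1 < a := by nlinarith
    set x := √(b / c) with hxdef
    have hbcd : 0 < b / c := div_pos_of_neg_of_neg hb hc
    have hx : 0 < x := by positivity
    have hx2 : x ^ 2 = b / c := Real.sq_sqrt hbcd.le
    have hb' : b = c * x ^ 2 := by have := hc.ne; rw [hx2]; field_simp
    have hcx : 0 < -(c * x) := by nlinarith
    have hcx2 : (c * x) ^ 2 = a ^ 2 - 1 := by nlinarith
    have g1 : c * x + a < 1 := by nlinarith
    have g0 : 0 < c * x + a := by nlinarith
    have f1 : (c * x + a) ^ 2 < 1 := by nlinarith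
    have f2 : (a * x + b) ^ 2 < x ^ 2 := by
      have : (a * x + b) ^ 2 = x ^ 2 * (c * x + a) ^ 2 := by rw [hb']; ring
      rw [this]
      nlinarith [sq_pos_of_pos hx]
    have c1 : Continuous (fun y : ℝ => (c * x + a) ^ 2 + (c * y) ^ 2) := by fun_prop
    have c2 : Continuous (fun y : ℝ => (a * x + b) ^ 2 + (a * y) ^ 2) := by fun_prop
    have c3 : Continuous (fun y : ℝ => x ^ 2 + y ^ 2) := by fun_prop
    have e1 : ∀ᶠ y in 𝓝 (0:ℝ), (c * x + a) ^ 2 + (c * y) ^ 2 < 1 :=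
      c1.continuousAt.eventually_lt continuousAt_const (by simpa using f1)
    have e2 : ∀ᶠ y in 𝓝 (0:ℝ), (a * x + b) ^ 2 + (a * y) ^ 2 < x ^ 2 + y ^ 2 :=
      c2.continuousAt.eventually_lt c3.continuousAt (by simpa using f2)
    have e3 : ∀ᶠ y in 𝓝[>] (0:ℝ), LN a b c a x y := nhdsWithin_le_nhds (e1.and e2)
    have e4 : ∀ᶠ y in 𝓝[>] (0:ℝ), y ∈ Set.Ioi (0:ℝ) := self_mem_nhdsWithin
    obtain ⟨y, hy1, hy2⟩ := (e3.and e4).exists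
    exact ⟨x, y, hx, hy2, hy1⟩

lemma Hs_pos_iff (A : SL2) (ht : 0 ≤ A 0 0 + A 1 1) :
    pmk A ∈ Hs 1 ↔ SG (A 0 0) (A 0 1) (A 1 0) (A 1 1) := by
  rw [Hs_iff]
  constructor
  · rintro ⟨x, y, hx, hy, h⟩
    exact LN_sign (sl2_det A) ht (by linarith) hy h
  · intro h
    obtain ⟨x, y, hx, hy, h⟩ := sign_LN (sl2_det A) ht h
    exact ⟨x, y, by linarith, hy, h⟩

lemma LN_refl {a b c d x y : ℝ} : LN a b c d x y ↔ LN a (-b) (-c) d (-x) y := by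
  unfold LN
  rw [show (-c * -x + d) ^ 2 + (-c * y) ^ 2 = (c * x + d) ^ 2 + (c * y) ^ 2 by ring,
    show (a * -x + -b) ^ 2 + (a * y) ^ 2 = (a * x + b) ^ 2 + (a * y) ^ 2 by ring,
    show (-x) ^ 2 + y ^ 2 = x ^ 2 + y ^ 2 by ring]

lemma Hs_neg_iff (A : SL2) (ht : 0 ≤ A 0 0 + A 1 1) :
    pmk A ∈ Hs (-1) ↔ SG (A 0 0) (-A 0 1) (-A 1 0) (A 1 1) := by
  rw [Hs_iff]
  have hd := sl2_det A
  constructor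
  · rintro ⟨x, y, hx, hy, h⟩
    rw [LN_refl] at h
    exact LN_sign (by linarith) ht (by linarith) hy h
  · intro h
    obtain ⟨x, y, hx, hy, h⟩ := sign_LN (by linarith) ht h
    refine ⟨-x, y, by linarith, hy, ?_⟩
    rw [LN_refl]
    simpa using h

lemma isC0_iff (A : SL2) (ht : 0 ≤ A 0 0 + A 1 1) : isC0 A ↔
    (A 1 1 < A 0 0 ∧ A 0 1 = 0) ∨ (A 0 0 < A 1 1 ∧ A 1 0 = 0) ∨
    (A 0 0 = A 1 1 ∧ A 0 1 * A 1 0 ≤ 0) := by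
  have hd := sl2_det A
  unfold isC0
  constructor
  · rintro (⟨y, hy, h1, h2⟩ | ⟨h1, h2⟩ | ⟨h1, h2⟩)
    · right; right
      refine ⟨h1, ?_⟩
      rw [h2]; nlinarith [sq_nonneg (A 1 0 * y)]
    · rw [h1] at hd
      have := abs_le.1 h2
      have h3 : 0 < A 0 0 := by
        by_contra hh; push Not at hh
        nlinarith
      have h4 : A 0 0 ≤ A 1 1 := by nlinarith
      rcases h4.lt_or_eq with h5 | h5
      · right; left; exact ⟨h5, h1⟩
      · right; right; exact ⟨h5, by rw [h1]; simp⟩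
    · rw [h1] at hd
      have := abs_le.1 h2
      have h3 : 0 < A 1 1 := by
        by_contra hh; push Not at hh
        nlinarith
      have h4 : A 1 1 ≤ A 0 0 := by nlinarith
      rcases h4.lt_or_eq with h5 | h5
      · left; exact ⟨h5, h1⟩
      · right; right; exact ⟨h5.symm, by rw [h1]; simp⟩
  · rintro (⟨h1, h2⟩ | ⟨h1, h2⟩ | ⟨h1, h2⟩)
    · right; right
      refine ⟨h2, ?_⟩
      rw [h2] at hd
      have h3 : 0 < A 1 1 := by
        by_contra hh; push Not at hh
        nlinarith
      rw [abs_of_pos h3]; nlinarith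
    · right; left
      refine ⟨h2, ?_⟩
      rw [h2] at hd
      have h3 : 0 < A 0 0 := by
        by_contra hh; push Not at hh
        nlinarith
      rw [abs_of_pos h3]; nlinarith
    · rcases h2.lt_or_eq with h3 | h3
      · left
        have hc : A 1 0 ≠ 0 := by intro h; rw [h] at h3; simp at h3
        have hpos : 0 < -(A 0 1 / A 1 0) := by
          have : A 0 1 / A 1 0 = (A 0 1 * A 1 0) / (A 1 0) ^ 2 := by field_simp
          rw [this, ← neg_div]
          have : 0 < A 1 0 ^ 2 := by positivity
          apply div_pos (by linarith) this
        refine ⟨√(-(A 0 1 / A 1 0)), by positivity, h1, ?_⟩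
        rw [Real.sq_sqrt hpos.le]; field_simp
      · rw [h1] at hd
        have h4 : A 1 1 ^ 2 = 1 := by linarith
        have h5 : |A 1 1| ≤ 1 := by
          rw [← sq_le_one_iff_abs_le_one, h4]
        rcases mul_eq_zero.1 h3 with h | h
        · right; right; exact ⟨h, h5⟩
        · right; left; exact ⟨h, by rwa [h1]⟩

lemma lift_nonneg (h : PSL2) : ∃ A : SL2, pmk A = h ∧ 0 ≤ A 0 0 + A 1 1 := by
  obtain ⟨A, rfl⟩ := pmk_surj h
  rcases le_total 0 (A 0 0 + A 1 1) with h | h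
  · exact ⟨A, rfl, h⟩
  · refine ⟨-A, pmk_neg A, ?_⟩
    rw [sl2_neg_entry, sl2_neg_entry]; linarith

lemma cover1 (h : PSL2) : h ∈ C0 ∨ h ∈ Hs 1 ∨ h ∈ Hs (-1) := by
  obtain ⟨A, rfl, ht⟩ := lift_nonneg h
  have hd := sl2_det A
  rw [mem_C0, isC0_iff A ht, Hs_pos_iff A ht, Hs_neg_iff A ht]
  unfold SG
  simp only [Left.neg_neg_iff]
  rcases lt_trichotomy (A 0 0) (A 1 1) with h1 | h1 | h1
  · rcases lt_trichotomy (A 1 0) 0 with h2 | h2 | h2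
    · exact Or.inr (Or.inl (Or.inr (Or.inl ⟨h1, h2⟩)))
    · exact Or.inl (Or.inr (Or.inl ⟨h1, h2⟩))
    · exact Or.inr (Or.inr (Or.inr (Or.inl ⟨h1, h2⟩)))
  · rcases lt_or_ge 0 (A 0 1 * A 1 0) with h2 | h2
    · rcases mul_pos_iff.1 h2 with h3 | h3
      · exact Or.inr (Or.inr (Or.inr (Or.inr ⟨h1, h3⟩)))
      · exact Or.inr (Or.inl (Or.inr (Or.inr ⟨h1, h3⟩)))
    · exact Or.inl (Or.inr (Or.inr ⟨h1, h2⟩))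
  · rcases lt_trichotomy (A 0 1) 0 with h2 | h2 | h2
    · exact Or.inr (Or.inl (Or.inl ⟨h1, h2⟩))
    · exact Or.inl (Or.inl ⟨h1, h2⟩)
    · exact Or.inr (Or.inr (Or.inl ⟨h1, h2⟩))

lemma disj1 (h : PSL2) : ¬ (h ∈ Hs 1 ∧ h ∈ Hs (-1)) := by
  obtain ⟨A, rfl, ht⟩ := lift_nonneg h
  rw [Hs_pos_iff A ht, Hs_neg_iff A ht]
  unfold SG
  simp only [Left.neg_neg_iff]
  rintro ⟨(h1 | h1 | h1), (h2 | h2 | h2)⟩ <;> linarith [h1.1, h1.2, h2.1, h2.2]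

lemma disj2 (h : PSL2) : ¬ (h ∈ C0 ∧ h ∈ Hs 1) := by
  obtain ⟨A, rfl, ht⟩ := lift_nonneg h
  rw [Hs_pos_iff A ht, mem_C0, isC0_iff A ht]
  unfold SG
  rintro ⟨(h1 | h1 | h1), (h2 | h2 | h2)⟩ <;> nlinarith [h1.1, h1.2, h2.1, h2.2]

lemma disj3 (h : PSL2) : ¬ (h ∈ C0 ∧ h ∈ Hs (-1)) := by
  obtain ⟨A, rfl, ht⟩ := lift_nonneg h
  rw [Hs_neg_iff A ht, mem_C0, isC0_iff A ht]
  unfold SG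
  rintro ⟨(h1 | h1 | h1), (h2 | h2 | h2)⟩ <;> nlinarith [h1.1, h1.2, h2.1, h2.2]

lemma Hs_pm {s : ℝ} (hs : s ≠ 0) : (Hs s = Hs 1 ∧ Hs (-s) = Hs (-1)) ∨
    (Hs s = Hs (-1) ∧ Hs (-s) = Hs 1) := by
  rcases lt_or_gt_of_ne hs with h | h
  · right; exact ⟨Hs_congr (by linarith), Hs_congr (by linarith)⟩
  · left; exact ⟨Hs_congr (by linarith), Hs_congr (by linarith)⟩

lemma Hs_cover {s : ℝ} (hs : s ≠ 0) (h : PSL2) : h ∈ C0 ∨ h ∈ Hs s ∨ h ∈ Hs (-s) := by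
  have := cover1 h
  rcases Hs_pm hs with ⟨h1, h2⟩ | ⟨h1, h2⟩ <;> rw [h1, h2] <;> tauto

lemma Hs_disj {s : ℝ} {h : PSL2} (h1 : h ∈ Hs s) (h2 : h ∈ Hs (-s)) : False := by
  have hs : s ≠ 0 := by
    rintro rfl; obtain ⟨z, hz, _⟩ := h1; simp at hz
  rcases Hs_pm hs with ⟨e1, e2⟩ | ⟨e1, e2⟩ <;> rw [e1] at h1 <;> rw [e2] at h2
  · exact disj1 h ⟨h1, h2⟩
  · exact disj1 h ⟨h2, h1⟩

lemma Hs_C0_disj {s : ℝ} {h : PSL2} (h1 : h ∈ Hs s) (h2 : h ∈ C0) : False := by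
  have hs : s ≠ 0 := by
    rintro rfl; obtain ⟨z, hz, _⟩ := h1; simp at hz
  rcases Hs_pm hs with ⟨e1, e2⟩ | ⟨e1, e2⟩ <;> rw [e1] at h1
  · exact disj2 h ⟨h2, h1⟩
  · exact disj3 h ⟨h2, h1⟩


/-! ### Lens and distances -/

lemma lens_dist {q z : ℍ} (h : Lens q z) :
    ∃ κ > 0, ∀ t, dist q (vert t) ≤ dist z (vert t) - κ := by
  obtain ⟨h1, h2⟩ := h
  have hq := q.im_pos
  have hz := z.im_pos
  have nq := nsq_pos q
  have nz := nsq_pos z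
  set α := 1 / q.im with hα
  set α' := 1 / z.im with hα'
  set β := nsq q / q.im with hβ
  set β' := nsq z / z.im with hβ'
  have a0 : 0 < α := by positivity
  have a0' : 0 < α' := by positivity
  have b0 : 0 < β := by positivity
  have b0' : 0 < β' := by positivity
  have h1' : α < α' := one_div_lt_one_div_of_lt hz h1
  set θ := max (α / α') (β / β') with hθ
  have t1 : θ < 1 := max_lt ((div_lt_one a0').2 h1') ((div_lt_one b0').2 h2)
  have t0 : 0 < θ := lt_max_of_lt_left (by positivity)
  have e1 : α ≤ θ * α' := (div_le_iff₀ a0').1 (le_max_left _ _)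
  have e2 : β ≤ θ * β' := (div_le_iff₀ b0').1 (le_max_right _ _)
  refine ⟨-Real.log θ, by have := Real.log_neg t0 t1; linarith, fun t => ?_⟩
  apply cosh_contr dist_nonneg dist_nonneg (by have := Real.log_neg t0 t1; linarith)
  rw [neg_neg, Real.exp_log t0, cosh_dist_vert, cosh_dist_vert]
  have f1 : (Real.exp (-t) * nsq q + Real.exp t) / (2 * q.im) =
    (Real.exp (-t) * β + Real.exp t * α) / 2 := by rw [hβ, hα]; field_simp
  have f2 : (Real.exp (-t) * nsq z + Real.exp t) / (2 * z.im) =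
    (Real.exp (-t) * β' + Real.exp t * α') / 2 := by rw [hβ', hα']; field_simp
  rw [f1, f2]
  have := mul_le_mul_of_nonneg_left e1 (Real.exp_pos t).le
  have := mul_le_mul_of_nonneg_left e2 (Real.exp_pos (-t)).le
  linarith

lemma lin_aux {α β α' β' : ℝ} (h : ∀ u > 0, α * u + β / u ≤ α' * u + β' / u + 1) : α ≤ α' := by
  by_contra hh
  push Not at hh
  set u := max 1 ((|β' - β| + 2) / (α - α')) with hu
  have hu1 : 1 ≤ u := le_max_left _ _
  have hu2 : (|β' - β| + 2) / (α - α') ≤ u := le_max_right _ _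
  rw [div_le_iff₀ (by linarith)] at hu2
  have := h u (by linarith)
  have h3 : (β' - β) / u ≤ |β' - β| := by
    rw [div_le_iff₀ (by linarith)]
    have := le_abs_self (β' - β)
    nlinarith [abs_nonneg (β' - β)]
  rw [sub_div] at h3
  nlinarith

lemma lin_both {α β α' β' : ℝ} (h : ∀ u > 0, α * u + β / u ≤ α' * u + β' / u + 1) :
    α ≤ α' ∧ β ≤ β' := by
  refine ⟨lin_aux h, lin_aux (α := β) (β := α) (α' := β') (β' := α') fun u hu => ?_⟩
  have := h (1 / u) (by positivity)
  simp only [mul_one_div, div_div_eq_mul_div, div_one] at this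
  linarith

lemma cosh_sub_le {d d' κ : ℝ} (hd' : 0 ≤ d') (h : d' ≤ d - κ) :
    Real.cosh d' ≤ Real.exp (-κ) * Real.cosh d + 1 / 2 := by
  have h1 : Real.cosh d' ≤ Real.cosh (d - κ) := by
    rw [Real.cosh_le_cosh, abs_of_nonneg hd', abs_of_nonneg (by linarith)]; exact h
  have h2 : Real.exp (-(d - κ)) ≤ 1 := Real.exp_le_one_iff.2 (by linarith)
  have h3 : Real.exp (d - κ) = Real.exp (-κ) * Real.exp d := by rw [← Real.exp_add]; ring_nf
  rw [Real.cosh_eq (d - κ), h3] at h1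
  rw [Real.cosh_eq d]
  have : 0 < Real.exp (-κ) * Real.exp (-d) := by positivity
  linarith

lemma dist_lens {q z : ℍ} {κ : ℝ} (hκ : 0 < κ)
    (h : ∀ t, dist q (vert t) ≤ dist z (vert t) - κ) : Lens q z := by
  have hq := q.im_pos
  have hz := z.im_pos
  have nq := nsq_pos q
  have nz := nsq_pos z
  set e := Real.exp (-κ) with he
  have he0 : 0 < e := Real.exp_pos _
  have he1 : e < 1 := by rw [he, Real.exp_lt_one_iff]; linarith
  have key := lin_both (α := 1 / q.im) (β := nsq q / q.im) (α' := e * (1 / z.im))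
    (β' := e * (nsq z / z.im)) (fun u hu => by
      have := cosh_sub_le dist_nonneg (h (Real.log u))
      rw [cosh_dist_vert, cosh_dist_vert, Real.exp_neg, Real.exp_log hu] at this
      have f1 : (u⁻¹ * nsq q + u) / (2 * q.im) = (1 / q.im * u + nsq q / q.im / u) / 2 := by
        field_simp; ring
      have f2 : (u⁻¹ * nsq z + u) / (2 * z.im) = (1 / z.im * u + nsq z / z.im / u) / 2 := by
        field_simp; ring
      rw [f1, f2, ← he] at this
      have f3 : e * (nsq z / z.im) / u = e * (nsq z / z.im / u) := by ring
      rw [f3]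
      linarith)
  obtain ⟨k1, k2⟩ := key
  constructor
  · have : 1 / q.im < 1 / z.im := lt_of_le_of_lt k1 (by
      apply mul_lt_of_lt_one_left (by positivity) he1)
    exact lt_of_one_div_lt_one_div hq this
  · exact lt_of_le_of_lt k2 (mul_lt_of_lt_one_left (by positivity) he1)

lemma w_sq : pmk wSL * pmk wSL = 1 := by
  rw [← pmk_mul, ← pmk_one, pmk_eq_iff]
  right
  apply sl2_ext <;> simp [wSL, sl2_neg_entry]

lemma w_inv : (pmk wSL)⁻¹ = pmk wSL := inv_eq_of_mul_eq_one_right w_sq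

lemma lens_w {q z : ℍ} (h : Lens q z) : Lens (wSL • q) (wSL • z) := by
  obtain ⟨h1, h2⟩ := h
  have hq := q.im_pos
  have hz := z.im_pos
  have nq := nsq_pos q
  have nz := nsq_pos z
  unfold Lens
  simp only [wSL_im, wSL_nsq]
  rw [div_lt_div_iff₀ hq hz] at h2
  constructor
  · rw [div_lt_div_iff₀ nz nq]; linarith
  · rw [show 1 / nsq q / (q.im / nsq q) = 1 / q.im by field_simp,
      show 1 / nsq z / (z.im / nsq z) = 1 / z.im by field_simp]
    exact one_div_lt_one_div_of_lt hz h1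

lemma Hs_w {s : ℝ} {k : PSL2} (h : k ∈ Hs s) : pmk wSL * k * pmk wSL ∈ Hs (-s) := by
  obtain ⟨z, hz, hl⟩ := h
  refine ⟨wSL • z, ?_, ?_⟩
  · rw [wSL_re]
    have nz := nsq_pos z
    rw [show -s * (-z.re / nsq z) = s * z.re / nsq z by ring]
    positivity
  · have : (pmk wSL * k * pmk wSL) • wSL • z = wSL • k • z := by
      rw [← pmk_smul, ← pmk_smul, ← mul_smul, mul_assoc, w_sq, mul_one, mul_smul]
    rw [this]
    exact lens_w hl

/-! ### The flow pushing off a crooked plane -/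

def bt (t : ℝ) : SL2 := mkSL (Real.cosh t) (Real.sinh t) (Real.sinh t) (Real.cosh t)
  (by have := Real.cosh_sq t; nlinarith)

lemma bt_cont : Continuous bt := mkSL_cont _ Real.continuous_cosh Real.continuous_sinh
  Real.continuous_sinh Real.continuous_cosh

lemma bt_zero : bt 0 = 1 := by apply sl2_ext <;> simp [bt]

lemma bt_mul_neg (t : ℝ) : bt (-t) * bt t = 1 := by
  have := Real.cosh_sq t
  apply sl2_ext <;> simp [bt] <;> nlinarith

lemma push_of {s τ : ℝ} {k : PSL2} (z : ℍ) (h1 : 0 < s * (bt τ • z).re)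
    (h2 : Lens (k • z) (bt τ • z)) : k * pmk (bt (-τ)) ∈ Hs s := by
  refine ⟨bt τ • z, h1, ?_⟩
  rwa [mul_smul, pmk_smul, ← mul_smul, bt_mul_neg, one_smul]

lemma ch_pos' {τ : ℝ} (hτ : τ ≠ 0) : 1 < Real.cosh τ := Real.one_lt_cosh.2 hτ

lemma sinh_sign {s τ : ℝ} (h : 0 < s * τ) : 0 < s * Real.sinh τ := by
  rcases mul_pos_iff.1 h with ⟨h1, h2⟩ | ⟨h1, h2⟩
  · exact mul_pos h1 (Real.sinh_pos_iff.2 h2)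
  · exact mul_pos_of_neg_of_neg h1 (Real.sinh_neg_iff.2 h2)

lemma bt_re_pos {s τ : ℝ} (h : 0 < s * τ) (z : ℍ) (hz : 0 ≤ s * z.re) :
    0 < s * (bt τ • z).re := by
  have hs := sinh_sign h
  have hc := Real.cosh_pos τ
  have hp := den_pos (bt τ) z
  have hi := z.im_pos
  rw [smul_re, mul_div_assoc']
  apply div_pos _ hp
  simp only [bt, mkSL_00, mkSL_01, mkSL_10, mkSL_11]
  set S := Real.sinh τ
  set C := Real.cosh τ
  have e : s * ((C * z.re + S) * (S * z.re + C) + C * S * z.im ^ 2) =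
    C * (s * S) * (z.re ^ 2 + z.im ^ 2) + s * z.re * (C ^ 2 + S ^ 2) + (s * S) * C := by ring
  rw [e]; positivity

lemma lens_bt {s τ : ℝ} (h : 0 < s * τ) (q z : ℍ) (hz : 0 ≤ s * z.re) (hq1 : z.im ≤ q.im)
    (hq2 : nsq q / q.im ≤ nsq z / z.im) : Lens q (bt τ • z) := by
  have hs := sinh_sign h
  have hs0 : s ≠ 0 := by rintro rfl; simp at h
  have hτ : τ ≠ 0 := by rintro rfl; simp at h
  have hc := ch_pos' hτ
  have hp := den_pos (bt τ) z
  have hi := z.im_pos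
  have hSx : 0 ≤ Real.sinh τ * z.re := by
    have : 0 ≤ (s * Real.sinh τ) * (s * z.re) := by positivity
    have h2 : (s * Real.sinh τ) * (s * z.re) = s ^ 2 * (Real.sinh τ * z.re) := by ring
    rw [h2] at this
    exact nonneg_of_mul_nonneg_right this (by positivity)
  have d1 : 1 < den (bt τ) z := by
    simp only [den, bt, mkSL_10, mkSL_11]
    nlinarith [sq_nonneg (Real.sinh τ * z.re), sq_nonneg (Real.sinh τ * z.im)]
  have n1 : nsq z < nume (bt τ) z := by
    simp only [nume, nsq, bt, mkSL_00, mkSL_01]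
    have h4 : 0 < z.im ^ 2 := by positivity
    have h5 : 1 < Real.cosh τ ^ 2 := one_lt_pow₀ hc (by norm_num)
    have h6 : 0 < (Real.cosh τ ^ 2 - 1) * z.im ^ 2 := mul_pos (by linarith) h4
    have h7 : 0 ≤ (Real.cosh τ ^ 2 - 1) * z.re ^ 2 := mul_nonneg (by linarith) (sq_nonneg _)
    have h8 : 0 ≤ Real.cosh τ * (Real.sinh τ * z.re) := mul_nonneg (by linarith) hSx
    nlinarith [sq_nonneg (Real.sinh τ)]
  constructor
  · rw [smul_im]
    exact lt_of_lt_of_le (div_lt_self hi d1) hq1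
  · rw [smul_im, smul_nsq]
    refine lt_of_le_of_lt hq2 ?_
    rw [div_div_div_cancel_right₀ hp.ne']
    exact div_lt_div_of_pos_right n1 hi

lemma push_wing {s τ : ℝ} (h : 0 < s * τ) (A : SL2) (h1 : A 1 0 = 0) (h2 : |A 0 0| ≤ 1) :
    pmk A * pmk (bt (-τ)) ∈ Hs s := by
  have hs := sinh_sign h
  have hτ : τ ≠ 0 := by rintro rfl; simp at h
  have hc := ch_pos' hτ
  have hd := sl2_det A
  rw [h1, mul_zero, sub_zero] at hd
  have hμ : A 0 0 ≠ 0 := by intro h; rw [h] at hd; simp at hd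
  have hμ' : 0 < |A 0 0| := abs_pos.2 hμ
  set S := Real.sinh τ with hS
  set C := Real.cosh τ with hC
  have hS0 : S ≠ 0 := by intro h; rw [h] at hs; simp at hs
  have hSa : 0 < |S| := abs_pos.2 hS0
  have hX1 : 0 < 1 / (|A 0 0| * S ^ 2) := by positivity
  have hC1 : 0 < C - 1 := by linarith
  have hX2 : 0 ≤ |A 0 1| / ((C - 1) * |S|) := by positivity
  set X := 1 / (|A 0 0| * S ^ 2) + |A 0 1| / ((C - 1) * |S|) with hX
  have hXp : 0 < X := by positivity
  set z : ℍ := ⟨⟨S * X, 1⟩, one_pos⟩ with hz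
  have zr : z.re = S * X := rfl
  have zi : z.im = 1 := rfl
  have hp := den_pos (bt τ) z
  have hpA := den_pos A z
  apply push_of z
  · apply bt_re_pos h
    rw [zr, ← mul_assoc]; positivity
  · have g1 : 1 ≤ |A 0 0| * (S * (S * X)) := by
      have : 1 / (|A 0 0| * S ^ 2) ≤ X := by linarith
      rw [div_le_iff₀ (by positivity)] at this
      linarith
    have g2 : |A 0 1| ≤ (C - 1) * |S * X| := by
      have : |A 0 1| / ((C - 1) * |S|) ≤ X := by linarith
      rw [div_le_iff₀ (by positivity)] at this
      rw [abs_mul, abs_of_pos hXp]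
      linarith
    have hd2 : A 1 1 ^ 2 * |A 0 0| ^ 2 = 1 := by
      rw [sq_abs]; nlinarith
    have dA : den A z = A 1 1 ^ 2 := by simp [den, h1]
    have nA : nume A z = (A 0 0 * (S * X) + A 0 1) ^ 2 + A 0 0 ^ 2 := by simp [nume, zr, zi]
    have dB : den (bt τ) z = (S * (S * X) + C) ^ 2 + S ^ 2 := by
      simp [den, bt, zr, zi, hS, hC]
    have nB : nume (bt τ) z = (C * (S * X) + S) ^ 2 + C ^ 2 := by
      simp [nume, bt, zr, zi, hS, hC]
    have hSX : 0 ≤ S * (S * X) := by rw [← mul_assoc]; have := mul_self_nonneg S; positivity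
    rw [pmk_smul]
    constructor
    · rw [smul_im, smul_im, zi]
      apply one_div_lt_one_div_of_lt hpA
      rw [dA, dB]
      have : A 1 1 ^ 2 ≤ (S * (S * X)) ^ 2 := by
        have g3 : 1 ≤ (|A 0 0| * (S * (S * X))) ^ 2 := one_le_pow₀ g1
        rw [mul_pow] at g3
        have : A 1 1 ^ 2 * 1 ≤ A 1 1 ^ 2 * (|A 0 0| ^ 2 * (S * (S * X)) ^ 2) :=
          mul_le_mul_of_nonneg_left g3 (sq_nonneg _)
        rw [← mul_assoc, hd2] at this
        linarith
      have : 0 < S ^ 2 := by positivity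
      nlinarith
    · rw [smul_im, smul_nsq, smul_im, smul_nsq, div_div_div_cancel_right₀ hp.ne',
        div_div_div_cancel_right₀ hpA.ne']
      apply div_lt_div_of_pos_right _ z.im_pos
      rw [nA, nB]
      have k1 : (A 0 0 * (S * X) + A 0 1) ^ 2 ≤ (C * |S * X|) ^ 2 := by
        rw [← sq_abs (A 0 0 * (S * X) + A 0 1)]
        apply pow_le_pow_left₀ (abs_nonneg _)
        have := abs_add_le (A 0 0 * (S * X)) (A 0 1)
        rw [abs_mul] at this
        have := mul_le_mul_of_nonneg_right h2 (abs_nonneg (S * X))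
        linarith
      rw [mul_pow, sq_abs] at k1
      have k2 : A 0 0 ^ 2 ≤ 1 := (sq_le_one_iff_abs_le_one _).2 h2
      have k3 : 0 ≤ C * (S * (S * X)) := by positivity
      have k4 : 1 < C ^ 2 := one_lt_pow₀ hc (by norm_num)
      have k5 : (C * (S * X) + S) ^ 2 = C ^ 2 * (S * X) ^ 2 + 2 * (C * (S * (S * X))) + S ^ 2 := by
        ring
      have k6 := sq_nonneg S
      linarith

lemma C0_w {k : PSL2} (h : k ∈ C0) : pmk wSL * k * pmk wSL ∈ C0 := by
  obtain ⟨A, rfl⟩ := pmk_surj k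
  rw [mem_C0] at h
  rw [← pmk_mul, ← pmk_mul, mem_C0]
  have e00 : (wSL * A * wSL) 0 0 = - A 1 1 := by simp [wSL]
  have e01 : (wSL * A * wSL) 0 1 = A 1 0 := by simp [wSL]
  have e10 : (wSL * A * wSL) 1 0 = A 0 1 := by simp [wSL]
  have e11 : (wSL * A * wSL) 1 1 = - A 0 0 := by simp [wSL]
  unfold isC0 at *
  rw [e00, e01, e10, e11, abs_neg, abs_neg]
  rcases h with ⟨y, hy, h1, h2⟩ | h | h
  · left
    refine ⟨1 / y, by positivity, by rw [h1], ?_⟩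
    rw [h2]; field_simp
  · right; right; exact h
  · right; left; exact h

lemma bt_w (t : ℝ) : pmk wSL * pmk (bt t) * pmk wSL = pmk (bt (-t)) := by
  rw [← pmk_mul, ← pmk_mul, pmk_eq_iff]
  right
  apply sl2_ext <;> simp [wSL, bt, sl2_neg_entry]

lemma push {s τ : ℝ} (h : 0 < s * τ) {k : PSL2} (hk : k ∈ Hs s ∨ k ∈ C0) :
    k * pmk (bt (-τ)) ∈ Hs s := by
  rcases hk with ⟨z, hz, hl⟩ | hk
  · exact push_of z (bt_re_pos h z hz.le) (lens_bt h _ _ hz.le hl.1.le hl.2.le)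
  · obtain ⟨A, rfl⟩ := pmk_surj k
    have hk' := (mem_C0 A).1 hk
    rcases hk' with ⟨y, hy, h1, h2⟩ | ⟨h1, h2⟩ | ⟨h1, h2⟩
    · have hf : A • vert (Real.log y) = vert (Real.log y) := by
        rw [fix_vert, Real.exp_log hy]; exact ⟨h1, h2⟩
      apply push_of (vert (Real.log y))
      · exact bt_re_pos h _ (by simp)
      · rw [pmk_smul, hf]
        exact lens_bt h _ _ (by simp) le_rfl le_rfl
    · exact push_wing h A h1 h2
    · have := push_wing (s := -s) (τ := -τ) (by linarith) (wSL * A * wSL) (by simp [wSL, h1])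
        (by simpa [wSL] using h2)
      have := Hs_w this
      rw [neg_neg, neg_neg, pmk_mul, pmk_mul] at this
      rw [← bt_w τ]
      convert this using 1
      have w2 := w_sq
      simp only [← mul_assoc, w2, one_mul]

/-! ### Connectedness of the crooked plane -/

lemma exists_cos_sin {p r : ℝ} (h : p ^ 2 + r ^ 2 = 1) : ∃ θ : ℝ, p = Real.cos θ ∧ r = Real.sin θ := by
  have h1 : -1 ≤ p := by nlinarith [sq_nonneg r]
  have h2 : p ≤ 1 := by nlinarith [sq_nonneg r]
  have hs : Real.sin (Real.arccos p) = |r| := by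
    rw [Real.sin_arccos, ← Real.sqrt_sq_eq_abs]; congr 1; linarith
  rcases le_total 0 r with hr | hr
  · exact ⟨Real.arccos p, (Real.cos_arccos h1 h2).symm, by rw [hs, abs_of_nonneg hr]⟩
  · refine ⟨-Real.arccos p, by rw [Real.cos_neg, Real.cos_arccos h1 h2], ?_⟩
    rw [Real.sin_neg, hs, abs_of_nonpos hr, neg_neg]

lemma C0_join_aux (f : ℝ → SL2) (hf : Continuous f) (h0 : f 0 = 1) (hc : ∀ s, isC0 (f s)) :
    ∃ t ⊆ C0, (1 : PSL2) ∈ t ∧ pmk (f 1) ∈ t ∧ IsPreconnected t := by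
  refine ⟨Set.range (fun s => pmk (f s)), ?_, ⟨0, by simp [h0]⟩, ⟨1, rfl⟩,
    isPreconnected_range (pmk_cont.comp hf)⟩
  rintro _ ⟨s, rfl⟩
  exact (mem_C0 _).2 (hc s)

lemma C0_join_wing (A : SL2) (h1 : A 1 0 = 0) (h2 : |A 0 0| ≤ 1) :
    ∃ t ⊆ C0, (1 : PSL2) ∈ t ∧ pmk A ∈ t ∧ IsPreconnected t := by
  have main : ∀ A : SL2, A 1 0 = 0 → |A 0 0| ≤ 1 → 0 < A 0 0 →
      ∃ t ⊆ C0, (1 : PSL2) ∈ t ∧ pmk A ∈ t ∧ IsPreconnected t := by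
    intro A h1 h2 h3
    have hd := sl2_det A
    rw [h1, mul_zero, sub_zero] at hd
    set u := Real.log (A 0 0) with hu
    have hu0 : u ≤ 0 := Real.log_nonpos h3.le (le_of_abs_le h2)
    have heu : Real.exp u = A 0 0 := Real.exp_log h3
    have hdet : ∀ s : ℝ, Real.exp (s ^ 2 * u) * Real.exp (-(s ^ 2 * u)) - s * A 0 1 * 0 = 1 := by
      intro s; rw [← Real.exp_add]; simp
    obtain ⟨t, ht1, ht2, ht3, ht4⟩ := C0_join_aux (fun s => mkSL (Real.exp (s ^ 2 * u)) (s * A 0 1) 0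
      (Real.exp (-(s ^ 2 * u))) (hdet s))
      (mkSL_cont _ (by fun_prop) (by fun_prop) (by fun_prop) (by fun_prop))
      (by apply sl2_ext <;> simp) (fun s => by
        right; left
        refine ⟨by simp, ?_⟩
        simp only [mkSL_00, Real.abs_exp, Real.exp_le_one_iff]
        nlinarith [sq_nonneg s])
    refine ⟨t, ht1, ht2, ?_, ht4⟩
    convert ht3 using 2
    apply sl2_ext
    · simp [heu]
    · simp
    · simp [h1]
    · simp [Real.exp_neg, heu]; field_simp; linarith
  rcases lt_trichotomy (A 0 0) 0 with h | h | h
  · rw [← pmk_neg]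
    apply main
    · rw [sl2_neg_entry, h1, neg_zero]
    · rw [sl2_neg_entry, abs_neg]; exact h2
    · rw [sl2_neg_entry]; linarith
  · have hd := sl2_det A
    rw [h1, h] at hd; simp at hd
  · exact main A h1 h2 h

lemma C0_preconn : IsPreconnected C0 := by
  apply isPreconnected_of_forall (1 : PSL2)
  intro k hk
  obtain ⟨A, rfl⟩ := pmk_surj k
  have hd := sl2_det A
  rcases (mem_C0 A).1 hk with ⟨y, hy, h1, h2⟩ | ⟨h1, h2⟩ | ⟨h1, h2⟩
  · have : (A 0 0) ^ 2 + (A 1 0 * y) ^ 2 = 1 := by rw [h2, ← h1] at hd; linarith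
    obtain ⟨θ, hθ1, hθ2⟩ := exists_cos_sin this
    have hdet : ∀ s : ℝ, Real.cos (s * θ) * Real.cos (s * θ) -
        (-(y * Real.sin (s * θ))) * (Real.sin (s * θ) / y) = 1 := by
      intro s; have := Real.sin_sq_add_cos_sq (s * θ); field_simp; linarith
    obtain ⟨t, ht1, ht2, ht3, ht4⟩ := C0_join_aux (fun s => mkSL (Real.cos (s * θ))
      (-(y * Real.sin (s * θ))) (Real.sin (s * θ) / y) (Real.cos (s * θ)) (hdet s))
      (mkSL_cont _ (by fun_prop) (by fun_prop) (by fun_prop) (by fun_prop))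
      (by apply sl2_ext <;> simp) (fun s => by
        left
        refine ⟨y, hy, by simp, ?_⟩
        simp only [mkSL_01, mkSL_10]; field_simp)
    refine ⟨t, ht1, ht2, ?_, ht4⟩
    convert ht3 using 2
    apply sl2_ext
    · simp [hθ1]
    · simp only [mkSL_01, one_mul, ← hθ2, h2]; ring
    · simp only [mkSL_10, one_mul, ← hθ2]; field_simp
    · simp [← h1, hθ1]
  · exact C0_join_wing A h1 h2
  · obtain ⟨t, ht1, ht2, ht3, ht4⟩ := C0_join_wing (wSL * A * wSL) (by simp [wSL, h1])
        (by simpa [wSL] using h2)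
    have w2 := w_sq
    refine ⟨(fun k => pmk wSL * k * pmk wSL) '' t, ?_, ⟨1, ht2, by simp [w2]⟩, ⟨_, ht3, ?_⟩,
      ht4.image _ ?_⟩
    · rintro _ ⟨k, hk, rfl⟩
      exact C0_w (ht1 hk)
    · simp only [pmk_mul, ← mul_assoc, w2, one_mul]
      rw [mul_assoc, w2, mul_one]
    · exact ((continuous_const.mul continuous_id).mul continuous_const).continuousOn


/-! ### Framed planes -/

def PP (M F : PSL2) : Set PSL2 := {h | F⁻¹ * h * M ∈ C0}
def HH (M F : PSL2) (s : ℝ) : Set PSL2 := {h | F⁻¹ * h * M ∈ Hs s}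

lemma plane_frame {S : Set PSL2} (h : IsRightCrookedPlane S) : ∃ M F : PSL2, S = PP M F := by
  obtain ⟨g, l, hl, rfl⟩ := h
  obtain ⟨M, rfl⟩ := geod_lineOf hl
  refine ⟨M, g * M, ?_⟩
  ext h
  constructor
  · rintro ⟨k, hk, rfl⟩
    rw [mem_rightCrooked] at hk
    change (g * M)⁻¹ * (g * k) * M ∈ C0
    convert hk using 1
    group
  · intro hh
    refine ⟨g⁻¹ * h, ?_, by simp⟩
    rw [mem_rightCrooked]
    change (g * M)⁻¹ * h * M ∈ C0 at hh
    convert hh using 1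
    group

lemma actImg_PP {j ρ : Γ →* PSL2} (γ : Γ) (M F : PSL2) :
    actImg j ρ γ (PP M F) = PP (j γ * M) (ρ γ * F) := by
  ext h
  constructor
  · rintro ⟨k, hk, rfl⟩
    change (ρ γ * F)⁻¹ * (ρ γ * k * (j γ)⁻¹) * (j γ * M) ∈ C0
    change F⁻¹ * k * M ∈ C0 at hk
    convert hk using 1
    group
  · intro hh
    refine ⟨(ρ γ)⁻¹ * h * j γ, ?_, by group⟩
    change F⁻¹ * ((ρ γ)⁻¹ * h * j γ) * M ∈ C0
    change (ρ γ * F)⁻¹ * h * (j γ * M) ∈ C0 at hh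
    convert hh using 1
    group

lemma crit10 (X Y : SL2) (hdis : ∀ k ∈ C0, (pmk Y)⁻¹ * k * pmk X ∉ C0) : |Y 1 0| < |X 1 0| := by
  by_contra hle
  push Not at hle
  have main : ∀ K : SL2, isC0 K → ∀ μ : ℝ, |μ| ≤ 1 → (K * X) 0 0 = μ * Y 0 0 →
      (K * X) 1 0 = μ * Y 1 0 → False := by
    intro K hK μ hμ h0 h1
    apply hdis (pmk K) ((mem_C0 K).2 hK)
    rw [← pmk_inv, ← pmk_mul, ← pmk_mul, mem_C0, mul_assoc]
    have hd := sl2_det Y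
    right; left
    constructor
    · rw [sl2_mul_10, h0, h1]; simp; ring
    · rw [sl2_mul_00, h0, h1, sl2_inv_00, sl2_inv_01]
      rw [show Y 1 1 * (μ * Y 0 0) + -Y 0 1 * (μ * Y 1 0) = μ * (Y 0 0 * Y 1 1 - Y 0 1 * Y 1 0) by ring,
        hd, mul_one]
      exact hμ
  have hdX := sl2_det X
  have hdY := sl2_det Y
  by_cases hX : X 1 0 = 0
  · have hX0 : X 0 0 ≠ 0 := by intro h; rw [hX, h] at hdX; simp at hdX
    by_cases hY : Y 1 0 = 0
    · have hY0 : Y 0 0 ≠ 0 := by intro h; rw [hY, h] at hdY; simp at hdY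
      set μ := 1 / (1 + |X 0 0 / Y 0 0|) with hμ
      have hp : 0 < 1 + |X 0 0 / Y 0 0| := by positivity
      have hμ0 : 0 < μ := by positivity
      apply main (mkSL μ 0 0 (1 / μ) (by field_simp; norm_num)) ?_ (μ * (X 0 0 / Y 0 0)) ?_ ?_ ?_
      · right; left
        refine ⟨by simp, ?_⟩
        simp only [mkSL_00]
        rw [abs_of_pos hμ0, hμ, div_le_one hp]
        linarith [abs_nonneg (X 0 0 / Y 0 0)]
      · rw [abs_mul, abs_of_pos hμ0, hμ, one_div, inv_mul_le_iff₀ hp]; linarith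
      · rw [sl2_mul_00]; simp; field_simp
      · rw [sl2_mul_10]; simp [hX, hY]
    · set y := |X 0 0 / Y 1 0| with hy
      have hy0 : 0 < y := abs_pos.2 (div_ne_zero hX0 hY)
      set Q := Y 0 0 ^ 2 + y ^ 2 * Y 1 0 ^ 2 with hQ
      have hQ0 : 0 < Q := by positivity
      have hyQ : y ^ 2 * Y 1 0 ^ 2 = X 0 0 ^ 2 := by rw [hy, sq_abs]; field_simp
      set l := 1 / √Q with hl
      have hl2 : l ^ 2 * Q = 1 := by
        rw [hl, div_pow, Real.sq_sqrt hQ0.le]; field_simp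
      have hl0 : 0 < l := by positivity
      apply main (mkSL (l * Y 0 0) (-(l * y ^ 2 * Y 1 0)) (l * Y 1 0) (l * Y 0 0)
        (by rw [hQ] at hl2; linarith)) ?_ (l * X 0 0) ?_ ?_ ?_
      · left
        refine ⟨y, hy0, by simp, ?_⟩
        simp only [mkSL_01, mkSL_10]; ring
      · rw [← sq_le_one_iff_abs_le_one, mul_pow]
        rw [hQ, hyQ] at hl2
        have : 0 ≤ l ^ 2 * Y 0 0 ^ 2 := by positivity
        nlinarith
      · rw [sl2_mul_00]; simp [hX]; ring
      · rw [sl2_mul_10]; simp [hX]; ring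
  · have hY : Y 1 0 ≠ 0 := by
      intro h; rw [h, abs_zero] at hle
      exact hX (abs_eq_zero.1 (le_antisymm hle (abs_nonneg _)))
    apply main (mkSL 1 ((X 1 0 / Y 1 0 * Y 0 0 - X 0 0) / X 1 0) 0 1 (by simp)) ?_
      (X 1 0 / Y 1 0) ?_ ?_ ?_
    · right; left; simp
    · rw [abs_div, div_le_one (abs_pos.2 hY)]; exact hle
    · rw [sl2_mul_00]; simp; field_simp; ring
    · rw [sl2_mul_10]; simp; field_simp

lemma crit_w {X Y : SL2} (hdis : ∀ k ∈ C0, (pmk Y)⁻¹ * k * pmk X ∉ C0) :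
    (∀ k ∈ C0, (pmk (Y * wSL))⁻¹ * k * pmk (X * wSL) ∉ C0) ∧
    (∀ k ∈ C0, (pmk (wSL * Y))⁻¹ * k * pmk (wSL * X) ∉ C0) := by
  have w2 := w_sq
  constructor
  · intro k hk hh
    apply hdis k hk
    have := C0_w hh
    convert this using 1
    simp only [pmk_mul, mul_inv_rev, w_inv]
    rw [show pmk wSL * (pmk wSL * (pmk Y)⁻¹ * k * (pmk X * pmk wSL)) * pmk wSL =
      (pmk wSL * pmk wSL) * ((pmk Y)⁻¹ * k * pmk X) * (pmk wSL * pmk wSL) by group, w2]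
    group
  · intro k hk hh
    apply hdis (pmk wSL * k * pmk wSL) (C0_w hk)
    convert hh using 1
    simp only [pmk_mul, mul_inv_rev, w_inv]
    group

lemma crit {X Y : SL2} (hdis : ∀ k ∈ C0, (pmk Y)⁻¹ * k * pmk X ∉ C0) (i j : Fin 2) :
    |Y i j| < |X i j| := by
  have h10 := crit10 X Y hdis
  have h11 := crit10 _ _ (crit_w hdis).1
  have h00 := crit10 _ _ (crit_w hdis).2
  have h01 := crit10 _ _ (crit_w (crit_w hdis).2).1
  simp [wSL] at h11 h00 h01
  fin_cases i <;> fin_cases j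
  · exact h00
  · exact h01
  · exact h10
  · exact h11

lemma PP_disj {M F M' F' : PSL2} (h : Disjoint (PP M F) (PP M' F')) {X Y : SL2}
    (hX : pmk X = M⁻¹ * M') (hY : pmk Y = F⁻¹ * F') (i j : Fin 2) : |Y i j| < |X i j| := by
  apply crit
  intro k hk hh
  have h1 : F * k * M⁻¹ ∈ PP M F := by
    change F⁻¹ * (F * k * M⁻¹) * M ∈ C0
    convert hk using 1; group
  have h2 : F * k * M⁻¹ ∈ PP M' F' := by
    change F'⁻¹ * (F * k * M⁻¹) * M' ∈ C0
    rw [hX, hY] at hh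
    convert hh using 1; group
  exact Set.disjoint_left.1 h h1 h2

lemma contr_of {X Y : SL2} {κ : ℝ} (hκ : 0 ≤ κ)
    (h : ∀ i j, Y i j ^ 2 ≤ Real.exp (-κ) * X i j ^ 2) (s t : ℝ) :
    dist (Y • vert t) (vert s) ≤ dist (X • vert t) (vert s) - κ := by
  apply cosh_contr dist_nonneg dist_nonneg hκ
  rw [cosh_dist_lines, cosh_dist_lines]
  have h1 := mul_le_mul_of_nonneg_right (h 0 0) (Real.exp_pos (t - s)).le
  have h2 := mul_le_mul_of_nonneg_right (h 0 1) (Real.exp_pos (-s - t)).le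
  have h3 := mul_le_mul_of_nonneg_right (h 1 0) (Real.exp_pos (s + t)).le
  have h4 := mul_le_mul_of_nonneg_right (h 1 1) (Real.exp_pos (s - t)).le
  linarith

lemma ratio_exists {X Y : SL2} (h : ∀ i j, |Y i j| < |X i j|) :
    ∃ κ > 0, ∀ i j, Y i j ^ 2 ≤ Real.exp (-κ) * X i j ^ 2 := by
  have h' : ∀ i j, ∃ κ > 0, Y i j ^ 2 ≤ Real.exp (-κ) * X i j ^ 2 := by
    intro i j
    have hx : 0 < |X i j| := lt_of_le_of_lt (abs_nonneg _) (h i j)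
    have hx2 : 0 < X i j ^ 2 := by rw [← sq_abs]; positivity
    have hy : Y i j ^ 2 < X i j ^ 2 := sq_lt_sq.2 (h i j)
    set θ := (Y i j ^ 2 + X i j ^ 2) / (2 * X i j ^ 2) with hθ
    have t0 : 0 < θ := by positivity
    have t1 : θ < 1 := by rw [hθ, div_lt_one (by positivity)]; linarith
    refine ⟨-Real.log θ, by have := Real.log_neg t0 t1; linarith, ?_⟩
    rw [neg_neg, Real.exp_log t0, hθ]
    rw [show (Y i j ^ 2 + X i j ^ 2) / (2 * X i j ^ 2) * X i j ^ 2 = (Y i j ^ 2 + X i j ^ 2) / 2 by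
      have : X i j ≠ 0 := abs_pos.1 hx
      field_simp]
    linarith
  choose κ hκ0 hκ using h'
  refine ⟨min (min (κ 0 0) (κ 0 1)) (min (κ 1 0) (κ 1 1)), by
    simp [hκ0], fun i j => (hκ i j).trans ?_⟩
  apply mul_le_mul_of_nonneg_right _ (sq_nonneg _)
  apply Real.exp_le_exp.2
  apply neg_le_neg
  fin_cases i <;> fin_cases j
  · exact (min_le_left _ _).trans (min_le_left _ _)
  · exact (min_le_left _ _).trans (min_le_right _ _)
  · exact (min_le_right _ _).trans (min_le_left _ _)
  · exact (min_le_right _ _).trans (min_le_right _ _)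

/-- distances between lines in terms of relative frames -/
lemma dist_rel {M M' : PSL2} {X : SL2} (hX : pmk X = M⁻¹ * M') (s t : ℝ) :
    dist (M' • vert t) (M • vert s) = dist (X • vert t) (vert s) := by
  rw [← pmk_smul, hX, mul_smul, pdist_inv]

/-! ### Uniqueness of the center -/

lemma quad3 {a0 a1 a2 b0 b1 b2 c0 c1 c2 : ℝ} (h : ∀ μ : ℝ, 0 < μ → μ ≤ 1 →
    (a0 + a1 * μ + a2 * μ ^ 2) * (b0 + b1 * μ + b2 * μ ^ 2) * (c0 + c1 * μ + c2 * μ ^ 2) = 0) :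
    (a0 = 0 ∧ a1 = 0 ∧ a2 = 0) ∨ (b0 = 0 ∧ b1 = 0 ∧ b2 = 0) ∨ (c0 = 0 ∧ c1 = 0 ∧ c2 = 0) := by
  let q : ℝ → ℝ → ℝ → Polynomial ℝ := fun x y z =>
    Polynomial.C x + Polynomial.C y * Polynomial.X + Polynomial.C z * Polynomial.X ^ 2
  have hq : ∀ x y z, q x y z = 0 → x = 0 ∧ y = 0 ∧ z = 0 := by
    intro x y z h
    have h0 := congrArg (fun p => Polynomial.eval 0 p) h
    have h1 := congrArg (fun p => Polynomial.eval 1 p) h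
    have h2 := congrArg (fun p => Polynomial.eval (-1) p) h
    simp [q] at h0 h1 h2
    refine ⟨h0, by linarith, by linarith⟩
  have hz : q a0 a1 a2 * q b0 b1 b2 * q c0 c1 c2 = 0 := by
    apply Polynomial.eq_zero_of_infinite_isRoot
    apply Set.Infinite.mono _ (Set.Ioc_infinite (show (0:ℝ) < 1 by norm_num))
    intro μ hμ
    have := h μ hμ.1 hμ.2
    simpa [Polynomial.IsRoot, q] using this
  rcases mul_eq_zero.1 hz with h1 | h1
  · rcases mul_eq_zero.1 h1 with h2 | h2
    · exact Or.inl (hq _ _ _ h2)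
    · exact Or.inr (Or.inl (hq _ _ _ h2))
  · exact Or.inr (Or.inr (hq _ _ _ h1))

lemma isC0_prod {A : SL2} (h : isC0 A) : A 0 1 * A 1 0 * (A 0 0 - A 1 1) = 0 := by
  rcases h with ⟨y, hy, h1, h2⟩ | ⟨h1, h2⟩ | ⟨h1, h2⟩
  · rw [h1]; ring
  · rw [h1]; ring
  · rw [h1]; ring

lemma uniq_aux (Z X : SL2) (h : ∀ K : SL2, isC0 K → isC0 (Z * K * X)) :
    (Z 0 0 = 0 ∧ X 1 1 = 0) ∨ (Z 1 0 = 0 ∧ X 1 0 = 0) := by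
  have hZ := sl2_det Z
  have hX := sl2_det X
  have := quad3 (a0 := Z 0 1 * X 1 1) (a1 := Z 0 0 * X 1 1) (a2 := Z 0 0 * X 0 1)
    (b0 := Z 1 1 * X 1 0) (b1 := Z 1 0 * X 1 0) (b2 := Z 1 0 * X 0 0)
    (c0 := Z 0 1 * X 1 0 - Z 1 1 * X 1 1) (c1 := Z 0 0 * X 1 0 - Z 1 0 * X 1 1)
    (c2 := Z 0 0 * X 0 0 - Z 1 0 * X 0 1) (fun μ h0 h1 => by
      have := isC0_prod (h (mkSL μ 1 0 (1 / μ) (by field_simp; norm_num)) (by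
        right; left; exact ⟨by simp, by simp [abs_of_pos h0, h1]⟩))
      simp at this
      field_simp at this
      rcases this with (h | h) | h
      · rw [show Z 0 1 * X 1 1 + Z 0 0 * X 1 1 * μ + Z 0 0 * X 0 1 * μ ^ 2 = 0 by linarith]; ring
      · rw [show Z 1 1 * X 1 0 + Z 1 0 * X 1 0 * μ + Z 1 0 * X 0 0 * μ ^ 2 = 0 by linarith]; ring
      · rw [show Z 0 1 * X 1 0 - Z 1 1 * X 1 1 + (Z 0 0 * X 1 0 - Z 1 0 * X 1 1) * μ +
          (Z 0 0 * X 0 0 - Z 1 0 * X 0 1) * μ ^ 2 = 0 by linarith]; ring)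
  rcases this with ⟨h0, h1, h2⟩ | ⟨h0, h1, h2⟩ | ⟨h0, h1, h2⟩
  · left
    have hz : Z 0 0 = 0 := by
      have : Z 0 0 * (X 0 0 * X 1 1 - X 0 1 * X 1 0) = 0 := by linear_combination X 0 0 * h1 - X 1 0 * h2
      rwa [hX, mul_one] at this
    refine ⟨hz, ?_⟩
    have : Z 0 1 ≠ 0 := by intro h; rw [hz, h] at hZ; simp at hZ
    exact (mul_eq_zero.1 h0).resolve_left this
  · right
    have hz : Z 1 0 = 0 := by
      have : Z 1 0 * (X 0 0 * X 1 1 - X 0 1 * X 1 0) = 0 := by linear_combination X 1 1 * h2 - X 0 1 * h1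
      rwa [hX, mul_one] at this
    refine ⟨hz, ?_⟩
    have : Z 1 1 ≠ 0 := by intro h; rw [hz, h] at hZ; simp at hZ
    exact (mul_eq_zero.1 h0).resolve_left this
  · exfalso
    have hz : Z 0 0 = 0 := by
      have : Z 0 0 * (X 0 0 * X 1 1 - X 0 1 * X 1 0) = 0 := by linear_combination X 1 1 * h2 - X 0 1 * h1
      rwa [hX, mul_one] at this
    have hz' : Z 1 0 = 0 := by
      have : Z 1 0 * (X 0 0 * X 1 1 - X 0 1 * X 1 0) = 0 := by linear_combination X 1 0 * h2 - X 0 0 * h1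
      rwa [hX, mul_one] at this
    rw [hz, hz'] at hZ; simp at hZ

lemma isC0_up {A : SL2} (h : isC0 A) (h1 : A 1 0 = 0) (h2 : A 0 1 ≠ 0) : |A 0 0| ≤ 1 := by
  rcases h with ⟨y, hy, h3, h4⟩ | h | h
  · rw [h1] at h4; simp at h4; exact absurd h4 h2
  · exact h.2
  · exact absurd h.1 h2

lemma isC0_low {A : SL2} (h : isC0 A) (h1 : A 0 1 = 0) (h2 : A 1 0 ≠ 0) : |A 1 1| ≤ 1 := by
  rcases h with ⟨y, hy, h3, h4⟩ | h | h
  · rw [h1] at h4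
    have : A 1 0 * y ^ 2 ≠ 0 := mul_ne_zero h2 (by positivity)
    exfalso; apply this; linarith
  · exact absurd h.1 h2
  · exact h.2

lemma diag_one {A : SL2} (h01 : A 0 1 = 0) (h10 : A 1 0 = 0) (h0 : |A 0 0| ≤ 1) (h1 : |A 1 1| ≤ 1) :
    pmk A = 1 := by
  have hd := sl2_det A
  rw [h01, zero_mul, sub_zero] at hd
  have e : |A 0 0| * |A 1 1| = 1 := by rw [← abs_mul, hd, abs_one]
  have f : |A 0 0| = 1 := by nlinarith [abs_nonneg (A 0 0), abs_nonneg (A 1 1)]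
  symm
  rw [← pmk_one, pmk_eq_iff]
  rcases (abs_eq (by norm_num : (0:ℝ) ≤ 1)).1 f with g | g
  · left
    rw [g] at hd
    apply sl2_ext <;> simp [h01, h10, g]
    linarith
  · right
    rw [g] at hd
    apply sl2_ext <;> simp [h01, h10, g, sl2_neg_entry]
    linarith

lemma uniq (Z X : SL2) (h : ∀ K : SL2, isC0 K → isC0 (Z * K * X)) : pmk (Z * X) = 1 := by
  have hZ := sl2_det Z
  have hX := sl2_det X
  have u1 := uniq_aux Z X h
  have hw : ∀ A : SL2, isC0 A → isC0 (wSL * A * wSL) := by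
    intro A hA
    have := C0_w ((mem_C0 A).2 hA)
    rwa [← pmk_mul, ← pmk_mul, mem_C0] at this
  have u2 := uniq_aux (wSL * Z * wSL) (wSL * X * wSL) (by
    intro K hK
    have := hw _ (h _ (hw K hK))
    convert this using 1
    simp only [mul_assoc])
  simp [wSL] at u2
  have k1 := h (mkSL 1 1 0 1 (by norm_num)) (by right; left; simp)
  have k2 := h (mkSL 1 0 1 1 (by norm_num)) (by right; right; simp)
  rcases u1 with ⟨a1, a2⟩ | ⟨a1, a2⟩ <;> rcases u2 with ⟨b1, b2⟩ | ⟨b1, b2⟩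
  · have n1 : Z 1 0 ≠ 0 := by intro h; rw [a1, h] at hZ; simp at hZ
    have n2 : X 1 0 ≠ 0 := by intro h; rw [a2, h] at hX; simp at hX
    have n3 : Z 0 1 ≠ 0 := by intro h; rw [a1, h] at hZ; simp at hZ
    have n4 : X 0 1 ≠ 0 := by intro h; rw [a2, h] at hX; simp at hX
    apply diag_one
    · simp [a1, a2]
    · simp [b1, b2]
    · have := isC0_up k2 (by simp [b1, b2]) (by simp [a1, a2, n3, n4])
      simpa [a1, a2, b1, b2] using this
    · have := isC0_low k1 (by simp [a1, a2]) (by simp [b1, b2, n1, n2])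
      simpa [a1, a2, b1, b2] using this
  · rw [a1, b1] at hZ; simp at hZ
  · rw [a1, b1] at hZ; simp at hZ
  · have n1 : Z 0 0 ≠ 0 := by intro h; rw [a1, h] at hZ; simp at hZ
    have n2 : X 0 0 ≠ 0 := by intro h; rw [a2, h] at hX; simp at hX
    have n3 : Z 1 1 ≠ 0 := by intro h; rw [a1, h] at hZ; simp at hZ
    have n4 : X 1 1 ≠ 0 := by intro h; rw [a2, h] at hX; simp at hX
    apply diag_one
    · simp [b1, b2]
    · simp [a1, a2]
    · have := isC0_up k1 (by simp [a1, a2]) (by simp [b1, b2, n1, n4])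
      simpa [b1, b2, a1, a2] using this
    · have := isC0_low k2 (by simp [b1, b2]) (by simp [a1, a2, n3, n2])
      simpa [a1, a2, b1, b2] using this

lemma PP_eq {M F M' F' : PSL2} (h : PP M F = PP M' F') : F * M⁻¹ = F' * M'⁻¹ := by
  obtain ⟨Z, hZ⟩ := pmk_surj (F'⁻¹ * F)
  obtain ⟨X, hX⟩ := pmk_surj (M⁻¹ * M')
  have := uniq Z X (fun K hK => by
    have h1 : F * pmk K * M⁻¹ ∈ PP M F := by
      change F⁻¹ * (F * pmk K * M⁻¹) * M ∈ C0
      have := (mem_C0 K).2 hK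
      convert this using 1; group
    rw [h] at h1
    change F'⁻¹ * (F * pmk K * M⁻¹) * M' ∈ C0 at h1
    rw [← mem_C0, pmk_mul, pmk_mul, hZ, hX]
    convert h1 using 1; group)
  rw [pmk_mul, hZ, hX] at this
  have h2 : F * M⁻¹ * M' = F' := by
    have : F' * (F'⁻¹ * F * (M⁻¹ * M')) = F' * 1 := by rw [this]
    rw [mul_one] at this
    rw [← this]; group
  rw [← h2]; group


/-! ### The index set -/

abbrev FG (r : ℕ) := FreeGroup (Fin r)

/-- A system of crooked planes with trivial stabilizers. -/
structure CS (r : ℕ) (j ρ : FG r →* PSL2) where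
  J : Type
  fin : Finite J
  m : J → PSL2
  f : J → PSL2
  pd : ProperlyDisc j ρ
  disj : ∀ a b : FG r × J, a ≠ b →
    Disjoint (PP (j a.1 * m a.2) (ρ a.1 * f a.2)) (PP (j b.1 * m b.2) (ρ b.1 * f b.2))

abbrev CS.I {r : ℕ} {j ρ : FG r →* PSL2} (S : CS r j ρ) := FG r × S.J
def CS.M {r : ℕ} {j ρ : FG r →* PSL2} (S : CS r j ρ) (a : S.I) : PSL2 := j a.1 * S.m a.2
def CS.F {r : ℕ} {j ρ : FG r →* PSL2} (S : CS r j ρ) (a : S.I) : PSL2 := ρ a.1 * S.f a.2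
def CS.P {r : ℕ} {j ρ : FG r →* PSL2} (S : CS r j ρ) (a : S.I) : Set PSL2 := PP (S.M a) (S.F a)
def CS.act {r : ℕ} {j ρ : FG r →* PSL2} (S : CS r j ρ) (γ : FG r) (a : S.I) : S.I := (γ * a.1, a.2)

lemma actImg_mul {j ρ : Γ →* PSL2} (γ γ' : Γ) (s : Set PSL2) :
    actImg j ρ (γ * γ') s = actImg j ρ γ (actImg j ρ γ' s) := by
  simp only [actImg, Set.image_image]
  apply Set.image_congr
  intro x _
  simp only [map_mul]
  group

lemma actImg_one {j ρ : Γ →* PSL2} (s : Set PSL2) : actImg j ρ 1 s = s := by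
  simp [actImg]

lemma stab_trivial {r : ℕ} {j ρ : FG r →* PSL2} (hpd : ProperlyDisc j ρ) {g : PSL2} {δ : FG r}
    (h : ρ δ * g * (j δ)⁻¹ = g) : δ = 1 := by
  have hpow : ∀ n : ℕ, ρ (δ ^ n) * g * (j (δ ^ n))⁻¹ = g := by
    intro n
    induction n with
    | zero => simp
    | succ n ih =>
      rw [pow_succ', map_mul, map_mul, mul_inv_rev]
      calc ρ δ * ρ (δ ^ n) * g * ((j (δ ^ n))⁻¹ * (j δ)⁻¹)
          = ρ δ * (ρ (δ ^ n) * g * (j (δ ^ n))⁻¹) * (j δ)⁻¹ := by group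
        _ = g := by rw [ih, h]
  have hfin := hpd {g} isCompact_singleton
  by_contra hne
  have hinj : Function.Injective (fun n : ℕ => δ ^ n) := by
    rw [injective_pow_iff_not_isOfFinOrder]
    exact not_isOfFinOrder_of_isMulTorsionFree hne
  apply Set.infinite_range_of_injective hinj
  apply hfin.subset
  rintro _ ⟨n, rfl⟩
  exact ⟨g, ⟨g, rfl, hpow n⟩, rfl⟩

lemma CS_exists {r : ℕ} {j ρ : FG r →* PSL2} (hpd : ProperlyDisc j ρ) {n : ℕ}
    (D : Fin n → Set PSL2) (hD : ∀ i, IsRightCrookedPlane (D i))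
    (hdis : ∀ (γ γ' : FG r) (i i' : Fin n),
      actImg j ρ γ (D i) = actImg j ρ γ' (D i') ∨
      Disjoint (actImg j ρ γ (D i)) (actImg j ρ γ' (D i'))) :
    ∃ S : CS r j ρ, (⋃ (γ : FG r) (i : Fin n), actImg j ρ γ (D i)) = ⋃ a : S.I, S.P a := by
  choose M F hMF using fun i => plane_frame (hD i)
  let s : Setoid (Fin n) :=
    { r := fun i i' => ∃ γ, actImg j ρ γ (D i) = D i'
      iseqv := by
        refine ⟨fun i => ⟨1, actImg_one _⟩, ?_, ?_⟩
        · rintro i i' ⟨γ, h⟩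
          refine ⟨γ⁻¹, ?_⟩
          rw [← h, ← actImg_mul, inv_mul_cancel, actImg_one]
        · rintro i i' i'' ⟨γ, h⟩ ⟨γ', h'⟩
          exact ⟨γ' * γ, by rw [actImg_mul, h, h']⟩ }
  have key : ∀ (γ : FG r) (q : Quotient s), PP (j γ * M q.out) (ρ γ * F q.out) =
      actImg j ρ γ (D q.out) := by
    intro γ q; rw [hMF q.out, actImg_PP]
  refine ⟨⟨Quotient s, inferInstance, fun q => M q.out, fun q => F q.out, hpd, ?_⟩, ?_⟩
  · rintro ⟨γ, q⟩ ⟨γ', q'⟩ hne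
    simp only
    rw [key, key]
    refine (hdis γ γ' q.out q'.out).resolve_left fun heq => hne ?_
    have hq : q = q' := by
      rw [← Quotient.out_equiv_out]
      refine ⟨γ'⁻¹ * γ, ?_⟩
      rw [actImg_mul, heq, ← actImg_mul, inv_mul_cancel, actImg_one]
    subst hq
    rw [← key, ← key] at heq
    have := PP_eq heq
    have h2 : γ'⁻¹ * γ = 1 := by
      apply stab_trivial hpd (g := F q.out * (M q.out)⁻¹)
      rw [map_mul, map_mul, map_inv, map_inv]
      calc (ρ γ')⁻¹ * ρ γ * (F q.out * (M q.out)⁻¹) * ((j γ')⁻¹ * j γ)⁻¹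
          = (ρ γ')⁻¹ * (ρ γ * F q.out * (j γ * M q.out)⁻¹) * j γ' := by group
        _ = _ := by rw [this]; group
    rw [inv_mul_eq_one] at h2
    rw [h2]
  · ext h
    simp only [Set.mem_iUnion]
    constructor
    · rintro ⟨γ, i, hi⟩
      obtain ⟨δ, hδ⟩ : ∃ δ, actImg j ρ δ (D (Quotient.mk s i).out) = D i :=
        Quotient.exact (Quotient.out_eq (Quotient.mk s i))
      refine ⟨(γ * δ, Quotient.mk s i), ?_⟩
      change h ∈ PP _ _
      have := key (γ * δ) (Quotient.mk s i)
      rw [actImg_mul, hδ] at this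
      exact this ▸ hi
    · rintro ⟨⟨γ, q⟩, hq⟩
      refine ⟨γ, q.out, ?_⟩
      rw [← key]; exact hq

section
variable {r : ℕ} {j ρ : FG r →* PSL2} (S : CS r j ρ)

lemma CS.M_act (γ : FG r) (a : S.I) : S.M (S.act γ a) = j γ * S.M a := by
  simp [CS.M, CS.act, mul_assoc]
lemma CS.F_act (γ : FG r) (a : S.I) : S.F (S.act γ a) = ρ γ * S.F a := by
  simp [CS.F, CS.act, mul_assoc]
lemma CS.act_inj (γ : FG r) {a b : S.I} (h : S.act γ a = S.act γ b) : a = b := by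
  simp only [CS.act, Prod.mk.injEq, mul_right_inj] at h
  exact Prod.ext h.1 h.2
lemma CS.act_inv (γ : FG r) (a : S.I) : S.act γ (S.act γ⁻¹ a) = a := by
  simp [CS.act]
lemma CS.act_inv' (γ : FG r) (a : S.I) : S.act γ⁻¹ (S.act γ a) = a := by
  simp [CS.act]

lemma CS.entries {a b : S.I} (h : a ≠ b) {X Y : SL2} (hX : pmk X = (S.M a)⁻¹ * S.M b)
    (hY : pmk Y = (S.F a)⁻¹ * S.F b) (i k : Fin 2) : |Y i k| < |X i k| :=
  PP_disj (S.disj a b h) hX hY i k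

lemma CS.entries_ne {a b : S.I} (h : a ≠ b) {X : SL2} (hX : pmk X = (S.M a)⁻¹ * S.M b)
    (i k : Fin 2) : X i k ≠ 0 := by
  obtain ⟨Y, hY⟩ := pmk_surj ((S.F a)⁻¹ * S.F b)
  exact abs_pos.1 (lt_of_le_of_lt (abs_nonneg _) (S.entries h hX hY i k))

lemma CS.contr {a b : S.I} (h : a ≠ b) : ∃ κ > 0, ∀ s t,
    dist (S.F b • vert t) (S.F a • vert s) ≤ dist (S.M b • vert t) (S.M a • vert s) - κ := by
  obtain ⟨X, hX⟩ := pmk_surj ((S.M a)⁻¹ * S.M b)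
  obtain ⟨Y, hY⟩ := pmk_surj ((S.F a)⁻¹ * S.F b)
  obtain ⟨κ, h0, h1⟩ := ratio_exists (S.entries h hX hY)
  refine ⟨κ, h0, fun s t => ?_⟩
  rw [dist_rel hX, dist_rel hY]
  exact contr_of h0.le h1 s t

lemma CS.lip (a b : S.I) (s t : ℝ) :
    dist (S.F b • vert t) (S.F a • vert s) ≤ dist (S.M b • vert t) (S.M a • vert s) := by
  by_cases h : a = b
  · subst h
    rw [dist_smul, dist_smul]
  · obtain ⟨κ, h0, h1⟩ := S.contr h
    linarith [h1 s t]

lemma CS.line_ne {a b : S.I} (h : a ≠ b) (s t : ℝ) : S.M b • vert t ≠ S.M a • vert s := by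
  intro heq
  obtain ⟨κ, h0, h1⟩ := S.contr h
  have := h1 s t
  rw [heq, dist_self] at this
  linarith [dist_nonneg (x := S.F b • vert t) (y := S.F a • vert s)]

lemma CS.line_inj {a b : S.I} (h : lineOf (S.M a) = lineOf (S.M b)) : a = b := by
  by_contra hne
  have : S.M a • vert 0 ∈ lineOf (S.M b) := h ▸ ⟨0, rfl⟩
  obtain ⟨t, ht⟩ := this
  exact S.line_ne hne 0 t ht

lemma CS.endpoints {a b : S.I} (h : a ≠ b) (ξ : OnePoint ℝ) (h1 : IsEndpoint (lineOf (S.M a)) ξ) :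
    ¬ IsEndpoint (lineOf (S.M b)) ξ := by
  obtain ⟨X, hX⟩ := pmk_surj ((S.M a)⁻¹ * S.M b)
  have hn := S.entries_ne h hX
  obtain ⟨A, hA⟩ := pmk_surj (S.M a)
  have hB : S.M b = pmk (A * X) := by rw [pmk_mul, hX, hA]; group
  intro h2
  rw [← hA, endpoint_iff] at h1
  rw [hB, endpoint_iff] at h2
  have hdA := sl2_det A
  have aux : ∀ p q p' q' : ℝ, (p ≠ 0 ∨ q ≠ 0) → (p' ≠ 0 ∨ q' ≠ 0) → dirpt p q = dirpt p' q' →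
      p * q' = q * p' := by
    intro p q p' q' h h' he
    obtain ⟨μ, _, e1, e2⟩ := dirpt_spec h
    obtain ⟨μ', _, e1', e2'⟩ := dirpt_spec h'
    rw [he] at e1 e2
    generalize bvec (dirpt p' q') = v at *
    rw [e1, e2, e1', e2']; ring
  have hdX := sl2_det (A * X)
  have n1 : A 0 0 ≠ 0 ∨ A 1 0 ≠ 0 := by
    by_contra hh; push Not at hh; rw [hh.1, hh.2] at hdA; norm_num at hdA
  have n2 : A 0 1 ≠ 0 ∨ A 1 1 ≠ 0 := by
    by_contra hh; push Not at hh; rw [hh.1, hh.2] at hdA; norm_num at hdA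
  have n3 : (A * X) 0 0 ≠ 0 ∨ (A * X) 1 0 ≠ 0 := by
    by_contra hh; push Not at hh; rw [hh.1, hh.2] at hdX; norm_num at hdX
  have n4 : (A * X) 0 1 ≠ 0 ∨ (A * X) 1 1 ≠ 0 := by
    by_contra hh; push Not at hh; rw [hh.1, hh.2] at hdX; norm_num at hdX
  rcases h1 with h1 | h1 <;> rcases h2 with h2 | h2 <;> rw [h1] at h2
  · have e := aux _ _ _ _ n1 n3 h2
    rw [sl2_mul_00, sl2_mul_10] at e
    exact hn 1 0 (by linear_combination e - (X 1 0) * hdA)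
  · have e := aux _ _ _ _ n1 n4 h2
    rw [sl2_mul_01, sl2_mul_11] at e
    exact hn 1 1 (by linear_combination e - (X 1 1) * hdA)
  · have e := aux _ _ _ _ n2 n3 h2
    rw [sl2_mul_00, sl2_mul_10] at e
    exact hn 0 0 (by linear_combination -e - (X 0 0) * hdA)
  · have e := aux _ _ _ _ n2 n4 h2
    rw [sl2_mul_01, sl2_mul_11] at e
    exact hn 0 1 (by linear_combination -e - (X 0 1) * hdA)

lemma CS.local_fin (x0 : ℍ) (C : ℝ) : {a : S.I | ∃ t, dist x0 (S.M a • vert t) ≤ C}.Finite := by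
  by_cases hemp : Nonempty S.I
  swap
  · have : IsEmpty S.I := not_nonempty_iff.1 hemp
    exact Set.toFinite _
  obtain ⟨a0⟩ := hemp
  have := S.fin
  obtain ⟨K, hK, hKs⟩ := compact_dist x0 (S.F a0 • vert 0) (2 * C + dist x0 (S.M a0 • vert 0))
  have hf : ∀ i : S.J, {γ : FG r | (actImg j ρ γ (K ∪ {S.f i * (S.m i)⁻¹}) ∩
      (K ∪ {S.f i * (S.m i)⁻¹})).Nonempty}.Finite := fun i =>
    S.pd _ (hK.union isCompact_singleton)
  have hu := Set.finite_iUnion (fun i => (hf i).image (fun γ => ((γ, i) : S.I)))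
  apply hu.subset
  rintro ⟨γ, i⟩ ⟨t, ht⟩
  rw [Set.mem_iUnion]
  refine ⟨i, γ, ?_, rfl⟩
  refine ⟨ρ γ * (S.f i * (S.m i)⁻¹) * (j γ)⁻¹, ⟨_, Or.inr rfl, rfl⟩, Or.inl (hKs _ ?_)⟩
  have e : ρ γ * (S.f i * (S.m i)⁻¹) * (j γ)⁻¹ = S.F (γ, i) * (S.M (γ, i))⁻¹ := by
    simp only [CS.F, CS.M]; group
  rw [e]
  have h1 : dist ((S.F (γ, i) * (S.M (γ, i))⁻¹) • x0) (S.F (γ, i) • vert t) =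
      dist x0 (S.M (γ, i) • vert t) := by
    rw [mul_smul, dist_smul, pdist_inv]
  have h2 := S.lip a0 (γ, i) 0 t
  have h3 := dist_triangle (S.M (γ, i) • vert t) x0 (S.M a0 • vert 0)
  rw [dist_comm _ x0] at h3
  have h4 := dist_triangle ((S.F (γ, i) * (S.M (γ, i))⁻¹) • x0) (S.F (γ, i) • vert t)
    (S.F a0 • vert 0)
  linarith

end

lemma transl_vert (u : ℝ) : ∃ T : PSL2, ∀ t, T • vert t = vert (t + u) := by
  obtain ⟨h, hh⟩ := isometry_eq (fun t => vert (t + u))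
    (vert_isometry.comp (isometry_add_right u))
  exact ⟨h, fun t => (hh t).symm⟩

lemma kak {r : ℕ} {j ρ : FG r →* PSL2} (hpd : ProperlyDisc j ρ) (x0 y0 w w' : ℍ) (C : ℝ) :
    {γ : FG r | |dist x0 (j γ • w) - dist y0 (ρ γ • w')| ≤ C}.Finite := by
  obtain ⟨K1, hK1, h1⟩ := compact_dist x0 y0 C
  obtain ⟨K2, hK2, h2⟩ := compact_dist w w' 0
  apply (hpd _ (hK1.union hK2)).subset
  intro γ hγ
  obtain ⟨k1, a1, b1⟩ := two_point x0 (j γ • w)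
  obtain ⟨k2, a2, b2⟩ := two_point y0 (ρ γ • w')
  obtain ⟨T, hT⟩ := transl_vert (dist y0 (ρ γ • w') - dist x0 (j γ • w))
  set h := k2⁻¹ * T * k1 with hh
  have e1 : h • (j γ • w) = ρ γ • w' := by
    rw [hh, mul_smul, mul_smul, b1, hT, inv_smul_eq_iff, b2]; congr 1; ring
  have e2 : dist (h • x0) y0 ≤ C := by
    rw [hh, mul_smul, mul_smul, a1, hT, pdist_inv, a2, vert_isometry.dist_eq, Real.dist_eq]
    rw [abs_sub_comm]
    have : |dist x0 (j γ • w) - dist y0 (ρ γ • w')| ≤ C := hγ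
    convert this using 2; ring
  refine ⟨h, ⟨(ρ γ)⁻¹ * h * j γ, Or.inr (h2 _ ?_), by simp; group⟩, Or.inl (h1 _ e2)⟩
  rw [mul_smul, mul_smul, e1, inv_smul_smul, dist_self]


/-! ### Crossing lemma -/

lemma avoid_gt {θ : ℝ → ℝ} (hθ : Continuous θ) {c : ℝ} (h : ∀ x, θ x ≠ c) {a : ℝ} (ha : c < θ a)
    (b : ℝ) : c < θ b := by
  by_contra hb
  push Not at hb
  obtain ⟨x, hx⟩ := mem_range_of_exists_le_of_exists_ge hθ ⟨b, hb⟩ ⟨a, ha.le⟩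
  exact h x hx

lemma avoid_lt {θ : ℝ → ℝ} (hθ : Continuous θ) {c : ℝ} (h : ∀ x, θ x ≠ c) {a : ℝ} (ha : θ a < c)
    (b : ℝ) : θ b < c := by
  by_contra hb
  push Not at hb
  obtain ⟨x, hx⟩ := mem_range_of_exists_le_of_exists_ge hθ ⟨a, ha.le⟩ ⟨b, hb⟩
  exact h x hx

lemma crossing {κ ν : ℝ → ℂ} (hκ : Continuous κ) (hν : Continuous ν)
    (h0 : ∀ t, (κ 0).re < (ν t).re) (h1 : ∀ t, (ν t).re < (κ 1).re)
    (h2 : ∀ s, (κ s).re = (ν 0).re → (ν 0).im < (κ s).im)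
    (h3 : ∀ s, (κ s).re = (ν 1).re → (κ s).im < (ν 1).im)
    (hne : ∀ s t, κ s ≠ ν t) : False := by
  let f : C(ℝ × ℝ, ℂ) := ⟨fun p => κ p.1 - ν p.2,
    (hκ.comp continuous_fst).sub (hν.comp continuous_snd)⟩
  have hf0 : ∀ p, f p ≠ 0 := fun p => sub_ne_zero.2 (hne p.1 p.2)
  have hpi := Real.pi_pos
  have hx0 : Complex.exp (Complex.log (-f (0, 0)) + Real.pi * Complex.I) = f (0, 0) := by
    rw [Complex.exp_add, Complex.exp_log (neg_ne_zero.2 (hf0 _)), Complex.exp_pi_mul_I]; ring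
  rcases Complex.isCoveringMapOn_exp.existsUnique_continuousMap_lifts f hx0
    (fun p => hf0 p) with ⟨g, ⟨hg0, hg⟩, -⟩
  have hge : ∀ p, Complex.exp (g p) = f p := fun p => congrFun hg p
  set θ : ℝ × ℝ → ℝ := fun p => (g p).im with hθ
  have hθc : Continuous θ := Complex.continuous_im.comp g.continuous
  have hre : ∀ p, (f p).re = Real.exp (g p).re * Real.cos (θ p) := fun p => by
    rw [← hge, Complex.exp_re]
  have him : ∀ p, (f p).im = Real.exp (g p).re * Real.sin (θ p) := fun p => by
    rw [← hge, Complex.exp_im]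
  have s0 : ∀ t, Real.cos (θ (0, t)) < 0 := by
    intro t
    have : (f (0, t)).re < 0 := by
      change (κ 0 - ν t).re < 0; rw [Complex.sub_re]; linarith [h0 t]
    rw [hre] at this
    exact neg_of_mul_neg_right this (Real.exp_pos _).le
  have s1 : ∀ t, 0 < Real.cos (θ (1, t)) := by
    intro t
    have : 0 < (f (1, t)).re := by
      change 0 < (κ 1 - ν t).re; rw [Complex.sub_re]; linarith [h1 t]
    rw [hre] at this
    exact pos_of_mul_pos_right this (Real.exp_pos _).le
  have t0 : ∀ s, Real.cos (θ (s, 0)) = 0 → 0 < Real.sin (θ (s, 0)) := by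
    intro s hs
    have e : (f (s, 0)).re = 0 := by rw [hre, hs, mul_zero]
    have : 0 < (f (s, 0)).im := by
      change (κ s - ν 0).re = 0 at e
      change 0 < (κ s - ν 0).im
      rw [Complex.sub_re] at e
      rw [Complex.sub_im]; linarith [h2 s (by linarith)]
    rw [him] at this
    exact pos_of_mul_pos_right this (Real.exp_pos _).le
  have t1 : ∀ s, Real.cos (θ (s, 1)) = 0 → Real.sin (θ (s, 1)) < 0 := by
    intro s hs
    have e : (f (s, 1)).re = 0 := by rw [hre, hs, mul_zero]
    have : (f (s, 1)).im < 0 := by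
      change (κ s - ν 1).re = 0 at e
      change (κ s - ν 1).im < 0
      rw [Complex.sub_re] at e
      rw [Complex.sub_im]; linarith [h3 s (by linarith)]
    rw [him] at this
    exact neg_of_mul_neg_right this (Real.exp_pos _).le
  have c1 : Real.cos (3 * Real.pi / 2) = 0 := by
    rw [show 3 * Real.pi / 2 = Real.pi / 2 + Real.pi by ring, Real.cos_add_pi, Real.cos_pi_div_two,
      neg_zero]
  have c2 : Real.sin (3 * Real.pi / 2) = -1 := by
    rw [show 3 * Real.pi / 2 = Real.pi / 2 + Real.pi by ring, Real.sin_add_pi, Real.sin_pi_div_two]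
  have c3 : Real.cos (-(Real.pi / 2)) = 0 := by rw [Real.cos_neg, Real.cos_pi_div_two]
  have c4 : Real.sin (-(Real.pi / 2)) = -1 := by rw [Real.sin_neg, Real.sin_pi_div_two]
  have hcl : ∀ t, Continuous fun s => θ (s, t) := fun t => hθc.comp (by fun_prop)
  have hcr : ∀ s, Continuous fun t => θ (s, t) := fun s => hθc.comp (by fun_prop)
  have start : Real.pi / 2 < θ (0, 0) ∧ θ (0, 0) < 3 * Real.pi / 2 := by
    have e : θ (0, 0) = Complex.arg (-f (0, 0)) + Real.pi := by
      change (g (0, 0)).im = _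
      rw [hg0]; simp [Complex.log_im]
    have hp : 0 < (-f (0, 0)).re := by
      change 0 < (-(κ 0 - ν 0)).re
      simp only [Complex.neg_re, Complex.sub_re]; linarith [h0 0]
    have := abs_lt.1 (Complex.abs_arg_lt_pi_div_two_iff.2 (Or.inl hp))
    rw [e]; constructor <;> linarith [this.1, this.2]
  have l1 := avoid_gt (hcr 0) (c := Real.pi / 2)
    (fun t ht => by have := s0 t; rw [ht, Real.cos_pi_div_two] at this; exact lt_irrefl _ this)
    start.1 1
  have b1 := avoid_lt (hcl 0) (c := 3 * Real.pi / 2)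
    (fun s hs => by have := t0 s (hs ▸ c1); rw [hs, c2] at this; linarith) start.2 1
  have b2 := avoid_gt (hcl 0) (c := -(Real.pi / 2))
    (fun s hs => by have := t0 s (hs ▸ c3); rw [hs, c4] at this; linarith) (a := 0)
    (by linarith [start.1]) 1
  have b3 : θ (1, 0) < Real.pi / 2 := by
    by_contra hh
    push Not at hh
    have := Real.cos_nonpos_of_pi_div_two_le_of_le hh (by linarith)
    linarith [s1 0]
  have r1 := avoid_lt (hcr 1) (c := Real.pi / 2)
    (fun t ht => by have := s1 t; rw [ht, Real.cos_pi_div_two] at this; exact lt_irrefl _ this)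
    b3 1
  have := avoid_gt (hcl 1) (c := Real.pi / 2)
    (fun s hs => by
      have := t1 s (by rw [hs, Real.cos_pi_div_two]); rw [hs, Real.sin_pi_div_two] at this
      linarith) l1 1
  linarith


/-! ### Geometric finiteness near the ends of a line -/

lemma cont_re : Continuous (fun z : ℍ => z.re) := UpperHalfPlane.continuous_re
lemma cont_im : Continuous (fun z : ℍ => z.im) := UpperHalfPlane.continuous_im

lemma geod_joined (z w : ℍ) : JoinedIn {x | dist x z ≤ dist z w} z w := by
  obtain ⟨h, h1, h2⟩ := two_point z w
  refine JoinedIn.ofLine (f := fun t : ℝ => h⁻¹ • vert (t * dist z w)) ?_ ?_ ?_ ?_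
  · exact ((pslIsom.isometry_smul h⁻¹).continuous.comp
      (vert_isometry.continuous.comp (continuous_id.mul continuous_const))).continuousOn
  · simp [← h1]
  · simp [← h2]
  · rintro _ ⟨t, ⟨ht0, ht1⟩, rfl⟩
    simp only [Set.mem_ofPred_eq]
    rw [pdist_inv, h1, vert_isometry.dist_eq, Real.dist_eq, sub_zero,
      abs_of_nonneg (mul_nonneg ht0 dist_nonneg)]
    exact mul_le_of_le_one_left dist_nonneg ht1

lemma joined_fun {F : Set ℍ} {x y : ℍ} (h : JoinedIn F x y) :
    ∃ f : ℝ → ℍ, Continuous f ∧ f 0 = x ∧ f 1 = y ∧ (∀ t, f t ∈ F) := by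
  refine ⟨h.somePath.extend, h.somePath.continuous_extend, by simp, by simp, fun t => ?_⟩
  have : h.somePath.extend t ∈ Set.range h.somePath.extend := ⟨t, rfl⟩
  rw [Path.extend_range] at this
  obtain ⟨u, hu⟩ := this
  rw [← hu]; exact h.somePath_mem u

lemma joined_bdd {F : Set ℍ} {x y : ℍ} (h : JoinedIn F x y) {u : ℍ → ℝ} (hu : Continuous u)
    (hpos : ∀ z, 0 < u z) : ∃ b > 0, ∃ B, JoinedIn (F ∩ {z | b ≤ u z ∧ u z ≤ B}) x y := by
  have hc : IsCompact (Set.range h.somePath) := isCompact_range h.somePath.continuous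
  have hne : (Set.range h.somePath).Nonempty := ⟨_, ⟨0, rfl⟩⟩
  obtain ⟨z1, _, h1⟩ := hc.exists_isMinOn hne hu.continuousOn
  obtain ⟨z2, _, h2⟩ := hc.exists_isMaxOn hne hu.continuousOn
  refine ⟨u z1, hpos _, u z2, h.somePath, fun t => ⟨h.somePath_mem t, h1 ⟨t, rfl⟩, h2 ⟨t, rfl⟩⟩⟩

lemma re_shift (A : SL2) (hc : A 1 0 ≠ 0) (z : ℍ) :
    (A • z).re = A 0 0 / A 1 0 - (A 1 0 * z.re + A 1 1) / (A 1 0 * den A z) := by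
  have hp := den_pos A z
  have hd := sl2_det A
  rw [smul_re]
  field_simp
  unfold den
  linear_combination (-(A 1 0 * z.re + A 1 1)) * hd

lemma nz_shift (A : SL2) (hc : A 1 0 ≠ 0) (z : ℍ) :
    ((A • z).re - A 0 0 / A 1 0) ^ 2 + (A • z).im ^ 2 = 1 / (A 1 0 ^ 2 * den A z) := by
  have hp := den_pos A z
  rw [re_shift A hc, smul_im]
  field_simp
  unfold den
  ring

section
variable {r : ℕ} (k : FG r →* PSL2) (y : ℍ)

lemma path_orbit {D : ℝ} (hD0 : 0 ≤ D) (hD : ∀ i, dist y (k (FreeGroup.of i) • y) ≤ D) (γ : FG r) :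
    ∀ δ, JoinedIn {z | ∃ η, dist z (k η • y) ≤ D} (k δ • y) (k (δ * γ) • y) := by
  have step : ∀ i δ, JoinedIn {z | ∃ η, dist z (k η • y) ≤ D} (k δ • y)
      (k (δ * FreeGroup.of i) • y) := by
    intro i δ
    refine (geod_joined _ _).mono fun z hz => ⟨δ, le_trans hz ?_⟩
    rw [map_mul, mul_smul, dist_smul]; exact hD i
  induction γ using FreeGroup.induction_on with
  | C1 => intro δ; rw [mul_one]; exact JoinedIn.refl ⟨δ, by rw [dist_self]; exact hD0⟩
  | of i => exact step i
  | inv_of i _ =>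
    intro δ
    have := (step i (δ * (FreeGroup.of i)⁻¹)).symm
    rwa [inv_mul_cancel_right] at this
  | mul a b ha hb =>
    intro δ
    rw [← mul_assoc]
    exact (ha δ).trans (hb (δ * a))

def Ms (R : ℝ) : Set ℍ := {z | ∀ γ : FG r, R ≤ dist z (k γ • y)}

def Ch (R : ℝ) : ℍ → ℍ → Prop :=
  Relation.ReflTransGen (fun z w => z ∈ Ms k y R ∧ w ∈ Ms k y R ∧ dist z w < 1)

variable {k y}

lemma Ms_smul {R : ℝ} {z : ℍ} (h : z ∈ Ms k y R) (δ : FG r) : k δ • z ∈ Ms k y R := by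
  intro γ
  rw [dist_comm, ← pdist_inv, ← map_inv, ← mul_smul, ← map_mul, dist_comm]
  exact h _

lemma Ch_smul {R : ℝ} {z w : ℍ} (h : Ch k y R z w) (δ : FG r) : Ch k y R (k δ • z) (k δ • w) := by
  induction h with
  | refl => exact Relation.ReflTransGen.refl
  | tail _ hbc ih =>
    exact ih.tail ⟨Ms_smul hbc.1 δ, Ms_smul hbc.2.1 δ, by rw [dist_smul]; exact hbc.2.2⟩

lemma Ch_symm {R : ℝ} {z w : ℍ} (h : Ch k y R z w) : Ch k y R w z := by
  unfold Ch at *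
  have : Std.Symm (fun z w => z ∈ Ms k y R ∧ w ∈ Ms k y R ∧ dist z w < 1) :=
    ⟨fun a b h => ⟨h.2.1, h.1, by rw [dist_comm]; exact h.2.2⟩⟩
  exact (Relation.ReflTransGen.stdSymm).symm _ _ h

lemma Ch_joined {R : ℝ} {z w : ℍ} (h : Ch k y R z w) (hz : z ∈ Ms k y R) :
    JoinedIn {x | ∀ γ : FG r, R - 1 < dist x (k γ • y)} z w := by
  induction h with
  | refl => exact JoinedIn.refl fun γ => by have := hz γ; linarith
  | @tail b c _ hbc ih =>
    refine ih.trans ((geod_joined b c).mono fun x hx γ => ?_)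
    have h1 := hbc.1 γ
    have h2 := hbc.2.2
    have h3 := dist_triangle b x (k γ • y)
    rw [dist_comm b x] at h3
    have : dist x b ≤ dist b c := hx
    linarith

lemma Ch_tail {R t0 : ℝ} (ht0 : ∀ t, t0 ≤ t → vert t ∈ Ms k y R) {t : ℝ} (ht : t0 ≤ t) :
    Ch k y R (vert t0) (vert t) := by
  have : ∀ n : ℕ, ∀ t, t0 ≤ t → t ≤ t0 + n / 2 → Ch k y R (vert t0) (vert t) := by
    intro n
    induction n with
    | zero =>
      intro t h1 h2
      have : t = t0 := by simp at h2; linarith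
      rw [this]; exact Relation.ReflTransGen.refl
    | succ n ih =>
      intro t h1 h2
      push_cast at h2
      have h3 : t0 ≤ max t0 (t - 1 / 2) := le_max_left _ _
      refine (ih (max t0 (t - 1/2)) h3 ?_).tail ⟨ht0 _ h3, ht0 _ h1, ?_⟩
      · apply max_le
        · have : (0 : ℝ) ≤ n := n.cast_nonneg
          linarith
        · linarith
      · rw [vert_isometry.dist_eq, Real.dist_eq, abs_lt]
        rcases le_total t0 (t - 1/2) with h | h
        · rw [max_eq_right h]; constructor <;> linarith
        · rw [max_eq_left h]; constructor <;> linarith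
  obtain ⟨n, hn⟩ := exists_nat_ge (2 * (t - t0))
  exact this n t ht (by linarith)

lemma tail_joined {t0 T : ℝ} (hT : t0 ≤ T) :
    JoinedIn {z | ∃ t, t0 ≤ t ∧ z = vert t} (vert t0) (vert T) := by
  refine JoinedIn.ofLine (f := fun u : ℝ => vert (t0 + u * (T - t0))) ?_ ?_ ?_ ?_
  · exact (vert_isometry.continuous.comp (by fun_prop)).continuousOn
  · simp
  · simp
  · rintro _ ⟨u, ⟨hu, _⟩, rfl⟩
    exact ⟨_, by nlinarith, rfl⟩

lemma claim2 {D R t0 s : ℝ} (hD0 : 0 ≤ D) (hD : ∀ i, dist y (k (FreeGroup.of i) • y) ≤ D)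
    (hR : D + 1 ≤ R) (ht0 : ∀ t, t0 ≤ t → vert t ∈ Ms k y R)
    (hub : ∀ B, ∃ γ : FG r, B < nsq (k γ • y) ∧ 0 < s * (k γ • y).re)
    {γ0 : FG r} {A : SL2} (hA : pmk A = k γ0) (hc : A 1 0 ≠ 0)
    (hch : Ch k y R (vert t0) (k γ0 • vert t0)) : False := by
  set α := A 0 0 / A 1 0 with hα
  set nz : ℍ → ℝ := fun z => (z.re - α) ^ 2 + z.im ^ 2 with hnz
  have hnzc : Continuous nz := ((cont_re.sub continuous_const).pow 2).add (cont_im.pow 2)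
  have hnzpos : ∀ z, 0 < nz z := fun z => by have := z.im_pos; simp only [hnz]; positivity
  have hAz : ∀ z, k γ0 • z = A • z := fun z => by rw [← hA, pmk_smul]
  have hnzA : ∀ z, nz (A • z) = 1 / (A 1 0 ^ 2 * den A z) := nz_shift A hc
  have hc2 : 0 < A 1 0 ^ 2 := by positivity
  obtain ⟨b, hb, B, hκ0⟩ := joined_bdd (Ch_joined hch (ht0 t0 le_rfl)).symm hnzc hnzpos
  -- choose `n`
  have hden : ∀ z : ℍ, A 1 0 ^ 2 * nsq z / 2 - A 1 1 ^ 2 ≤ den A z := by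
    intro z; unfold den nsq
    nlinarith [sq_nonneg (A 1 0 * z.re + 2 * A 1 1), sq_nonneg (A 1 0 * z.im)]
  have hnzn : ∀ z : ℍ, nsq z / 2 - α ^ 2 ≤ nz z := by
    intro z; simp only [hnz]; unfold nsq
    nlinarith [sq_nonneg (z.re - 2 * α), sq_nonneg z.im]
  set E := Real.exp t0 ^ 2 with hE
  have hE0 : 0 < E := by positivity
  have tail_nz : ∀ t, t0 ≤ t → E ≤ nz (vert t) := by
    intro t ht
    simp only [hnz, vert_re, vert_im, hE]
    have : Real.exp t0 ^ 2 ≤ Real.exp t ^ 2 := by gcongr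
    nlinarith [sq_nonneg (0 - α)]
  have den_tail : ∀ t, A 1 0 ^ 2 * Real.exp t ^ 2 ≤ den A (vert t) := by
    intro t; unfold den; simp only [vert_re, vert_im]
    nlinarith [sq_nonneg (A 1 0 * 0 + A 1 1)]
  have qtail_nz : ∀ t, nz (A • vert t) ≤ 1 / (A 1 0 ^ 2 * (A 1 0 ^ 2 * Real.exp t ^ 2)) := by
    intro t
    rw [hnzA]
    apply one_div_le_one_div_of_le (by positivity)
    exact mul_le_mul_of_nonneg_left (den_tail t) hc2.le
  set B2 := 1 / (A 1 0 ^ 2 * (A 1 0 ^ 2 * E)) with hB2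
  have qtail_nz2 : ∀ t, t0 ≤ t → nz (A • vert t) ≤ B2 := by
    intro t ht
    refine (qtail_nz t).trans ?_
    rw [hB2]
    apply one_div_le_one_div_of_le (by positivity)
    have : E ≤ Real.exp t ^ 2 := by rw [hE]; gcongr
    gcongr
  set m := min b E with hm
  have hm0 : 0 < m := lt_min hb hE0
  obtain ⟨η, hη1, hη2⟩ := hub (max (2 * (max B B2 + α ^ 2))
    (2 * (1 / (A 1 0 ^ 2 * m) + A 1 1 ^ 2) / A 1 0 ^ 2))
  set o := k η • y with ho
  have ho1 : max B B2 < nz o := by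
    have := lt_of_le_of_lt (le_max_left _ _) hη1
    have := hnzn o
    linarith
  have ho2 : nz (A • o) < m := by
    rw [hnzA]
    have h1 := lt_of_le_of_lt (le_max_right _ _) hη1
    rw [div_lt_iff₀ hc2] at h1
    have h2 : 1 / (A 1 0 ^ 2 * m) < den A o := by
      have := hden o
      linarith
    rw [div_lt_iff₀ (by positivity)] at h2
    rw [div_lt_iff₀ (mul_pos hc2 (den_pos A o))]
    linarith
  -- the path in the orbit neighbourhood
  have hν0 : JoinedIn {z | ∃ η, dist z (k η • y) ≤ D} (A • o) o := by
    have := path_orbit k y hD0 hD ((γ0 * η)⁻¹ * η) (γ0 * η)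
    rwa [mul_inv_cancel_left, map_mul, mul_smul, hAz] at this
  obtain ⟨b3, hb3, B3, hν1⟩ := joined_bdd hν0 hnzc hnzpos
  obtain ⟨ν, hνc, hν_0, hν_1, hνm⟩ := joined_fun hν1
  -- choose `T`
  obtain ⟨T, hT0, hT1, hT2⟩ : ∃ T, t0 ≤ T ∧ B3 < nz (vert T) ∧ nz (A • vert T) < b3 := by
    set B4 := max B3 (1 / (A 1 0 ^ 2 * (A 1 0 ^ 2 * b3))) with hB4
    refine ⟨max t0 |B4|, le_max_left _ _, ?_⟩
    set T := max t0 |B4| with hT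
    have h1 : |B4| + 1 ≤ Real.exp T := by
      have := Real.add_one_le_exp T
      have := le_max_right t0 |B4|
      linarith
    have h2 : B4 < Real.exp T ^ 2 := by
      have := le_abs_self B4
      have := abs_nonneg B4
      nlinarith
    constructor
    · have := le_max_left B3 (1 / (A 1 0 ^ 2 * (A 1 0 ^ 2 * b3)))
      simp only [hnz, vert_re, vert_im]
      nlinarith [sq_nonneg (0 - α)]
    · refine (qtail_nz T).trans_lt ?_
      have := lt_of_le_of_lt (le_max_right B3 (1 / (A 1 0 ^ 2 * (A 1 0 ^ 2 * b3)))) h2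
      rw [div_lt_iff₀ (by positivity)] at this ⊢
      linarith
  -- the path κ
  set tl : Set ℍ := {z | ∃ t, t0 ≤ t ∧ z = vert t} with htl
  set ql : Set ℍ := {z | ∃ t, t0 ≤ t ∧ z = A • vert t} with hql
  set K0 : Set ℍ := {x | ∀ γ : FG r, R - 1 < dist x (k γ • y)} ∩ {z | b ≤ nz z ∧ nz z ≤ B} with hK0
  have hq : JoinedIn ql (A • vert T) (A • vert t0) := by
    have h1 : JoinedIn tl (vert t0) (vert T) := tail_joined hT0
    have h2 := h1.symm.map_continuousOn (f := fun z : ℍ => A • z) (continuous_const_smul A).continuousOn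
    refine h2.mono ?_
    rintro _ ⟨_, ⟨t, ht, rfl⟩, rfl⟩
    exact ⟨t, ht, rfl⟩
  have hκ1 : JoinedIn (ql ∪ K0 ∪ tl) (A • vert T) (vert T) := by
    rw [hAz] at hκ0
    exact ((hq.mono (by intro z hz; exact Or.inl (Or.inl hz))).trans
      (hκ0.mono (by intro z hz; exact Or.inl (Or.inr hz)))).trans
      ((tail_joined hT0).mono (by intro z hz; exact Or.inr hz))
  obtain ⟨κ, hκc, hκ_0, hκ_1, hκm⟩ := joined_fun hκ1
  have hs : s ≠ 0 := by rintro rfl; simp at hη2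
  set Φ : ℍ → ℂ := fun z => ⟨nz z, s * z.re⟩ with hΦ
  have hΦc : Continuous Φ :=
    Complex.equivRealProdCLM.symm.continuous.comp (hnzc.prodMk (continuous_const.mul cont_re))
  have hΦi : ∀ z w, Φ z = Φ w → z = w := by
    intro z w h
    have h1 : nz z = nz w := congrArg Complex.re h
    have h2 : s * z.re = s * w.re := congrArg Complex.im h
    have h3 := mul_left_cancel₀ hs h2
    refine uhp_ext h3 ?_
    simp only [hnz, h3] at h1
    have h4 : z.im ^ 2 = w.im ^ 2 := by linarith
    exact (sq_eq_sq₀ z.im_pos.le w.im_pos.le).1 h4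
  refine crossing (hΦc.comp hκc) (hΦc.comp hνc) ?_ ?_ ?_ ?_ ?_
  · intro t
    change nz (κ 0) < nz (ν t)
    rw [hκ_0]; exact hT2.trans_le (hνm t).2.1
  · intro t
    change nz (ν t) < nz (κ 1)
    rw [hκ_1]; exact lt_of_le_of_lt (hνm t).2.2 hT1
  · intro u hu
    change nz (κ u) = nz (ν 0) at hu
    change s * (ν 0).re < s * (κ u).re
    rw [hν_0] at hu ⊢
    rcases hκm u with (⟨t, ht, e⟩ | h) | ⟨t, ht, e⟩
    · rw [e] at hu ⊢
      rw [hnzA, hnzA] at hu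
      have hd : den A (vert t) = den A o := by
        have h1 := den_pos A (vert t)
        have h2 := den_pos A o
        field_simp at hu
        linarith
      rw [re_shift A hc, re_shift A hc, hd, vert_re, mul_zero, zero_add]
      have h2 := den_pos A o
      have : s * (A 0 0 / A 1 0 - A 1 1 / (A 1 0 * den A o)) -
          s * (A 0 0 / A 1 0 - (A 1 0 * o.re + A 1 1) / (A 1 0 * den A o)) =
          s * o.re / den A o := by
        field_simp; ring
      have h3 : 0 < s * o.re / den A o := div_pos hη2 h2
      linarith
    · have h1 := h.2.1
      have := min_le_left b E
      linarith
    · have h1 := tail_nz t ht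
      rw [← e] at h1
      have := min_le_right b E
      linarith
  · intro u hu
    change nz (κ u) = nz (ν 1) at hu
    change s * (κ u).re < s * (ν 1).re
    rw [hν_1] at hu ⊢
    rcases hκm u with (⟨t, ht, e⟩ | h) | ⟨t, ht, e⟩
    · have h1 := qtail_nz2 t ht
      rw [← e] at h1
      have := le_max_right B B2
      linarith
    · have h1 := h.2.2
      have := le_max_left B B2
      linarith
    · rw [e, vert_re, mul_zero]; exact hη2
  · intro u t h
    have e := hΦi _ _ h
    obtain ⟨δ, hδ⟩ := (hνm t).1
    rw [← e] at hδ
    have key : D < dist (κ u) (k δ • y) := by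
      rcases hκm u with (⟨t, ht, e⟩ | h) | ⟨t, ht, e⟩
      · have := Ms_smul (ht0 t ht) γ0 δ
        rw [e, ← hAz]; linarith
      · have := h.1 δ
        linarith
      · have := ht0 t ht δ
        rw [e]; linarith
    linarith

end


section
variable {r : ℕ} {k : FG r →* PSL2} {y : ℍ}

lemma cont_nsq : Continuous nsq := (cont_re.pow 2).add (cont_im.pow 2)

lemma claim3 {R t0 : ℝ} (ht0 : ∀ t, t0 ≤ t → vert t ∈ Ms k y R)
    (h2 : ∀ γ : FG r, γ ≠ 1 → ¬ Ch k y R (vert t0) (k γ • vert t0)) :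
    ∃ L, ∀ p, Ch k y R (vert t0) p → (∃ γ : FG r, dist p (k γ • y) ≤ R + 1) → nsq p ≤ L := by
  set Sg : Set (FG r) := {γ | ∃ p, Ch k y R (k γ • vert t0) p ∧ dist p y ≤ R + 1} with hSg
  have hfin : Sg.Finite := by
    have hcb : IsCompact (Metric.closedBall y (R + 1)) := isCompact_closedBall _ _
    obtain ⟨t, _, htf, hcov⟩ := hcb.finite_cover_balls (e := 1/2) (by norm_num)
    have hex : ∀ γ : FG r, γ ∈ Sg → ∃ c ∈ t, ∃ p, Ch k y R (k γ • vert t0) p ∧ dist p c < 1/2 := by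
      rintro γ ⟨p, hp, hd⟩
      have := hcov (Metric.mem_closedBall.2 hd)
      simp only [Set.mem_iUnion] at this
      obtain ⟨c, hc, hpc⟩ := this
      exact ⟨c, hc, p, hp, hpc⟩
    choose! c hc p hp hpc using hex
    refine Set.Finite.of_injOn (f := c) (fun γ hγ => hc γ hγ) ?_ htf
    intro γ hγ δ hδ heq
    by_contra hne
    have hMs : ∀ γ ∈ Sg, p γ ∈ Ms k y R := by
      intro γ hγ
      rcases Relation.ReflTransGen.cases_tail (hp γ hγ) with h | ⟨b, _, hb⟩
      · rw [h]; exact Ms_smul (ht0 t0 le_rfl) γ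
      · exact hb.2.1
    have hlt : dist (p γ) (p δ) < 1 := by
      have h1 := hpc γ hγ
      have h2 := hpc δ hδ
      rw [← heq] at h2
      have h3 := dist_triangle (p γ) (c γ) (p δ)
      rw [dist_comm (c γ)] at h3
      linarith
    have hch : Ch k y R (k γ • vert t0) (k δ • vert t0) :=
      Relation.ReflTransGen.trans ((hp γ hγ).tail ⟨hMs γ hγ, hMs δ hδ, hlt⟩) (Ch_symm (hp δ hδ))
    have := Ch_smul hch γ⁻¹
    rw [← mul_smul, ← map_mul, inv_mul_cancel, map_one, one_smul, ← mul_smul, ← map_mul] at this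
    refine h2 _ ?_ this
    intro h
    exact hne (inv_mul_eq_one.1 h)
  have hbd : ∀ γ : FG r, ∃ L, ∀ p, dist p (k γ • y) ≤ R + 1 → nsq p ≤ L := by
    intro γ
    obtain ⟨L, hL⟩ := ((isCompact_closedBall (k γ • y) (R + 1)).image cont_nsq).bddAbove
    exact ⟨L, fun p hp => hL ⟨p, hp, rfl⟩⟩
  choose L hL using hbd
  obtain ⟨L0, hL0⟩ := ((hfin.preimage inv_injective.injOn).image L).bddAbove
  refine ⟨L0, fun p hp ⟨γ, hγ⟩ => (hL γ p hγ).trans (hL0 ⟨γ, ?_, rfl⟩)⟩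
  refine ⟨k γ⁻¹ • p, Ch_smul hp _, ?_⟩
  rw [map_inv, pdist_inv]; exact hγ

def arcpt (ρ x : ℝ) (h : 0 < ρ) : ℍ :=
  ⟨⟨ρ * x / √(1 + x ^ 2), ρ / √(1 + x ^ 2)⟩, by
    change 0 < ρ / √(1 + x ^ 2); positivity⟩

lemma arcpt_cont {ρ : ℝ} (h : 0 < ρ) : Continuous (fun x => arcpt ρ x h) := by
  rw [UpperHalfPlane.isEmbedding_coe.continuous_iff]
  have h1 : Continuous fun x : ℝ => √(1 + x ^ 2) := by fun_prop
  have h2 : ∀ x : ℝ, √(1 + x ^ 2) ≠ 0 := fun x => by positivity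
  exact Complex.equivRealProdCLM.symm.continuous.comp
    (((continuous_const.mul continuous_id).div h1 h2).prodMk (continuous_const.div h1 h2))

lemma arcpt_nsq {ρ : ℝ} (h : 0 < ρ) (x : ℝ) : nsq (arcpt ρ x h) = ρ ^ 2 := by
  change (ρ * x / √(1 + x ^ 2)) ^ 2 + (ρ / √(1 + x ^ 2)) ^ 2 = _
  have h2 : √(1 + x ^ 2) ^ 2 = 1 + x ^ 2 := Real.sq_sqrt (by positivity)
  have h3 : (0:ℝ) < 1 + x ^ 2 := by positivity
  rw [div_pow, div_pow, h2]
  field_simp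
  ring

lemma arcpt_self (z : ℍ) : arcpt (√(nsq z)) (z.re / z.im) (Real.sqrt_pos.2 (nsq_pos z)) = z := by
  have hz := z.im_pos
  have h1 : √(1 + (z.re / z.im) ^ 2) = √(nsq z) / z.im := by
    rw [show 1 + (z.re / z.im) ^ 2 = nsq z / z.im ^ 2 by unfold nsq; field_simp; ring,
      Real.sqrt_div (nsq_pos z).le, Real.sqrt_sq hz.le]
  have h2 := Real.sqrt_pos.2 (nsq_pos z)
  apply uhp_ext
  · change √(nsq z) * (z.re / z.im) / √(1 + (z.re / z.im) ^ 2) = z.re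
    rw [h1]; field_simp
  · change √(nsq z) / √(1 + (z.re / z.im) ^ 2) = z.im
    rw [h1]; field_simp

lemma GF_aux (hT : ∀ C, ∃ t0, ∀ t, t0 ≤ t → vert t ∈ Ms k y C)
    (hN : ∀ γ : FG r, γ ≠ 1 → ∀ A : SL2, pmk A = k γ → A 1 0 ≠ 0) :
    ∃ B, ∀ γ : FG r, nsq (k γ • y) ≤ B := by
  by_contra hcon
  push Not at hcon
  obtain ⟨D, hD0, hD⟩ : ∃ D, 0 ≤ D ∧ ∀ i : Fin r, dist y (k (FreeGroup.of i) • y) ≤ D := by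
    obtain ⟨D, hD⟩ := (Set.finite_range fun i : Fin r => dist y (k (FreeGroup.of i) • y)).bddAbove
    exact ⟨max 0 D, le_max_left _ _, fun i => (hD ⟨i, rfl⟩).trans (le_max_right _ _)⟩
  obtain ⟨t0, ht0⟩ := hT (D + 2)
  set R := D + 2 with hR
  have hre : ∀ γ : FG r, Real.exp t0 ^ 2 ≤ nsq (k γ • y) → (k γ • y).re ≠ 0 := by
    intro γ h1 h2
    set o := k γ • y with ho
    have e : o = vert (Real.log o.im) := by
      apply uhp_ext
      · rw [h2, vert_re]
      · rw [vert_im, Real.exp_log o.im_pos]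
    have h3 : Real.exp t0 ≤ o.im := by
      unfold nsq at h1
      rw [h2] at h1
      have := o.im_pos
      nlinarith [Real.exp_pos t0]
    have := ht0 (Real.log o.im) ((Real.le_log_iff_exp_le o.im_pos).2 h3) γ
    rw [← ho, ← e, dist_self] at this
    linarith
  obtain ⟨s, hs⟩ : ∃ s : ℝ, ∀ B, ∃ γ : FG r, B < nsq (k γ • y) ∧ 0 < s * (k γ • y).re := by
    by_contra hh
    push Not at hh
    obtain ⟨B1, h1⟩ := hh 1
    obtain ⟨B2, h2⟩ := hh (-1)
    obtain ⟨γ, hγ⟩ := hcon (max (max B1 B2) (Real.exp t0 ^ 2))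
    have g1 := h1 γ (lt_of_le_of_lt ((le_max_left _ _).trans (le_max_left _ _)) hγ)
    have g2 := h2 γ (lt_of_le_of_lt ((le_max_right _ _).trans (le_max_left _ _)) hγ)
    exact hre γ ((le_max_right _ _).trans hγ.le) (by linarith)
  have hc2 : ∀ γ : FG r, γ ≠ 1 → ¬ Ch k y R (vert t0) (k γ • vert t0) := by
    intro γ hγ hch
    obtain ⟨A, hA⟩ := pmk_surj (k γ)
    exact claim2 hD0 hD (by rw [hR]; linarith) ht0 hs hA (hN γ hγ A hA) hch
  obtain ⟨L, hL⟩ := claim3 ht0 hc2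
  obtain ⟨γ, hγ⟩ := hcon (max L (Real.exp t0 ^ 2))
  set o := k γ • y with ho
  have ho1 : L < nsq o := lt_of_le_of_lt (le_max_left _ _) hγ
  have ho2 : Real.exp t0 ^ 2 < nsq o := lt_of_le_of_lt (le_max_right _ _) hγ
  have hp := Real.sqrt_pos.2 (nsq_pos o)
  set W : Set ℍ := Set.range fun x => arcpt (√(nsq o)) x hp with hW
  have hWp : IsPreconnected W := isPreconnected_range (arcpt_cont hp)
  have hWn : ∀ z ∈ W, nsq z = nsq o := by
    rintro _ ⟨x, rfl⟩
    simp only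
    rw [arcpt_nsq, Real.sq_sqrt (nsq_pos o).le]
  have hfar : ∀ p, Ch k y R (vert t0) p → L < nsq p → p ∈ Ms k y (R + 1) := by
    intro p h1 h2 δ
    by_contra hh
    push Not at hh
    linarith [hL p h1 ⟨δ, hh.le⟩]
  have hnear : ∀ p z, Ch k y R (vert t0) p → L < nsq p → dist p z < 1 → Ch k y R (vert t0) z ∧
      z ∈ Ms k y R := by
    intro p z h1 h2 h3
    have h4 := hfar p h1 h2
    have h5 : z ∈ Ms k y R := by
      intro δ
      have := h4 δ
      have := dist_triangle p z (k δ • y)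
      linarith
    exact ⟨h1.tail ⟨fun δ => by have := h4 δ; linarith, h5, h3⟩, h5⟩
  set u : Set ℍ := {z | ∃ p, (Ch k y R (vert t0) p ∧ L < nsq p) ∧ dist p z < 1} with hu
  have huo : IsOpen u := by
    have : u = ⋃ p ∈ {p | Ch k y R (vert t0) p ∧ L < nsq p}, Metric.ball p 1 := by
      ext z; simp [hu, dist_comm]
    rw [this]
    exact isOpen_biUnion fun p _ => Metric.isOpen_ball
  have hsub : W ⊆ u := by
    apply hWp.subset_of_closure_inter_subset huo
    · have hv : vert (Real.log √(nsq o)) = arcpt (√(nsq o)) 0 hp := by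
        apply uhp_ext
        · change 0 = √(nsq o) * 0 / √(1 + 0 ^ 2); simp
        · rw [vert_im, Real.exp_log hp]
          change √(nsq o) = √(nsq o) / √(1 + 0 ^ 2); simp
      have hmem : vert (Real.log √(nsq o)) ∈ W := ⟨0, hv.symm⟩
      refine ⟨vert (Real.log √(nsq o)), hmem, ⟨_, ⟨Ch_tail ht0 ?_, ?_⟩,
        by rw [dist_self]; norm_num⟩⟩
      · rw [Real.le_log_iff_exp_le hp]
        exact Real.le_sqrt_of_sq_le ho2.le
      · rw [hWn _ hmem]; exact ho1
    · rintro z ⟨hz1, hz2⟩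
      have hnb : {w | L < nsq w} ∩ Metric.ball z 1 ∈ 𝓝 z := by
        apply Filter.inter_mem _ (Metric.ball_mem_nhds z one_pos)
        exact (isOpen_lt continuous_const cont_nsq).mem_nhds (by
          change L < nsq z; rw [hWn z hz2]; exact ho1)
      obtain ⟨w, ⟨hw1, hw2⟩, p, ⟨hp1, hp2⟩, hp3⟩ := mem_closure_iff_nhds.1 hz1 _ hnb
      exact ⟨w, ⟨(hnear p w hp1 hp2 hp3).1, hw1⟩, hw2⟩
  obtain ⟨p, ⟨hp1, hp2⟩, hp3⟩ := hsub ⟨_, arcpt_self o⟩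
  have := (hnear p o hp1 hp2 hp3).2 γ
  rw [← ho, dist_self] at this
  linarith

end


/-! ### Geometric finiteness for crooked systems and uniform contraction -/

lemma tail_of_fin {r : ℕ} {k : FG r →* PSL2} {y : ℍ}
    (h : ∀ C, {γ : FG r | ∃ t, dist (k γ • y) (vert t) ≤ C}.Finite) (C : ℝ) :
    ∃ t0, ∀ t, t0 ≤ t → vert t ∈ Ms k y C := by
  obtain ⟨L, hL⟩ := ((h C).image fun γ => dist (vert 0) (k γ • y)).bddAbove
  refine ⟨max 0 (L + C + 1), fun t ht γ => ?_⟩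
  by_contra hh
  push Not at hh
  rw [dist_comm] at hh
  have h1 : dist (vert 0) (k γ • y) ≤ L := hL ⟨γ, ⟨t, hh.le⟩, rfl⟩
  have h2 := dist_triangle (vert 0) (k γ • y) (vert t)
  rw [vert_isometry.dist_eq 0 t, Real.dist_eq, zero_sub, abs_neg] at h2
  have := le_abs_self t
  have := le_max_right 0 (L + C + 1)
  linarith

section
variable {r : ℕ} {j ρ : FG r →* PSL2} (S : CS r j ρ)

lemma CS.GF_frame (a : S.I) (x0 : ℍ) (V : PSL2) (hV : ∀ t, ∃ t', V • vert t = vert t')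
    (hN : ∀ X : SL2, (∀ i k, X i k ≠ 0) → ∀ A : SL2, pmk A = V⁻¹ * pmk X * V → A 1 0 ≠ 0) :
    ∃ B, ∀ γ : FG r, nsq (V⁻¹ • (S.M a)⁻¹ • j γ • x0) ≤ B := by
  set m := S.M a * V with hm
  set k : FG r →* PSL2 := (MulAut.conj m⁻¹).toMonoidHom.comp j with hk
  have hkγ : ∀ γ, k γ = m⁻¹ * j γ * m := fun γ => by simp [hk, MulAut.conj_apply]
  have hky : ∀ γ, k γ • (m⁻¹ • x0) = V⁻¹ • (S.M a)⁻¹ • j γ • x0 := by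
    intro γ
    rw [hkγ, ← mul_smul, ← mul_smul, ← mul_smul, hm]; congr 1; group
  have := GF_aux (k := k) (y := m⁻¹ • x0) (tail_of_fin ?_) ?_
  · obtain ⟨B, hB⟩ := this
    exact ⟨B, fun γ => by rw [← hky]; exact hB γ⟩
  · intro C
    have := S.local_fin x0 C
    have hinj : Function.Injective (fun γ : FG r => S.act γ⁻¹ a) := by
      intro γ δ h
      simpa [CS.act] using h
    apply (this.preimage hinj.injOn).subset
    rintro γ ⟨t, ht⟩
    obtain ⟨t', ht'⟩ := hV t
    refine ⟨t', ?_⟩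
    rw [hky, pdist_inv, ht', pdist_inv] at ht
    rw [S.M_act, map_inv, mul_smul, dist_comm, pdist_inv, dist_comm]
    exact ht
  · intro γ hγ A hA
    obtain ⟨X, hX⟩ := pmk_surj ((S.M a)⁻¹ * S.M (S.act γ a))
    have hne : a ≠ S.act γ a := by
      intro h
      apply hγ
      have := congrArg Prod.fst h
      simpa [CS.act] using this
    refine hN X (S.entries_ne hne hX) A ?_
    rw [hA, hkγ, hX, S.M_act, hm]; group

lemma CS.GF (a : S.I) (x0 : ℍ) :
    ∃ B > 0, ∀ γ : FG r, nsq ((S.M a)⁻¹ • j γ • x0) ≤ B ∧ 1 ≤ B * nsq ((S.M a)⁻¹ • j γ • x0) := by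
  obtain ⟨B1, h1⟩ := S.GF_frame a x0 1 (fun t => ⟨t, by simp⟩) (by
    intro X hX A hA
    rw [inv_one, one_mul, mul_one] at hA
    rcases (pmk_eq_iff _ _).1 hA with rfl | rfl
    · exact hX 1 0
    · have := hX 1 0
      rw [sl2_neg_entry] at this
      exact neg_ne_zero.1 this)
  obtain ⟨B2, h2⟩ := S.GF_frame a x0 (pmk wSL) (fun t => ⟨-t, by rw [pmk_smul, wSL_vert]⟩) (by
    intro X hX A hA
    rw [← pmk_inv, ← pmk_mul, ← pmk_mul] at hA
    have h01 := hX 0 1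
    have e : (wSL⁻¹ * X * wSL) 1 0 = - X 0 1 := by
      simp [sl2_mul_10, sl2_mul_11, wSL]
    rcases (pmk_eq_iff _ _).1 hA with h | h
    · rw [← h, e]; exact neg_ne_zero.2 h01
    · have : (-A) 1 0 = - X 0 1 := by rw [← h, e]
      rw [sl2_neg_entry, neg_inj] at this
      rw [this]; exact h01)
  refine ⟨max 1 (max B1 B2), by positivity, fun γ => ⟨?_, ?_⟩⟩
  · have := h1 γ
    rw [inv_one, one_smul] at this
    exact this.trans ((le_max_left _ _).trans (le_max_right _ _))
  · have := h2 γ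
    rw [w_inv, pmk_smul, wSL_nsq] at this
    have h3 := nsq_pos ((S.M a)⁻¹ • j γ • x0)
    rw [div_le_iff₀ h3] at this
    have h4 : B2 ≤ max 1 (max B1 B2) := (le_max_right _ _).trans (le_max_right _ _)
    nlinarith

end


section
variable {r : ℕ} {j ρ : FG r →* PSL2} (S : CS r j ρ)

lemma CS.GFu (x0 : ℍ) : ∃ B ≥ 1, ∀ a : S.I, nsq ((S.M a)⁻¹ • x0) ≤ B ∧
    1 ≤ B * nsq ((S.M a)⁻¹ • x0) := by
  have := S.fin
  choose B hB0 hB using fun i : S.J => S.GF ((1 : FG r), i) x0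
  obtain ⟨L, hL⟩ := (Set.finite_range B).bddAbove
  refine ⟨max 1 L, le_max_left _ _, fun a => ?_⟩
  have h1 := hB a.2 a.1⁻¹
  have e : (S.M ((1 : FG r), a.2))⁻¹ • j a.1⁻¹ • x0 = (S.M a)⁻¹ • x0 := by
    rw [← mul_smul]; congr 1; simp only [CS.M]; rw [map_inv, map_one]; group
  rw [e] at h1
  have h2 : B a.2 ≤ max 1 L := (hL ⟨a.2, rfl⟩).trans (le_max_right _ _)
  have h3 := nsq_pos ((S.M a)⁻¹ • x0)
  exact ⟨h1.1.trans h2, h1.2.trans (mul_le_mul_of_nonneg_right h2 h3.le)⟩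

lemma dist_vert_ge {z : ℍ} {B : ℝ} (hB : 1 ≤ B) (h1 : nsq z ≤ B) (h2 : 1 ≤ B * nsq z) (t : ℝ) :
    dist z (vert 0) + |t| - Real.log (2 * (B * (B + 1))) ≤ dist z (vert t) := by
  have hz := z.im_pos
  have hn := nsq_pos z
  set c := B * (B + 1) with hc
  have hc0 : 0 < c := by positivity
  have h3 : Real.exp |t| ≤ B * (Real.exp (-t) * nsq z + Real.exp t) := by
    have e1 := Real.exp_pos t
    have e2 := Real.exp_pos (-t)
    rcases le_total 0 t with h | h
    · rw [abs_of_nonneg h]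
      have : 0 ≤ Real.exp (-t) * nsq z := by positivity
      nlinarith
    · rw [abs_of_nonpos h]
      nlinarith
  have h4 : Real.exp |t| * Real.cosh (dist z (vert 0)) ≤ c * Real.cosh (dist z (vert t)) := by
    rw [cosh_dist_vert, cosh_dist_vert, neg_zero, Real.exp_zero, one_mul, ← mul_div_assoc,
      ← mul_div_assoc]
    apply div_le_div_of_nonneg_right _ (by positivity)
    have := Real.exp_pos |t|
    calc Real.exp |t| * (nsq z + 1) ≤ Real.exp |t| * (B + 1) := by gcongr
      _ ≤ (B * (Real.exp (-t) * nsq z + Real.exp t)) * (B + 1) := by gcongr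
      _ = _ := by rw [hc]; ring
  have h5 : Real.exp (dist z (vert 0)) ≤ 2 * Real.cosh (dist z (vert 0)) := by
    rw [Real.cosh_eq]; have := Real.exp_pos (-dist z (vert 0)); linarith
  have h6 : Real.cosh (dist z (vert t)) ≤ Real.exp (dist z (vert t)) := by
    rw [Real.cosh_eq]
    have : Real.exp (-dist z (vert t)) ≤ Real.exp (dist z (vert t)) :=
      Real.exp_le_exp.2 (by linarith [dist_nonneg (x := z) (y := vert t)])
    linarith
  have h7 : Real.exp (dist z (vert 0) + |t|) ≤
      Real.exp (dist z (vert t) + Real.log (2 * c)) := by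
    rw [Real.exp_add, Real.exp_add, Real.exp_log (by positivity)]
    have := Real.exp_pos |t|
    nlinarith
  have := Real.exp_le_exp.1 h7
  linarith

lemma CS.PPfin (x0 y0 : ℍ) (C : ℝ) :
    {a : S.I | ∃ t, dist x0 (S.M a • vert t) ≤ dist y0 (S.F a • vert t) + C}.Finite := by
  by_cases hemp : Nonempty S.I
  swap
  · have : IsEmpty S.I := not_nonempty_iff.1 hemp
    exact Set.toFinite _
  obtain ⟨a0⟩ := hemp
  have := S.fin
  obtain ⟨B, hB, hGF⟩ := S.GFu x0
  set c := Real.log (2 * (B * (B + 1))) with hc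
  set C' := |C + c| + (dist x0 (S.M a0 • vert 0) + dist y0 (S.F a0 • vert 0)) with hC'
  have hu := Set.finite_iUnion (fun i : S.J =>
    (kak S.pd x0 y0 (S.m i • vert 0) (S.f i • vert 0) C').image (fun γ => ((γ, i) : S.I)))
  apply hu.subset
  rintro ⟨γ, i⟩ ⟨t, ht⟩
  rw [Set.mem_iUnion]
  refine ⟨i, γ, ?_, rfl⟩
  change |_| ≤ C'
  set a : S.I := (γ, i) with ha
  have e1 : j γ • S.m i • vert 0 = S.M a • vert 0 := by rw [← mul_smul]; rfl
  have e2 : ρ γ • S.f i • vert 0 = S.F a • vert 0 := by rw [← mul_smul]; rfl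
  rw [e1, e2]
  have h1 := dist_vert_ge hB (hGF a).1 (hGF a).2 t
  rw [pdist_inv, pdist_inv] at h1
  have h2 := dist_triangle y0 (S.F a • vert 0) (S.F a • vert t)
  rw [dist_smul, vert_isometry.dist_eq, Real.dist_eq, zero_sub, abs_neg] at h2
  have h3 := S.lip a0 a 0 0
  have h4 := dist_triangle y0 (S.F a0 • vert 0) (S.F a • vert 0)
  rw [dist_comm (S.F a0 • vert 0)] at h4
  have h5 := dist_triangle (S.M a • vert 0) x0 (S.M a0 • vert 0)
  rw [dist_comm _ x0] at h5
  have h6 := le_abs_self (C + c)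
  have h7 := abs_nonneg (C + c)
  have h8 := dist_nonneg (x := x0) (y := S.M a0 • vert 0)
  have h9 := dist_nonneg (x := y0) (y := S.F a0 • vert 0)
  rw [abs_le]; constructor <;> linarith

end


lemma alg_ratio {a b c d B : ℝ} (hdet : a * d - b * c = 1) (hB : 1 ≤ B)
    (h : a ^ 2 + b ^ 2 ≤ B * (c ^ 2 + d ^ 2)) (hL : 4 * B * c ^ 2 < a ^ 2) :
    (a ^ 2 + c ^ 2) * (b ^ 2 + d ^ 2) ≤ 8 * B + 9 := by
  have hb : b ^ 2 ≤ B * d ^ 2 := by nlinarith [sq_nonneg a]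
  have hc2 : B * c ^ 2 ≤ a ^ 2 / 4 := by linarith
  have hc : c ^ 2 ≤ a ^ 2 := by nlinarith [sq_nonneg c]
  have hv : (b * c) ^ 2 ≤ (a * d) ^ 2 / 4 := by
    calc (b * c) ^ 2 = b ^ 2 * c ^ 2 := by ring
      _ ≤ (B * d ^ 2) * c ^ 2 := by gcongr
      _ = d ^ 2 * (B * c ^ 2) := by ring
      _ ≤ d ^ 2 * (a ^ 2 / 4) := by gcongr
      _ = _ := by ring
  have hu : (a * d) ^ 2 ≤ 4 := by
    have h1 : |b * c| ≤ |a * d| / 2 := by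
      have h0 : (0:ℝ) ≤ |a * d| / 2 := by positivity
      rw [← abs_of_nonneg h0]
      apply sq_le_sq.1
      rw [div_pow, sq_abs]; linarith
    have h2 : |a * d| ≤ 2 := by
      have e : a * d = 1 + b * c := by linarith
      have h3 : |1 + b * c| ≤ |(1:ℝ)| + |b * c| := abs_add_le _ _
      rw [← e, abs_one] at h3
      linarith
    rw [← sq_abs]; nlinarith [abs_nonneg (a * d)]
  have h1 : (a * b) ^ 2 ≤ 4 * B := by
    calc (a * b) ^ 2 = a ^ 2 * b ^ 2 := by ring
      _ ≤ a ^ 2 * (B * d ^ 2) := by gcongr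
      _ = B * (a * d) ^ 2 := by ring
      _ ≤ B * 4 := by gcongr
      _ = _ := by ring
  have h2 : (c * d) ^ 2 ≤ 4 := by
    calc (c * d) ^ 2 = c ^ 2 * d ^ 2 := by ring
      _ ≤ a ^ 2 * d ^ 2 := by gcongr
      _ = (a * d) ^ 2 := by ring
      _ ≤ 4 := hu
  have e : (a ^ 2 + c ^ 2) * (b ^ 2 + d ^ 2) = (a * b + c * d) ^ 2 + (a * d - b * c) ^ 2 := by ring
  rw [e, hdet]
  nlinarith [sq_nonneg (a * b - c * d)]

lemma alg_all {X : SL2} {B : ℝ} (hB : 1 ≤ B)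
    (h1 : X 0 0 ^ 2 + X 0 1 ^ 2 ≤ B * (X 1 0 ^ 2 + X 1 1 ^ 2))
    (h2 : X 1 0 ^ 2 + X 1 1 ^ 2 ≤ B * (X 0 0 ^ 2 + X 0 1 ^ 2))
    (h3 : 8 * B + 9 < (X 0 0 ^ 2 + X 1 0 ^ 2) * (X 0 1 ^ 2 + X 1 1 ^ 2)) :
    ∀ i k, X 0 k ^ 2 + X 1 k ^ 2 ≤ (1 + 4 * B) * X i k ^ 2 := by
  have hd := sl2_det X
  have c1 : X 0 0 ^ 2 ≤ 4 * B * X 1 0 ^ 2 := by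
    by_contra hh
    push Not at hh
    linarith [alg_ratio hd hB h1 hh]
  have c2 : X 1 0 ^ 2 ≤ 4 * B * X 0 0 ^ 2 := by
    by_contra hh
    push Not at hh
    have := alg_ratio (a := X 1 0) (b := X 1 1) (c := - X 0 0) (d := - X 0 1) (B := B)
      (by linarith) hB (by simpa using h2) (by simpa using hh)
    simp only [neg_sq] at this
    linarith
  have c3 : X 0 1 ^ 2 ≤ 4 * B * X 1 1 ^ 2 := by
    by_contra hh
    push Not at hh
    have := alg_ratio (a := X 0 1) (b := - X 0 0) (c := X 1 1) (d := - X 1 0) (B := B)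
      (by linarith) hB (by simp only [neg_sq]; linarith) hh
    simp only [neg_sq] at this
    linarith
  have c4 : X 1 1 ^ 2 ≤ 4 * B * X 0 1 ^ 2 := by
    by_contra hh
    push Not at hh
    have := alg_ratio (a := X 1 1) (b := - X 1 0) (c := - X 0 1) (d := X 0 0) (B := B)
      (by linarith) hB (by simp only [neg_sq]; linarith) (by simpa using hh)
    simp only [neg_sq] at this
    linarith
  intro i k
  fin_cases i <;> fin_cases k <;> simp only [Fin.zero_eta, Fin.mk_one, Fin.isValue] <;> linarith

lemma lines_cosh0 (X : SL2) (t : ℝ) : Real.cosh (dist (X • vert t) (vert 0)) =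
    ((X 0 0 ^ 2 + X 1 0 ^ 2) * Real.exp t + (X 0 1 ^ 2 + X 1 1 ^ 2) / Real.exp t) / 2 := by
  rw [cosh_dist_lines]
  rw [show t - 0 = t by ring, show -0 - t = -t by ring, show 0 + t = t by ring,
    show 0 - t = -t by ring, Real.exp_neg]
  ring

section
variable {r : ℕ} {j ρ : FG r →* PSL2} (S : CS r j ρ)

lemma CS.unif (a : S.I) : ∃ K > 0, ∀ b, a ≠ b → ∀ s t,
    dist (S.F b • vert t) (S.F a • vert s) ≤ dist (S.M b • vert t) (S.M a • vert s) - K := by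
  have := S.fin
  -- uniform bound
  obtain ⟨B, hB, hGF⟩ : ∃ B ≥ 1, ∀ b : S.I, nsq ((S.M a)⁻¹ • S.M b • vert 0) ≤ B ∧
      1 ≤ B * nsq ((S.M a)⁻¹ • S.M b • vert 0) := by
    choose B hB0 hB using fun i : S.J => S.GF a (S.m i • vert 0)
    obtain ⟨L, hL⟩ := (Set.finite_range B).bddAbove
    refine ⟨max 1 L, le_max_left _ _, fun b => ?_⟩
    have h1 := hB b.2 b.1
    have e : j b.1 • S.m b.2 • vert 0 = S.M b • vert 0 := by rw [← mul_smul]; rfl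
    rw [e] at h1
    have h2 : B b.2 ≤ max 1 L := (hL ⟨b.2, rfl⟩).trans (le_max_right _ _)
    have h3 := nsq_pos ((S.M a)⁻¹ • S.M b • vert 0)
    exact ⟨h1.1.trans h2, h1.2.trans (mul_le_mul_of_nonneg_right h2 h3.le)⟩
  set C := Real.log (1 + 4 * B) + 1 with hC
  set C1 := 8 * B + 9 with hC1
  have f1 := S.PPfin (S.M a • vert 0) (S.F a • vert 0) C
  have f2 := S.local_fin (S.M a • vert 0) C1
  have hgood : ∀ b, a ≠ b → b ∉ {b : S.I | ∃ t, dist (S.M a • vert 0) (S.M b • vert t) ≤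
      dist (S.F a • vert 0) (S.F b • vert t) + C} →
      b ∉ {b : S.I | ∃ t, dist (S.M a • vert 0) (S.M b • vert t) ≤ C1} → ∀ s t,
      dist (S.F b • vert t) (S.F a • vert s) ≤ dist (S.M b • vert t) (S.M a • vert s) - 1 := by
    intro b hab hb1 hb2
    have hb1' : ∀ t, dist (S.F a • vert 0) (S.F b • vert t) + C <
        dist (S.M a • vert 0) (S.M b • vert t) := by
      intro t; by_contra hh; push Not at hh; exact hb1 ⟨t, hh⟩
    have hb2' : ∀ t, C1 < dist (S.M a • vert 0) (S.M b • vert t) := by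
      intro t; by_contra hh; push Not at hh; exact hb2 ⟨t, hh⟩
    obtain ⟨X, hX⟩ := pmk_surj ((S.M a)⁻¹ * S.M b)
    obtain ⟨Y, hY⟩ := pmk_surj ((S.F a)⁻¹ * S.F b)
    have eX : (S.M a)⁻¹ • S.M b • vert 0 = X • vert 0 := by rw [← mul_smul, ← hX, pmk_smul]
    have hG := hGF b
    rw [eX, smul_nsq] at hG
    have hdp := den_pos X (vert 0)
    have eN : nume X (vert 0) = X 0 0 ^ 2 + X 0 1 ^ 2 := by simp [nume]; ring
    have eD : den X (vert 0) = X 1 0 ^ 2 + X 1 1 ^ 2 := by simp [den]; ring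
    rw [eN, eD] at hG
    rw [eD] at hdp
    have g1 := (div_le_iff₀ hdp).1 hG.1
    have g2 := hG.2
    rw [← mul_div_assoc, le_div_iff₀ hdp, one_mul] at g2
    set p := X 0 0 ^ 2 + X 1 0 ^ 2 with hp
    set q := X 0 1 ^ 2 + X 1 1 ^ 2 with hq
    have hn := S.entries_ne hab hX
    have hp0 : 0 < p := by have := hn 0 0; positivity
    have hq0 : 0 < q := by have := hn 0 1; positivity
    have hpq : 8 * B + 9 < p * q := by
      have h1 := hb2' (Real.log (√(q / p)))
      rw [dist_comm, dist_rel hX] at h1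
      have hsp : 0 < √(q / p) := Real.sqrt_pos.2 (div_pos hq0 hp0)
      have h2 := lines_cosh0 X (Real.log (√(q / p)))
      rw [Real.exp_log hsp] at h2
      have h3 : dist (X • vert (Real.log √(q / p))) (vert 0) + 1 ≤
          2 * Real.cosh (dist (X • vert (Real.log √(q / p))) (vert 0)) := by
        rw [Real.cosh_eq]
        have := Real.add_one_le_exp (dist (X • vert (Real.log √(q / p))) (vert 0))
        have := Real.exp_pos (-dist (X • vert (Real.log √(q / p))) (vert 0))
        linarith
      have h4 : √(q / p) ^ 2 = q / p := Real.sq_sqrt (div_pos hq0 hp0).le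
      have h5 : (p * √(q / p) + q / √(q / p)) ^ 2 = 4 * (p * q) := by
        have e : q / √(q / p) = p * √(q / p) := by
          rw [div_eq_iff hsp.ne', mul_assoc, ← sq, h4]; field_simp
        rw [e, ← two_mul, mul_pow, mul_pow, h4]; field_simp; norm_num
      have h6 : 8 * B + 10 < p * √(q / p) + q / √(q / p) := by
        rw [h2] at h3; rw [hC1] at h1; linarith
      nlinarith
    have hr := alg_all hB g1 g2 hpq
    have hcol : (Y 0 0 ^ 2 + Y 1 0 ^ 2) ≤ Real.exp (-C) * p ∧
        (Y 0 1 ^ 2 + Y 1 1 ^ 2) ≤ Real.exp (-C) * q := by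
      apply lin_both
      intro u hu
      have h1 := (hb1' (Real.log u)).le
      rw [dist_comm (S.M a • vert 0), dist_rel hX, dist_comm, dist_rel hY] at h1
      have h2 := cosh_sub_le (κ := C) dist_nonneg (le_sub_iff_add_le.2 h1)
      rw [lines_cosh0, lines_cosh0, Real.exp_log hu] at h2
      have e : Real.exp (-C) * p * u + Real.exp (-C) * q / u = Real.exp (-C) * (p * u + q / u) := by
        ring
      rw [e]
      linarith
    have hex : Real.exp (-C) * (1 + 4 * B) = Real.exp (-1) := by
      rw [hC, neg_add, Real.exp_add, Real.exp_neg, Real.exp_log (by positivity)]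
      field_simp
    have hep := Real.exp_pos (-C)
    intro s t
    rw [dist_rel hX, dist_rel hY]
    apply contr_of zero_le_one
    intro i k
    have h0 : Y i k ^ 2 ≤ Y 0 k ^ 2 + Y 1 k ^ 2 := by
      fin_cases i
      · simp only [Fin.zero_eta]; nlinarith [sq_nonneg (Y 1 k)]
      · simp only [Fin.mk_one]; nlinarith [sq_nonneg (Y 0 k)]
    have h1 : Y 0 k ^ 2 + Y 1 k ^ 2 ≤ Real.exp (-C) * (X 0 k ^ 2 + X 1 k ^ 2) := by
      fin_cases k
      · exact hcol.1
      · exact hcol.2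
    calc Y i k ^ 2 ≤ Real.exp (-C) * (X 0 k ^ 2 + X 1 k ^ 2) := h0.trans h1
      _ ≤ Real.exp (-C) * ((1 + 4 * B) * X i k ^ 2) := by gcongr; exact hr i k
      _ = _ := by rw [← mul_assoc, hex]
  -- finitely many exceptions
  have hfin := f1.union f2
  have hex : ∀ b : S.I, ∃ κ > 0, a ≠ b → ∀ s t, dist (S.F b • vert t) (S.F a • vert s) ≤
      dist (S.M b • vert t) (S.M a • vert s) - κ := by
    intro b
    by_cases hab : a = b
    · exact ⟨1, one_pos, fun h => (h hab).elim⟩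
    · obtain ⟨κ, h0, h1⟩ := S.contr hab
      exact ⟨κ, h0, fun _ => h1⟩
  choose κ hκ0 hκ using hex
  obtain ⟨K, hK0, hK⟩ : ∃ K > 0, ∀ b ∈ {b : S.I | ∃ t, dist (S.M a • vert 0) (S.M b • vert t) ≤
      dist (S.F a • vert 0) (S.F b • vert t) + C} ∪
      {b : S.I | ∃ t, dist (S.M a • vert 0) (S.M b • vert t) ≤ C1}, K ≤ κ b := by
    rcases Set.eq_empty_or_nonempty ({b : S.I | ∃ t, dist (S.M a • vert 0) (S.M b • vert t) ≤
      dist (S.F a • vert 0) (S.F b • vert t) + C} ∪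
      {b : S.I | ∃ t, dist (S.M a • vert 0) (S.M b • vert t) ≤ C1}) with he | hne
    · exact ⟨1, one_pos, fun b hb => by rw [he] at hb; exact hb.elim⟩
    · obtain ⟨b0, _, hmin⟩ := Set.exists_min_image _ κ hfin hne
      exact ⟨κ b0, hκ0 b0, hmin⟩
  refine ⟨min K 1, by positivity, fun b hab s t => ?_⟩
  by_cases hb : b ∈ {b : S.I | ∃ t, dist (S.M a • vert 0) (S.M b • vert t) ≤
      dist (S.F a • vert 0) (S.F b • vert t) + C} ∪
      {b : S.I | ∃ t, dist (S.M a • vert 0) (S.M b • vert t) ≤ C1}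
  · have h1 := hκ b hab s t
    have h2 := hK b hb
    have := min_le_left K 1
    linarith
  · have h1 := hgood b hab (fun h => hb (Or.inl h)) (fun h => hb (Or.inr h)) s t
    have := min_le_right K 1
    linarith

lemma CS.uniform : ∃ K > 0, ∀ a b, a ≠ b → ∀ s t,
    dist (S.F b • vert t) (S.F a • vert s) ≤ dist (S.M b • vert t) (S.M a • vert s) - K := by
  have := S.fin
  choose K hK0 hK using fun i : S.J => S.unif ((1 : FG r), i)
  obtain ⟨K0, hK00, hKmin⟩ : ∃ K0 > 0, ∀ i, K0 ≤ K i := by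
    rcases isEmpty_or_nonempty S.J with h | h
    · exact ⟨1, one_pos, fun i => h.elim i⟩
    · obtain ⟨i, hi⟩ := Finite.exists_min K
      exact ⟨K i, hK0 i, hi⟩
  refine ⟨K0, hK00, fun a b hab s t => ?_⟩
  have h1 := hK a.2 (S.act a.1⁻¹ b) (fun h => hab ?_) s t
  · have e : ((1 : FG r), a.2) = S.act a.1⁻¹ a := by simp [CS.act]
    rw [e, S.M_act, S.M_act, S.F_act, S.F_act, mul_smul, mul_smul, mul_smul, mul_smul, dist_smul,
      dist_smul] at h1
    linarith [hKmin a.2]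
  · have e : ((1 : FG r), a.2) = S.act a.1⁻¹ a := by simp [CS.act]
    rw [e] at h
    exact S.act_inj _ h

end


/-! ### Sides of lines -/

lemma conv_aux (g : PSL2) : ∃ (α β : ℝ) (D : ℝ → ℝ), (∀ t, 0 < D t) ∧
    ∀ t, (g • vert t).re = (α * Real.exp t ^ 2 + β) / D t := by
  obtain ⟨A, rfl⟩ := pmk_surj g
  refine ⟨A 0 0 * A 1 0, A 0 1 * A 1 1, fun t => den A (vert t), fun t => den_pos _ _, fun t => ?_⟩
  rw [pmk_smul, re_vert]

lemma conv_nonneg (g : PSL2) (c : ℝ) {L t : ℝ} (h0 : 0 ≤ t) (hL : t ≤ L)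
    (h1 : 0 ≤ c * (g • vert 0).re) (h2 : 0 ≤ c * (g • vert L).re) : 0 ≤ c * (g • vert t).re := by
  obtain ⟨α, β, D, hD, h⟩ := conv_aux g
  rw [h] at h1 h2 ⊢
  rw [← mul_div_assoc] at h1 h2 ⊢
  rw [le_div_iff₀ (hD _), zero_mul] at h1 h2 ⊢
  have e1 : Real.exp 0 ^ 2 ≤ Real.exp t ^ 2 := by gcongr
  have e2 : Real.exp t ^ 2 ≤ Real.exp L ^ 2 := by gcongr
  rcases le_total 0 (c * α) with hc | hc
  · nlinarith
  · nlinarith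

lemma conv_pos (g : PSL2) (c : ℝ) {L t : ℝ} (h0 : 0 ≤ t) (hL : t ≤ L)
    (h1 : 0 < c * (g • vert 0).re) (h2 : 0 < c * (g • vert L).re) : 0 < c * (g • vert t).re := by
  obtain ⟨α, β, D, hD, h⟩ := conv_aux g
  rw [h] at h1 h2 ⊢
  rw [← mul_div_assoc] at h1 h2 ⊢
  rw [lt_div_iff₀ (hD _), zero_mul] at h1 h2 ⊢
  have e1 : Real.exp 0 ^ 2 ≤ Real.exp t ^ 2 := by gcongr
  have e2 : Real.exp t ^ 2 ≤ Real.exp L ^ 2 := by gcongr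
  rcases le_total 0 (c * α) with hc | hc
  · nlinarith
  · nlinarith

section
variable {r : ℕ} {j ρ : FG r →* PSL2} (S : CS r j ρ)

/-- Signed position of `p` with respect to the line of index `a`. -/
def CS.σ (a : S.I) (p : ℍ) : ℝ := ((S.M a)⁻¹ • p).re

/-- Side of the line `a` containing the line `b`. -/
def CS.sd (a b : S.I) : ℝ := S.σ a (S.M b • vert 0)

lemma smul_cont (g : PSL2) : Continuous (fun z : ℍ => g • z) := (pslIsom.isometry_smul g).continuous

lemma vert_cont : Continuous vert := vert_isometry.continuous

lemma CS.σ_cont (a : S.I) : Continuous (S.σ a) := cont_re.comp (smul_cont _)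

lemma CS.σ_self (a : S.I) (t : ℝ) : S.σ a (S.M a • vert t) = 0 := by
  simp [CS.σ, vert_re]

lemma CS.σ_zero {a : S.I} {p : ℍ} (h : S.σ a p = 0) : ∃ t, p = S.M a • vert t := by
  have h1 := vert_of_re (z := (S.M a)⁻¹ • p) h
  exact ⟨Real.log ((S.M a)⁻¹ • p).im, by rw [← h1, smul_inv_smul]⟩

lemma CS.σ_act (γ : FG r) (a : S.I) (p : ℍ) : S.σ (S.act γ a) (j γ • p) = S.σ a p := by
  rw [CS.σ, CS.σ, S.M_act, smul_smul]
  congr 2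
  group

lemma CS.σ_ne {a b : S.I} (h : a ≠ b) (t : ℝ) : S.σ a (S.M b • vert t) ≠ 0 := by
  intro h0
  obtain ⟨s, hs⟩ := S.σ_zero h0
  exact S.line_ne h s t hs

lemma CS.sd_ne {a b : S.I} (h : a ≠ b) : S.sd a b ≠ 0 := S.σ_ne h 0

lemma CS.sd_pos {a b : S.I} (h : a ≠ b) (t : ℝ) : 0 < S.sd a b * S.σ a (S.M b • vert t) := by
  have hc : Continuous (fun t => S.σ a (S.M b • vert t)) :=
    (S.σ_cont a).comp ((smul_cont _).comp vert_cont)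
  rcases lt_or_gt_of_ne (S.sd_ne h) with h0 | h0
  · exact mul_pos_of_neg_of_neg h0 (avoid_lt hc (S.σ_ne h) (a := 0) h0 t)
  · exact mul_pos h0 (avoid_gt hc (S.σ_ne h) (a := 0) h0 t)

lemma CS.cross (a : S.I) {z w : ℍ} (h : S.σ a z * S.σ a w ≤ 0) :
    ∃ s, dist z (S.M a • vert s) + dist (S.M a • vert s) w = dist z w ∧
      ∀ b c, 0 ≤ c * S.σ b z → 0 ≤ c * S.σ b w → 0 ≤ c * S.σ b (S.M a • vert s) := by
  obtain ⟨k, hz, hw⟩ := two_point z w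
  set L := dist z w with hL
  have hL0 : 0 ≤ L := dist_nonneg
  have hz' : z = k⁻¹ • vert 0 := by rw [← hz, inv_smul_smul]
  have hw' : w = k⁻¹ • vert L := by rw [← hw, inv_smul_smul]
  have hσ : ∀ b t, S.σ b (k⁻¹ • vert t) = (((S.M b)⁻¹ * k⁻¹) • vert t).re := by
    intro b t; rw [CS.σ, smul_smul]
  have hc : Continuous (fun t => S.σ a (k⁻¹ • vert t)) :=
    (S.σ_cont a).comp ((smul_cont _).comp vert_cont)
  obtain ⟨t, ⟨ht0, htL⟩, ht⟩ : ∃ t ∈ Set.Icc 0 L, S.σ a (k⁻¹ • vert t) = 0 := by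
    have hz2 : S.σ a z = S.σ a (k⁻¹ • vert 0) := by rw [← hz']
    have hw2 : S.σ a w = S.σ a (k⁻¹ • vert L) := by rw [← hw']
    rw [hz2, hw2] at h
    rcases mul_nonpos_iff.1 h with ⟨h1, h2⟩ | ⟨h1, h2⟩
    · exact intermediate_value_Icc' hL0 hc.continuousOn ⟨h2, h1⟩
    · exact intermediate_value_Icc hL0 hc.continuousOn ⟨h1, h2⟩
  obtain ⟨s, hs⟩ := S.σ_zero ht
  refine ⟨s, ?_, ?_⟩
  · rw [← hs]
    conv_lhs => rw [hz', hw']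
    rw [dist_smul, dist_smul, vert_isometry.dist_eq, vert_isometry.dist_eq, Real.dist_eq, Real.dist_eq,
      abs_sub_comm, abs_sub_comm t L, abs_of_nonneg (by linarith), abs_of_nonneg (by linarith)]
    ring
  · intro b c h1 h2
    rw [← hs, hσ]
    rw [hz', hσ] at h1
    rw [hw', hσ] at h2
    exact conv_nonneg _ c ht0 htL h1 h2

lemma CS.geomsep {a b : S.I} (hab : a ≠ b) {p : ℍ} (h : S.σ a p * S.sd a b < 0) :
    0 < S.σ b p * S.sd b a := by
  by_contra hle
  push Not at hle
  obtain ⟨s, -, hs⟩ := S.cross b hle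
  have h1 := hs a (S.σ a p) (mul_self_nonneg _) (by rw [S.σ_self, mul_zero])
  have h2 := S.sd_pos hab s
  rcases lt_or_gt_of_ne (S.sd_ne hab) with h0 | h0
  · have := neg_of_mul_pos_right h2 h0.le
    have := pos_of_mul_neg_left h h0.le
    nlinarith
  · have := pos_of_mul_pos_right h2 h0.le
    have : S.σ a p < 0 := by
      by_contra hc
      push Not at hc
      nlinarith
    nlinarith

/-- Union of all the lines. -/
def CS.U : Set ℍ := ⋃ a : S.I, lineOf (S.M a)

lemma CS.mem_U (p : ℍ) : p ∈ S.U ↔ ∃ a, S.σ a p = 0 := by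
  rw [CS.U, Set.mem_iUnion]
  constructor
  · rintro ⟨a, t, rfl⟩
    exact ⟨a, S.σ_self a t⟩
  · rintro ⟨a, ha⟩
    obtain ⟨t, ht⟩ := S.σ_zero ha
    exact ⟨a, t, ht.symm⟩

/-- `p` lies on none of the lines. -/
def CS.gen (p : ℍ) : Prop := ∀ a, S.σ a p ≠ 0

lemma CS.gen_iff (p : ℍ) : p ∈ S.Uᶜ ↔ S.gen p := by
  rw [Set.mem_compl_iff, S.mem_U]; simp [CS.gen]

lemma CS.comp_eq {p : ℍ} (hp : S.gen p) :
    connectedComponentIn S.Uᶜ p = {q | ∀ a, 0 < S.σ a p * S.σ a q} := by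
  have hpU : p ∈ S.Uᶜ := (S.gen_iff p).2 hp
  apply Set.Subset.antisymm
  · intro q hq a
    by_contra hle
    push Not at hle
    have hpre : IsPreconnected (connectedComponentIn S.Uᶜ p) := isPreconnected_connectedComponentIn
    have hsub := connectedComponentIn_subset S.Uᶜ p
    have hpm := mem_connectedComponentIn hpU
    have him := hpre.image (S.σ a) (S.σ_cont a).continuousOn
    have hoc := him.ordConnected
    have h0 : (0 : ℝ) ∈ S.σ a '' connectedComponentIn S.Uᶜ p := by
      rcases mul_nonpos_iff.1 hle with ⟨h1, h2⟩ | ⟨h1, h2⟩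
      · exact hoc.out ⟨q, hq, rfl⟩ ⟨p, hpm, rfl⟩ ⟨h2, h1⟩
      · exact hoc.out ⟨p, hpm, rfl⟩ ⟨q, hq, rfl⟩ ⟨h1, h2⟩
    obtain ⟨y, hy, hy0⟩ := h0
    exact (S.gen_iff y).1 (hsub hy) a hy0
  · apply IsPreconnected.subset_connectedComponentIn
    · apply isPreconnected_of_forall p
      intro q hq
      obtain ⟨k, hz, hw⟩ := two_point p q
      set L := dist p q with hL
      have hL0 : 0 ≤ L := dist_nonneg
      have hz' : p = k⁻¹ • vert 0 := by rw [← hz, inv_smul_smul]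
      have hw' : q = k⁻¹ • vert L := by rw [← hw, inv_smul_smul]
      have hσ : ∀ b t, S.σ b (k⁻¹ • vert t) = (((S.M b)⁻¹ * k⁻¹) • vert t).re := by
        intro b t; rw [CS.σ, smul_smul]
      refine ⟨(fun t => k⁻¹ • vert t) '' Set.Icc 0 L, ?_, ⟨0, ⟨le_rfl, hL0⟩, hz'.symm⟩,
        ⟨L, ⟨hL0, le_rfl⟩, hw'.symm⟩, isPreconnected_Icc.image _
          ((smul_cont _).comp vert_cont).continuousOn⟩
      rintro _ ⟨t, ⟨h0, h1⟩, rfl⟩ a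
      simp only
      rw [hσ]
      refine conv_pos _ _ h0 h1 ?_ ?_
      · rw [← hσ, ← hz']; exact mul_self_pos.2 (hp a)
      · rw [← hσ, ← hw']; exact hq a
    · intro a; exact mul_self_pos.2 (hp a)
    · intro q hq
      rw [S.gen_iff]
      intro a h0
      have := hq a
      rw [h0, mul_zero] at this
      exact lt_irrefl _ this

lemma CS.gen_act (γ : FG r) {p : ℍ} (hp : S.gen p) : S.gen (j γ • p) := by
  intro a
  rw [← S.act_inv γ a, S.σ_act]
  exact hp _

end


/-! ### Half-spaces -/

lemma smul_cont_left (p : ℍ) : Continuous (fun h : PSL2 => h • p) := by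
  have hq : IsQuotientMap (pmk) := isQuotientMap_quot_mk
  rw [hq.continuous_iff]
  have : ContinuousSMul SL2 ℍ := UpperHalfPlane.instContinuousSMulSL2R
  have h1 : Continuous (fun A : SL2 => A • p) := continuous_id.smul continuous_const
  have h2 : ((fun h : PSL2 => h • p) ∘ pmk) = (fun A : SL2 => A • p) := by
    funext A; exact pmk_smul A p
  rw [h2]; exact h1

lemma one_C0 : (1 : PSL2) ∈ C0 := by
  rw [← pmk_one]
  exact (mem_C0 1).2 (Or.inr (Or.inl ⟨by simp, by simp⟩))

section
variable {r : ℕ} {j ρ : FG r →* PSL2} (S : CS r j ρ)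

/-- Open half-space bounded by the plane `a`, on the side of sign `s`. -/
def CS.H (a : S.I) (s : ℝ) : Set PSL2 := HH (S.M a) (S.F a) s

lemma CS.conj_cont (a : S.I) : Continuous (fun h : PSL2 => (S.F a)⁻¹ * h * S.M a) :=
  (continuous_const.mul continuous_id).mul continuous_const

lemma CS.H_open (a : S.I) (s : ℝ) : IsOpen (S.H a s) := (Hs_open s).preimage (S.conj_cont a)

lemma CS.H_congr (a : S.I) {s s' : ℝ} (h : 0 < s * s') : S.H a s = S.H a s' := by
  unfold CS.H HH; rw [Hs_congr h]

lemma CS.H_cover (a : S.I) {s : ℝ} (hs : s ≠ 0) (h : PSL2) :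
    h ∈ S.P a ∨ h ∈ S.H a s ∨ h ∈ S.H a (-s) := Hs_cover hs _

lemma CS.H_disj {a : S.I} {s : ℝ} {h : PSL2} (h1 : h ∈ S.H a s) (h2 : h ∈ S.H a (-s)) : False :=
  Hs_disj (s := s) h1 h2

lemma CS.H_P_disj {a : S.I} {s : ℝ} {h : PSL2} (h1 : h ∈ S.H a s) (h2 : h ∈ S.P a) : False :=
  Hs_C0_disj (s := s) h1 h2

lemma CS.mem_H {a : S.I} {h : PSL2} {p : ℍ} {κ : ℝ} (hp : S.σ a p ≠ 0) (hκ : 0 < κ)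
    (hd : ∀ t, dist (h • p) (S.F a • vert t) ≤ dist p (S.M a • vert t) - κ) :
    h ∈ S.H a (S.σ a p) := by
  refine ⟨(S.M a)⁻¹ • p, mul_self_pos.2 hp, dist_lens hκ fun t => ?_⟩
  rw [pdist_inv, smul_smul, mul_assoc, mul_assoc, mul_inv_cancel, mul_one, mul_smul, pdist_inv]
  exact hd t

lemma CS.of_mem_H {a : S.I} {h : PSL2} {s : ℝ} (hh : h ∈ S.H a s) :
    ∃ p κ, 0 < s * S.σ a p ∧ 0 < κ ∧
      ∀ t, dist (h • p) (S.F a • vert t) ≤ dist p (S.M a • vert t) - κ := by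
  obtain ⟨z, hz, hl⟩ := hh
  obtain ⟨κ, hκ, hd⟩ := lens_dist hl
  refine ⟨S.M a • z, κ, ?_, hκ, fun t => ?_⟩
  · rw [CS.σ, inv_smul_smul]; exact hz
  · have := hd t
    rw [mul_smul, mul_smul, pdist_inv] at this
    rwa [dist_smul]

lemma CS.P_preconn (a : S.I) : IsPreconnected (S.P a) := by
  have h1 : Continuous (fun k : PSL2 => S.F a * k * (S.M a)⁻¹) :=
    (continuous_const.mul continuous_id).mul continuous_const
  have h2 : S.P a = (fun k : PSL2 => S.F a * k * (S.M a)⁻¹) '' C0 := by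
    ext h
    constructor
    · intro hh
      exact ⟨(S.F a)⁻¹ * h * S.M a, hh, by group⟩
    · rintro ⟨k, hk, rfl⟩
      change (S.F a)⁻¹ * (S.F a * k * (S.M a)⁻¹) * S.M a ∈ C0
      have : (S.F a)⁻¹ * (S.F a * k * (S.M a)⁻¹) * S.M a = k := by group
      rwa [this]
  rw [h2]
  exact C0_preconn.image _ h1.continuousOn

/-- The center of a plane. -/
def CS.g (a : S.I) : PSL2 := S.F a * (S.M a)⁻¹

lemma CS.g_mem (a : S.I) : S.g a ∈ S.P a := by
  change (S.F a)⁻¹ * (S.F a * (S.M a)⁻¹) * S.M a ∈ C0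
  have : (S.F a)⁻¹ * (S.F a * (S.M a)⁻¹) * S.M a = 1 := by group
  rw [this]; exact one_C0

lemma CS.P_disj {a b : S.I} (h : a ≠ b) : Disjoint (S.P a) (S.P b) := S.disj a b h

lemma CS.HS1 {a b : S.I} (hab : a ≠ b) : S.P a ⊆ S.H b (S.sd b a) := by
  refine (S.P_preconn a).subset_left_of_subset_union (S.H_open b _) (S.H_open b (-(S.sd b a)))
    ?_ ?_ ?_
  · rw [Set.disjoint_left]
    intro h h1 h2
    exact S.H_disj h1 h2
  · intro h hh
    rcases S.H_cover b (S.sd_ne hab.symm) h with h1 | h1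
    · exact absurd h1 (Set.disjoint_left.1 (S.P_disj hab) hh)
    · exact h1
  · refine ⟨S.g a, S.g_mem a, ?_⟩
    obtain ⟨κ, hκ, hd⟩ := S.contr hab.symm
    refine S.mem_H (S.sd_ne hab.symm) hκ fun t => ?_
    rw [smul_smul, CS.g, inv_mul_cancel_right]
    exact hd t 0

lemma CS.HS2 {a b : S.I} (hab : a ≠ b) : S.H a (-(S.sd a b)) ⊆ S.H b (S.sd b a) := by
  intro h hh
  obtain ⟨p, κ, hs, hκ, hd⟩ := S.of_mem_H hh
  have hneg : S.σ a p * S.sd a b < 0 := by linarith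
  have hpos := S.geomsep hab hneg
  have hne : S.σ b p ≠ 0 := by
    intro h0; rw [h0, zero_mul] at hpos; exact lt_irrefl _ hpos
  rw [S.H_congr b (show 0 < S.sd b a * S.σ b p by linarith)]
  refine S.mem_H hne hκ fun t => ?_
  have h2 := S.sd_pos hab t
  have hle : S.σ a p * S.σ a (S.M b • vert t) ≤ 0 := by
    have := mul_neg_of_neg_of_pos hneg h2
    have hq : 0 < S.sd a b ^ 2 := by have := S.sd_ne hab; positivity
    by_contra hc
    push Not at hc
    nlinarith
  obtain ⟨s, hs1, -⟩ := S.cross a hle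
  have h3 := hd s
  have h4 := S.lip b a t s
  have h5 := dist_triangle (h • p) (S.F a • vert s) (S.F b • vert t)
  linarith

lemma CS.near_fin (p : ℍ) (hp : S.gen p) (y0 : ℍ) (C : ℝ) :
    {a | ¬ ∀ h : PSL2, dist (h • p) y0 ≤ C → h ∈ S.H a (S.σ a p)}.Finite := by
  refine (S.PPfin p y0 (C + 1)).subset ?_
  intro a ha
  by_contra hc
  apply ha
  intro h hh
  refine S.mem_H (hp a) one_pos fun t => ?_
  have h1 : ¬ dist p (S.M a • vert t) ≤ dist y0 (S.F a • vert t) + (C + 1) := fun h => hc ⟨t, h⟩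
  have h2 := dist_triangle (h • p) y0 (S.F a • vert t)
  linarith

lemma CS.inter_open (p : ℍ) (hp : S.gen p) (T : Set S.I) :
    IsOpen {h | ∀ a ∈ T, h ∈ S.H a (S.σ a p)} := by
  rw [isOpen_iff_mem_nhds]
  intro h0 hh0
  have hfin := S.near_fin p hp (h0 • p) 1
  have h1 : ∀ᶠ h in 𝓝 h0, dist (h • p) (h0 • p) < 1 := by
    have hc : Continuous (fun h : PSL2 => dist (h • p) (h0 • p)) :=
      (smul_cont_left p).dist continuous_const
    exact hc.continuousAt.eventually_lt continuousAt_const (by simp)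
  have h2 : ∀ᶠ h in 𝓝 h0, ∀ a ∈ {a | ¬ ∀ h : PSL2, dist (h • p) (h0 • p) ≤ 1 → h ∈ S.H a (S.σ a p)},
      a ∈ T → h ∈ S.H a (S.σ a p) := by
    rw [hfin.eventually_all]
    intro a _
    by_cases haT : a ∈ T
    · filter_upwards [(S.H_open a (S.σ a p)).mem_nhds (hh0 a haT)] with h hh _ using hh
    · exact Eventually.of_forall fun h h' => absurd h' haT
  filter_upwards [h1, h2] with h h3 h4 a haT
  by_cases hb : ∀ h : PSL2, dist (h • p) (h0 • p) ≤ 1 → h ∈ S.H a (S.σ a p)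
  · exact hb h h3.le
  · exact h4 a hb haT

/-- The lines adjacent to `p`. -/
def CS.bd (p : ℍ) (a : S.I) : Prop := ∀ b, b ≠ a → 0 < S.σ b p * S.sd b a

lemma nearest (z : ℍ) : ∃ t0, ∀ t, dist z (vert t0) ≤ dist z (vert t) := by
  have hn := nsq_pos z
  refine ⟨Real.log (nsq z) / 2, fun t => ?_⟩
  set u := Real.exp (Real.log (nsq z) / 2) with hu
  have hu0 : 0 < u := Real.exp_pos _
  have hun : u * u = nsq z := by
    rw [hu, ← Real.exp_add, add_halves, Real.exp_log hn]
  have hle : Real.cosh (dist z (vert (Real.log (nsq z) / 2))) ≤ Real.cosh (dist z (vert t)) := by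
    rw [cosh_dist_vert, cosh_dist_vert]
    have him := z.im_pos
    have h1 : Real.exp (-(Real.log (nsq z) / 2)) * nsq z + u = 2 * u := by
      rw [Real.exp_neg, ← hu, ← hun]; field_simp; norm_num
    rw [← hu, h1, ← hun, Real.exp_neg]
    have hv := Real.exp_pos t
    set v := Real.exp t
    have h2 : 2 * u ≤ v⁻¹ * (u * u) + v := by
      have : v⁻¹ * (u * u) + v - 2 * u = v⁻¹ * (u - v) ^ 2 := by field_simp; ring
      have : 0 ≤ v⁻¹ * (u - v) ^ 2 := by positivity
      linarith
    gcongr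
  rw [Real.cosh_le_cosh, abs_of_nonneg dist_nonneg, abs_of_nonneg dist_nonneg] at hle
  exact hle

lemma CS.nd_exists (p : ℍ) : ∃ nd : S.I → ℝ,
    (∀ a, ∃ t, nd a = dist p (S.M a • vert t)) ∧
    ∀ a b, b ≠ a → ¬ 0 < S.σ b p * S.sd b a → nd b < nd a := by
  choose t ht using fun a : S.I => nearest ((S.M a)⁻¹ • p)
  have ht' : ∀ a s, dist p (S.M a • vert (t a)) ≤ dist p (S.M a • vert s) := by
    intro a s
    have := ht a s
    rwa [pdist_inv, pdist_inv] at this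
  refine ⟨fun a => dist p (S.M a • vert (t a)), fun a => ⟨t a, rfl⟩, ?_⟩
  intro a b hab hneg
  push Not at hneg
  have h2 := S.sd_pos hab (t a)
  have hle : S.σ b p * S.σ b (S.M a • vert (t a)) ≤ 0 := by
    by_contra hc
    push Not at hc
    have := mul_pos h2 hc
    have h3 : 0 < S.σ b (S.M a • vert (t a)) ^ 2 := by have := S.σ_ne hab (t a); positivity
    nlinarith
  obtain ⟨s, hs, -⟩ := S.cross b hle
  have h3 : 0 < dist (S.M b • vert s) (S.M a • vert (t a)) :=
    dist_pos.2 fun h => S.line_ne hab s (t a) h.symm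
  have h4 := ht' b s
  simp only
  linarith

lemma CS.exists_bd (p : ℍ) {T : Set S.I} (hT : T.Finite) (hne : T.Nonempty)
    (hcl : ∀ a ∈ T, ∀ b, b ≠ a → ¬ 0 < S.σ b p * S.sd b a → b ∈ T) : ∃ a ∈ T, S.bd p a := by
  obtain ⟨nd, -, hnd⟩ := S.nd_exists p
  obtain ⟨a, haT, ha⟩ := Set.exists_min_image T nd hT hne
  refine ⟨a, haT, fun b hb => ?_⟩
  by_contra hc
  have h1 := hnd a b hb hc
  have h2 := ha b (hcl a haT b hb hc)
  linarith

lemma CS.bd_exists (p : ℍ) (a0 : S.I) : ∃ a, S.bd p a := by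
  obtain ⟨nd, hnd1, hnd⟩ := S.nd_exists p
  have hf : {a | nd a ≤ nd a0}.Finite := by
    refine (S.local_fin p (nd a0)).subset ?_
    intro a ha
    obtain ⟨t, ht⟩ := hnd1 a
    exact ⟨t, ht ▸ ha⟩
  obtain ⟨a, -, ha⟩ := S.exists_bd p hf ⟨a0, le_refl (nd a0)⟩
    (fun a ha b hb hc => (hnd a b hb hc).le.trans ha)
  exact ⟨a, ha⟩

/-- The region of `PSL2` corresponding to the region of `p` in the plane. -/
def CS.X (p : ℍ) : Set PSL2 := {h | ∀ a, h ∈ S.H a (S.σ a p)}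

/-- The closed far side of `a` as seen from `p`. -/
def CS.Fr (p : ℍ) (a : S.I) : Set PSL2 := S.P a ∪ S.H a (-(S.σ a p))

lemma CS.X_open (p : ℍ) (hp : S.gen p) : IsOpen (S.X p) := by
  have := S.inter_open p hp Set.univ
  simpa [CS.X] using this

lemma CS.not_near {p : ℍ} (hp : S.gen p) {a : S.I} {h : PSL2} :
    h ∉ S.H a (S.σ a p) ↔ h ∈ S.Fr p a := by
  constructor
  · intro hh
    rcases S.H_cover a (hp a) h with h1 | h1 | h1
    · exact Or.inl h1
    · exact absurd h1 hh
    · exact Or.inr h1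
  · rintro (h1 | h1) h2
    · exact S.H_P_disj h2 h1
    · exact S.H_disj h2 h1

lemma CS.neg_congr {a : S.I} {s s' : ℝ} (h : 0 < s * s') : S.H a (-s) = S.H a (-s') :=
  S.H_congr a (by linarith)

lemma CS.exists_far (p : ℍ) (hp : S.gen p) {h : PSL2} (hh : h ∉ S.X p) :
    ∃ a, S.bd p a ∧ h ∈ S.Fr p a := by
  have hne : {a | h ∉ S.H a (S.σ a p)}.Nonempty := by
    by_contra hc
    rw [Set.not_nonempty_iff_eq_empty] at hc
    apply hh
    intro a
    by_contra hc'
    have : a ∈ {a | h ∉ S.H a (S.σ a p)} := hc'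
    rw [hc] at this
    exact this
  have hf : {a | h ∉ S.H a (S.σ a p)}.Finite := by
    refine (S.near_fin p hp (h • p) 0).subset ?_
    intro a ha hc
    exact ha (hc h (by simp))
  have hcl : ∀ a ∈ {a | h ∉ S.H a (S.σ a p)}, ∀ b, b ≠ a → ¬ 0 < S.σ b p * S.sd b a →
      b ∈ {a | h ∉ S.H a (S.σ a p)} := by
    intro a ha b hb hc
    have hfar := (S.not_near hp).1 ha
    have hlt : S.σ b p * S.sd b a < 0 :=
      lt_of_le_of_ne (not_lt.1 hc) (mul_ne_zero (hp b) (S.sd_ne hb))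
    have hpos := S.geomsep hb hlt
    have hin : h ∈ S.H b (S.sd b a) := by
      rcases hfar with h1 | h1
      · exact S.HS1 hb.symm h1
      · rw [S.neg_congr hpos] at h1
        exact S.HS2 hb.symm h1
    refine (S.not_near hp).2 (Or.inr ?_)
    rwa [S.H_congr b (show 0 < -(S.σ b p) * S.sd b a by linarith)]
  obtain ⟨a, haT, ha⟩ := S.exists_bd p hf hne hcl
  exact ⟨a, ha, (S.not_near hp).1 haT⟩

lemma CS.far_disj {p : ℍ} (hp : S.gen p) {a b : S.I} (hab : a ≠ b) (ha : S.bd p a) (hb : S.bd p b)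
    {h : PSL2} (h1 : h ∈ S.Fr p a) (h2 : h ∈ S.Fr p b) : False := by
  have hin : h ∈ S.H b (S.sd b a) := by
    rcases h1 with h1 | h1
    · exact S.HS1 hab h1
    · rw [S.neg_congr (hb a hab)] at h1
      exact S.HS2 hab h1
  rw [← S.H_congr b (ha b hab.symm)] at hin
  exact (S.not_near hp).2 h2 hin

/-- The points on the near side of all planes other than `a`. -/
def CS.O (p : ℍ) (a : S.I) : Set PSL2 := {h | ∀ b ∈ {b | b ≠ a}, h ∈ S.H b (S.σ b p)}

lemma CS.P_sub_O {p : ℍ} {a : S.I} (ha : S.bd p a) : S.P a ⊆ S.O p a := by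
  intro h hh b hb
  rw [S.H_congr b (ha b hb)]
  exact S.HS1 (Ne.symm hb) hh

lemma CS.mem_X {p : ℍ} {a : S.I} {h : PSL2} (h1 : h ∈ S.O p a) (h2 : h ∈ S.H a (S.σ a p)) :
    h ∈ S.X p := by
  intro b
  by_cases hb : b = a
  · rw [hb]; exact h2
  · exact h1 b hb

end


/-! ### Regions are connected -/

section
variable {r : ℕ} {j ρ : FG r →* PSL2} (S : CS r j ρ)

/-- Push `h` towards `p` transversally to the line `a`. -/
def CS.fl (p : ℍ) (a : S.I) (h : PSL2) (u : ℝ) : PSL2 :=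
  h * (S.M a * pmk (bt (-(S.σ a p * u))) * (S.M a)⁻¹)

lemma CS.fl_cont (p : ℍ) (a : S.I) : Continuous (fun x : PSL2 × ℝ => S.fl p a x.1 x.2) := by
  have h1 : Continuous (fun u : ℝ => pmk (bt (-(S.σ a p * u)))) :=
    pmk_cont.comp (bt_cont.comp (continuous_const.mul continuous_id).neg)
  exact continuous_fst.mul ((continuous_const.mul (h1.comp continuous_snd)).mul continuous_const)

lemma CS.fl_zero (p : ℍ) (a : S.I) (h : PSL2) : S.fl p a h 0 = h := by
  simp [CS.fl, bt_zero]

lemma CS.fl_mem {p : ℍ} (hp : S.gen p) {a : S.I} {h : PSL2} {u : ℝ} (hu : 0 < u)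
    (hh : h ∈ S.H a (S.σ a p) ∨ h ∈ S.P a) : S.fl p a h u ∈ S.H a (S.σ a p) := by
  have h0 : 0 < S.σ a p * (S.σ a p * u) := by
    rw [← mul_assoc]; exact mul_pos (mul_self_pos.2 (hp a)) hu
  have h1 := push h0 (k := (S.F a)⁻¹ * h * S.M a) hh
  change (S.F a)⁻¹ * (h * (S.M a * pmk (bt (-(S.σ a p * u))) * (S.M a)⁻¹)) * S.M a ∈ Hs _
  convert h1 using 1
  group

attribute [irreducible] CS.fl

lemma CS.O_open {p : ℍ} (hp : S.gen p) (a : S.I) : IsOpen (S.O p a) := S.inter_open p hp _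

lemma flow_aux {φ : PSL2 × ℝ → PSL2} (hφ : Continuous φ) {O : Set PSL2} (hO : IsOpen O) {h : PSL2}
    (hh : φ (h, 0) ∈ O) :
    ∃ u0 > 0, ∀ᶠ h' in 𝓝 h, ∀ u : ℝ, 0 ≤ u → u ≤ u0 → φ (h', u) ∈ O := by
  have h1 : φ ⁻¹' O ∈ 𝓝 (h, (0 : ℝ)) := (hO.preimage hφ).mem_nhds hh
  rw [mem_nhds_prod_iff] at h1
  obtain ⟨W, hW, V, hV, hsub⟩ := h1
  obtain ⟨ε, hε, hball⟩ := Metric.mem_nhds_iff.1 hV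
  refine ⟨ε / 2, by positivity, ?_⟩
  filter_upwards [hW] with h' hh' u hu0 hu
  have : u ∈ Metric.ball (0 : ℝ) ε := by
    rw [Metric.mem_ball, Real.dist_eq, sub_zero, abs_of_nonneg hu0]; linarith
  exact hsub (Set.mk_mem_prod hh' (hball this))

lemma CS.fl_O {p : ℍ} (hp : S.gen p) {a : S.I} (ha : S.bd p a) {h : PSL2} (hh : h ∈ S.P a) :
    ∃ u0 > 0, ∀ᶠ h' in 𝓝 h, ∀ u, 0 ≤ u → u ≤ u0 → S.fl p a h' u ∈ S.O p a := by
  have h0 : S.fl p a h 0 ∈ S.O p a := by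
    rw [S.fl_zero]
    exact S.P_sub_O ha hh
  exact flow_aux (φ := fun x : PSL2 × ℝ => S.fl p a x.1 x.2) (S.fl_cont p a) (S.O_open hp a) h0

lemma CS.fl_freq {p : ℍ} (hp : S.gen p) {a : S.I} (ha : S.bd p a) {h : PSL2} (hh : h ∈ S.P a) :
    ∃ᶠ h' in 𝓝 h, h' ∈ S.X p := by
  obtain ⟨u0, hu0, hev⟩ := S.fl_O hp ha hh
  have hev' := hev.self_of_nhds
  have hc : Continuous (fun u : ℝ => S.fl p a h u) :=
    (S.fl_cont p a).comp (continuous_const.prodMk continuous_id)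
  have ht : Tendsto (fun u : ℝ => S.fl p a h u) (𝓝[>] 0) (𝓝 h) := by
    have := hc.tendsto 0
    rw [S.fl_zero] at this
    exact this.mono_left nhdsWithin_le_nhds
  refine ht.frequently (Eventually.frequently ?_)
  filter_upwards [Ioc_mem_nhdsGT hu0] with u hu
  exact S.mem_X (hev' u hu.1.le hu.2) (S.fl_mem hp hu.1 (Or.inr hh))

lemma CS.X_nonempty {p : ℍ} (hp : S.gen p) : (S.X p).Nonempty := by
  by_cases hI : Nonempty S.I
  · obtain ⟨a0⟩ := hI
    obtain ⟨a, ha⟩ := S.bd_exists p a0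
    obtain ⟨h, hh⟩ := (S.fl_freq hp ha (S.g_mem a)).exists
    exact ⟨h, hh⟩
  · exact ⟨1, fun a => absurd ⟨a⟩ hI⟩

lemma CS.side_aux {p : ℍ} (hp : S.gen p) {a : S.I} (ha : S.bd p a) {h : PSL2} (hh : h ∈ S.P a)
    {A B : Set PSL2} (hA : IsOpen A) (hB : IsOpen B) (hAB : Disjoint A B) (hX : S.X p ⊆ A ∪ B) :
    (∀ᶠ h' in 𝓝 h, h' ∈ S.X p → h' ∈ A) ∨ (∀ᶠ h' in 𝓝 h, h' ∈ S.X p → h' ∈ B) := by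
  have main : ∀ {A B : Set PSL2}, IsOpen A → IsOpen B → Disjoint A B → S.X p ⊆ A ∪ B →
      ∀ u0 > 0, (∀ᶠ h' in 𝓝 h, ∀ u, 0 ≤ u → u ≤ u0 → S.fl p a h' u ∈ S.O p a) →
      S.fl p a h u0 ∈ A → ∀ᶠ h' in 𝓝 h, h' ∈ S.X p → h' ∈ A := by
    intro A B hA hB hAB hX u0 hu0 hev hmem
    have hc : Continuous (fun h : PSL2 => S.fl p a h u0) :=
      (S.fl_cont p a).comp (continuous_id.prodMk continuous_const)
    filter_upwards [hev, (hA.preimage hc).mem_nhds hmem] with h' h1 h2 h3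
    have hc' : Continuous (fun u : ℝ => S.fl p a h' u) :=
      (S.fl_cont p a).comp (continuous_const.prodMk continuous_id)
    have hpre : IsPreconnected ((fun u : ℝ => S.fl p a h' u) '' Set.Icc 0 u0) :=
      isPreconnected_Icc.image _ hc'.continuousOn
    have hsub : (fun u : ℝ => S.fl p a h' u) '' Set.Icc 0 u0 ⊆ S.X p := by
      rintro _ ⟨u, ⟨hu, hu'⟩, rfl⟩
      rcases hu.eq_or_lt with h0 | h0
      · subst h0; simp only [S.fl_zero]; exact h3
      · exact S.mem_X (h1 u hu hu') (S.fl_mem hp h0 (Or.inl (h3 a)))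
    have := hpre.subset_left_of_subset_union hA hB hAB (hsub.trans hX)
      ⟨_, ⟨u0, ⟨hu0.le, le_rfl⟩, rfl⟩, h2⟩
    exact this ⟨0, ⟨le_rfl, hu0.le⟩, S.fl_zero p a h'⟩
  obtain ⟨u0, hu0, hev⟩ := S.fl_O hp ha hh
  have hmem : S.fl p a h u0 ∈ S.X p :=
    S.mem_X (hev.self_of_nhds u0 hu0.le le_rfl) (S.fl_mem hp hu0 (Or.inr hh))
  rcases hX hmem with h1 | h1
  · exact Or.inl (main hA hB hAB hX u0 hu0 hev h1)
  · exact Or.inr (main hB hA hAB.symm (by rwa [Set.union_comm]) u0 hu0 hev h1)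

lemma CS.side {p : ℍ} (hp : S.gen p) {a : S.I} (ha : S.bd p a)
    {A B : Set PSL2} (hA : IsOpen A) (hB : IsOpen B) (hAB : Disjoint A B) (hX : S.X p ⊆ A ∪ B) :
    S.P a ⊆ {h | ∀ᶠ h' in 𝓝 h, h' ∈ S.X p → h' ∈ A} ∨
      S.P a ⊆ {h | ∀ᶠ h' in 𝓝 h, h' ∈ S.X p → h' ∈ B} := by
  have hop : ∀ A : Set PSL2, IsOpen {h | ∀ᶠ h' in 𝓝 h, h' ∈ S.X p → h' ∈ A} :=
    fun A => isOpen_setOfPred_eventually_nhds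
  refine isPreconnected_iff_subset_of_disjoint.1 (S.P_preconn a) _ _ (hop A) (hop B) ?_ ?_
  · intro h hh
    exact S.side_aux hp ha hh hA hB hAB hX
  · rw [Set.eq_empty_iff_forall_notMem]
    rintro h ⟨hh, h1, h2⟩
    obtain ⟨k, hk1, hk2, hk3⟩ := ((S.fl_freq hp ha hh).and_eventually (h1.and h2)).exists
    exact Set.disjoint_left.1 hAB (hk2 hk1) (hk3 hk1)

/-- Extension of a piece of `X p` across the planes. -/
def CS.ext (p : ℍ) (A : Set PSL2) : Set PSL2 :=
  (S.X p ∩ A) ∪ ⋃ a ∈ {a | S.bd p a ∧ S.P a ⊆ {h | ∀ᶠ h' in 𝓝 h, h' ∈ S.X p → h' ∈ A}}, S.Fr p a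

lemma CS.ext_open {p : ℍ} (hp : S.gen p) {A : Set PSL2} (hA : IsOpen A) : IsOpen (S.ext p A) := by
  rw [isOpen_iff_mem_nhds]
  rintro h (hh | hh)
  · exact mem_of_superset (((S.X_open p hp).inter hA).mem_nhds hh) Set.subset_union_left
  · simp only [Set.mem_iUnion] at hh
    obtain ⟨a, ⟨ha, haA⟩, hh⟩ := hh
    have hsub : S.Fr p a ⊆ S.ext p A := by
      intro k hk
      refine Or.inr ?_
      simp only [Set.mem_iUnion]
      exact ⟨a, ⟨ha, haA⟩, hk⟩
    rcases hh with hh | hh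
    · have h1 : ∀ᶠ h' in 𝓝 h, h' ∈ S.X p → h' ∈ A := haA hh
      filter_upwards [h1, (S.O_open hp a).mem_nhds (S.P_sub_O ha hh)] with k hk1 hk2
      by_cases hk : k ∈ S.H a (S.σ a p)
      · have := S.mem_X hk2 hk
        exact Or.inl ⟨this, hk1 this⟩
      · exact hsub ((S.not_near hp).1 hk)
    · exact mem_of_superset ((S.H_open a _).mem_nhds hh) (Set.subset_union_right.trans hsub)

lemma CS.X_preconn {p : ℍ} (hp : S.gen p) : IsPreconnected (S.X p) := by
  rw [isPreconnected_iff_subset_of_disjoint]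
  intro u v hu hv hX huv
  have hXo := S.X_open p hp
  set A := S.X p ∩ u with hAdef
  set B := S.X p ∩ v with hBdef
  have hA : IsOpen A := hXo.inter hu
  have hB : IsOpen B := hXo.inter hv
  have hAB : Disjoint A B := by
    rw [Set.disjoint_left]
    rintro h ⟨h1, h2⟩ ⟨_, h3⟩
    have : h ∈ S.X p ∩ (u ∩ v) := ⟨h1, h2, h3⟩
    rw [huv] at this
    exact this
  have hX' : S.X p ⊆ A ∪ B := fun h hh => (hX hh).imp (fun h1 => ⟨hh, h1⟩) (fun h1 => ⟨hh, h1⟩)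
  have hdis : Disjoint (S.ext p A) (S.ext p B) := by
    rw [Set.disjoint_left]
    have hfx : ∀ {h : PSL2} {a : S.I}, h ∈ S.X p → h ∈ S.Fr p a → False :=
      fun h1 h2 => (S.not_near hp).2 h2 (h1 _)
    rintro h (h1 | h1) (h2 | h2)
    · exact Set.disjoint_left.1 hAB h1.2 h2.2
    · simp only [Set.mem_iUnion] at h2
      obtain ⟨a, -, h2⟩ := h2
      exact hfx h1.1 h2
    · simp only [Set.mem_iUnion] at h1
      obtain ⟨a, -, h1⟩ := h1
      exact hfx h2.1 h1
    · simp only [Set.mem_iUnion] at h1 h2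
      obtain ⟨a, ⟨ha, haA⟩, h1⟩ := h1
      obtain ⟨b, ⟨hb, hbB⟩, h2⟩ := h2
      by_cases hab : a = b
      · subst hab
        have e1 : ∀ᶠ h' in 𝓝 (S.g a), h' ∈ S.X p → h' ∈ A := haA (S.g_mem a)
        have e2 : ∀ᶠ h' in 𝓝 (S.g a), h' ∈ S.X p → h' ∈ B := hbB (S.g_mem a)
        obtain ⟨k, hk1, hk2, hk3⟩ :=
          ((S.fl_freq hp ha (S.g_mem a)).and_eventually (e1.and e2)).exists
        exact Set.disjoint_left.1 hAB (hk2 hk1) (hk3 hk1)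
      · exact S.far_disj hp hab ha hb h1 h2
  have hcov : Set.univ ⊆ S.ext p A ∪ S.ext p B := by
    intro h _
    by_cases hh : h ∈ S.X p
    · exact (hX' hh).imp (fun h1 => Or.inl ⟨hh, h1⟩) (fun h1 => Or.inl ⟨hh, h1⟩)
    · obtain ⟨a, ha, hfar⟩ := S.exists_far p hp hh
      rcases S.side hp ha hA hB hAB hX' with h1 | h1
      · left; right
        simp only [Set.mem_iUnion]
        exact ⟨a, ⟨ha, h1⟩, hfar⟩
      · right; right
        simp only [Set.mem_iUnion]
        exact ⟨a, ⟨ha, h1⟩, hfar⟩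
  have hfin : ∀ C : Set PSL2, Set.univ ⊆ S.ext p C → S.X p ⊆ C := by
    intro C hC h hh
    rcases hC (Set.mem_univ h) with h1 | h1
    · exact h1.2
    · simp only [Set.mem_iUnion] at h1
      obtain ⟨a, -, h1⟩ := h1
      exact absurd (hh a) ((S.not_near hp).2 h1)
  have hpre : IsPreconnected (Set.univ : Set PSL2) := psl2_preconn.isPreconnected_univ
  rcases isPreconnected_iff_subset_of_disjoint.1 hpre _ _ (S.ext_open hp hA) (S.ext_open hp hB) hcov
    (by rw [hdis.inter_eq, Set.inter_empty]) with h1 | h1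
  · left; exact (hfin A h1).trans Set.inter_subset_right
  · right; exact (hfin B h1).trans Set.inter_subset_right

lemma CS.H_act (γ : FG r) (a : S.I) (s : ℝ) (h : PSL2) :
    ρ γ * h * (j γ)⁻¹ ∈ S.H (S.act γ a) s ↔ h ∈ S.H a s := by
  have : (S.F (S.act γ a))⁻¹ * (ρ γ * h * (j γ)⁻¹) * S.M (S.act γ a) = (S.F a)⁻¹ * h * S.M a := by
    rw [S.F_act, S.M_act]; group
  change (S.F (S.act γ a))⁻¹ * (ρ γ * h * (j γ)⁻¹) * S.M (S.act γ a) ∈ Hs s ↔ _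
  rw [this]; rfl

lemma CS.X_act (γ : FG r) (p : ℍ) (h : PSL2) :
    ρ γ * h * (j γ)⁻¹ ∈ S.X (j γ • p) ↔ h ∈ S.X p := by
  constructor
  · intro hh a
    have := hh (S.act γ a)
    rwa [S.σ_act, S.H_act] at this
  · intro hh a
    rw [← S.act_inv γ a, S.σ_act, S.H_act]
    exact hh _

end


/-! ### Conclusion -/

section
variable {r : ℕ} {j ρ : FG r →* PSL2} (S : CS r j ρ)

lemma CS.P_sub_compl {p : ℍ} : S.X p ⊆ (⋃ a : S.I, S.P a)ᶜ := by
  intro h hh hc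
  obtain ⟨a, ha⟩ := Set.mem_iUnion.1 hc
  exact S.H_P_disj (hh a) ha

lemma CS.comp_sub {x : PSL2} {p : ℍ} (hp : S.gen p) {k : PSL2}
    (hk : k ∈ connectedComponentIn (⋃ a : S.I, S.P a)ᶜ x) (hkp : k ∈ S.X p) :
    connectedComponentIn (⋃ a : S.I, S.P a)ᶜ x ⊆ S.X p := by
  intro y hy a
  have hsub := connectedComponentIn_subset (⋃ a : S.I, S.P a)ᶜ x
  refine (isPreconnected_connectedComponentIn.subset_left_of_subset_union (S.H_open a (S.σ a p))
    (S.H_open a (-(S.σ a p))) ?_ ?_ ⟨k, hk, hkp a⟩) hy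
  · rw [Set.disjoint_left]
    intro h h1 h2
    exact S.H_disj h1 h2
  · intro h hh
    refine (S.H_cover a (hp a) h).resolve_left fun hP => ?_
    exact hsub hh (Set.mem_iUnion.2 ⟨a, hP⟩)

lemma CS.exists_transl {x : PSL2} (hx : x ∈ (⋃ a : S.I, S.P a)ᶜ)
    (hR : IsFundDom j ρ (closure (connectedComponentIn (⋃ a : S.I, S.P a)ᶜ x)))
    {p : ℍ} (hp : S.gen p) : ∃ γ, x ∈ S.X (j γ • p) := by
  obtain ⟨y, hy⟩ := S.X_nonempty hp
  have hy' : y ∈ ⋃ γ : FG r, actImg j ρ γ (closure (connectedComponentIn (⋃ a : S.I, S.P a)ᶜ x)) := by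
    rw [hR.2.1]; exact Set.mem_univ y
  obtain ⟨γ, z, hz, rfl⟩ := Set.mem_iUnion.1 hy'
  refine ⟨γ⁻¹, ?_⟩
  have hp' := S.gen_act γ⁻¹ hp
  have hz' : z ∈ S.X (j γ⁻¹ • p) := by
    rw [← S.X_act γ, smul_smul, ← map_mul, mul_inv_cancel, map_one, one_smul]
    exact hy
  obtain ⟨k, hk1, hk2⟩ := mem_closure_iff.1 hz _ (S.X_open _ hp') hz'
  exact S.comp_sub hp' hk2 hk1 (mem_connectedComponentIn hx)

lemma CS.same_side {x : PSL2} {p q : ℍ} (hp : S.gen p) (hq : S.gen q) (h1 : x ∈ S.X p)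
    (h2 : x ∈ S.X q) (a : S.I) : 0 < S.σ a p * S.σ a q := by
  by_contra hc
  have hlt : S.σ a p * S.σ a q < 0 := lt_of_le_of_ne (not_lt.1 hc) (mul_ne_zero (hp a) (hq a))
  have h3 := h2 a
  rw [S.H_congr a (show 0 < S.σ a q * -(S.σ a p) by linarith)] at h3
  exact S.H_disj (h1 a) h3

lemma CS.X_congr {p q : ℍ} (h : ∀ a, 0 < S.σ a p * S.σ a q) : S.X p = S.X q := by
  ext k
  simp only [CS.X, Set.mem_ofPred_eq]
  exact forall_congr' fun a => by rw [S.H_congr a (h a)]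

lemma CS.img_comp (γ : FG r) {p : ℍ} (hp : S.gen p) :
    pslImg (j γ) (connectedComponentIn S.Uᶜ p) = connectedComponentIn S.Uᶜ (j γ • p) := by
  rw [S.comp_eq hp, S.comp_eq (S.gen_act γ hp)]
  ext q
  constructor
  · rintro ⟨y, hy, rfl⟩ a
    rw [pslSMul_eq, ← S.act_inv γ a, S.σ_act, S.σ_act]
    exact hy _
  · intro hq
    refine ⟨(j γ)⁻¹ • q, fun a => ?_, by rw [pslSMul_eq, smul_inv_smul]⟩
    have := hq (S.act γ a)
    rw [S.σ_act] at this
    rwa [← S.σ_act γ a ((j γ)⁻¹ • q), smul_inv_smul]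

lemma CS.comp_iff {p q : ℍ} (hp : S.gen p) (hq : S.gen q) :
    connectedComponentIn S.Uᶜ p = connectedComponentIn S.Uᶜ q ↔ ∀ a, 0 < S.σ a p * S.σ a q := by
  constructor
  · intro h
    have h1 : q ∈ connectedComponentIn S.Uᶜ p := by
      rw [h]; exact mem_connectedComponentIn ((S.gen_iff q).2 hq)
    rw [S.comp_eq hp] at h1
    exact h1
  · intro h
    apply connectedComponentIn_eq
    rw [S.comp_eq hp]
    exact h

lemma CS.uniq {x : PSL2} (hx : x ∈ (⋃ a : S.I, S.P a)ᶜ)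
    (hR : IsFundDom j ρ (closure (connectedComponentIn (⋃ a : S.I, S.P a)ᶜ x)))
    {p : ℍ} (hp : S.gen p) (hxp : x ∈ S.X p) {δ : FG r}
    (h : ∀ a, 0 < S.σ a (j δ • p) * S.σ a p) : δ = 1 := by
  set R := closure (connectedComponentIn (⋃ a : S.I, S.P a)ᶜ x) with hRdef
  have hX : S.X (j δ • p) = S.X p := S.X_congr h
  have hsub : S.X p ⊆ R :=
    ((S.X_preconn hp).subset_connectedComponentIn hxp S.P_sub_compl).trans subset_closure
  have hsub2 : S.X p ⊆ actImg j ρ δ R := by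
    intro k hk
    refine ⟨(ρ δ)⁻¹ * k * j δ, hsub ?_, by group⟩
    rw [← S.X_act δ, hX]
    convert hk using 1
    group
  by_contra hne
  have hd : Disjoint (interior (actImg j ρ δ R)) (interior (actImg j ρ 1 R)) := hR.2.2 hne
  rw [actImg_one] at hd
  exact Set.disjoint_left.1 hd (interior_maximal hsub2 (S.X_open p hp) hxp)
    (interior_maximal hsub (S.X_open p hp) hxp)

lemma CS.trans_free {x : PSL2} (hx : x ∈ (⋃ a : S.I, S.P a)ᶜ)
    (hR : IsFundDom j ρ (closure (connectedComponentIn (⋃ a : S.I, S.P a)ᶜ x)))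
    (U V : Set ℍ) (hU : IsCC S.Uᶜ U) (hV : IsCC S.Uᶜ V) : ∃! γ : FG r, pslImg (j γ) U = V := by
  obtain ⟨p, hp, rfl⟩ := hU
  obtain ⟨q, hq, rfl⟩ := hV
  rw [S.gen_iff] at hp hq
  obtain ⟨γ₁, h1⟩ := S.exists_transl hx hR hp
  obtain ⟨γ₂, h2⟩ := S.exists_transl hx hR hq
  have hp1 := S.gen_act γ₁ hp
  have hq2 := S.gen_act γ₂ hq
  have hss := S.same_side hp1 hq2 h1 h2
  refine ⟨γ₂⁻¹ * γ₁, ?_, ?_⟩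
  · change pslImg (j (γ₂⁻¹ * γ₁)) _ = _
    rw [S.img_comp _ hp, S.comp_iff (S.gen_act _ hp) hq]
    intro a
    have := hss (S.act γ₂ a)
    rw [S.σ_act] at this
    rw [← S.σ_act γ₂ a (j (γ₂⁻¹ * γ₁) • p), smul_smul, ← map_mul, mul_inv_cancel_left]
    exact this
  · intro γ hγ
    change pslImg (j γ) _ = _ at hγ
    rw [S.img_comp _ hp, S.comp_iff (S.gen_act _ hp) hq] at hγ
    have hδ : γ₂ * γ * γ₁⁻¹ = 1 := by
      refine S.uniq hx hR hp1 h1 fun a => ?_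
      have e1 : j (γ₂ * γ * γ₁⁻¹) • j γ₁ • p = j γ₂ • j γ • p := by
        rw [smul_smul, smul_smul, ← map_mul, ← map_mul, inv_mul_cancel_right]
      rw [e1]
      have e2 := hγ (S.act γ₂⁻¹ a)
      rw [← S.σ_act γ₂, ← S.σ_act γ₂ _ q, S.act_inv] at e2
      have e3 := hss a
      have e4 := mul_pos e2 e3
      have e5 : 0 < S.σ a (j γ₂ • q) ^ 2 := by have := hq2 a; positivity
      by_contra hc
      push Not at hc
      nlinarith
    rw [mul_inv_eq_one] at hδ
    rw [← hδ, inv_mul_cancel_left]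

lemma CS.img_line (γ : FG r) (a : S.I) :
    pslImg (j γ) (lineOf (S.M a)) = lineOf (S.M (S.act γ a)) := by
  rw [S.M_act]
  ext q
  constructor
  · rintro ⟨_, ⟨t, rfl⟩, rfl⟩
    exact ⟨t, by simp only [pslSMul_eq, smul_smul]⟩
  · rintro ⟨t, rfl⟩
    exact ⟨S.M a • vert t, ⟨t, rfl⟩, by simp only [pslSMul_eq, smul_smul]⟩

end


theorem stmt9 (r : ℕ) (j ρ : FreeGroup (Fin r) →* PSL2)
    (hpd : ProperlyDisc j ρ) (hfd : AdmitsRightCrookedFD j ρ) :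
    ∃ 𝒜 : Set (Set ℍ),
      (∀ α ∈ 𝒜, IsGeodesicLine α) ∧
      (∀ (γ : FreeGroup (Fin r)), ∀ α ∈ 𝒜, pslImg (j γ) α ∈ 𝒜) ∧
      (∀ α ∈ 𝒜, ∀ α' ∈ 𝒜, α ≠ α' →
        α ∩ α' = ∅ ∧ ∀ ξ : OnePoint ℝ, IsEndpoint α ξ → ¬ IsEndpoint α' ξ) ∧
      (∀ K : Set ℍ, IsCompact K → {α ∈ 𝒜 | (α ∩ K).Nonempty}.Finite) ∧
      (∀ U V : Set ℍ, IsCC (⋃ α ∈ 𝒜, α)ᶜ U → IsCC (⋃ α ∈ 𝒜, α)ᶜ V →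
        ∃! γ : FreeGroup (Fin r), pslImg (j γ) U = V) ∧
      ∃ g : Set ℍ → PSL2,
        (∀ (γ : FreeGroup (Fin r)), ∀ α ∈ 𝒜,
          g (pslImg (j γ) α) = ρ γ * g α * (j γ)⁻¹) ∧
        ∃ K > 0, ∀ α ∈ 𝒜, ∀ α' ∈ 𝒜, α ≠ α' → ∀ x ∈ α, ∀ x' ∈ α',
          dist (pslSMul (g α) x) (pslSMul (g α') x') ≤ dist x x' - K := by
  obtain ⟨n, D, hD, hdis, x, hx, hR⟩ := hfd
  obtain ⟨S, hS⟩ := CS_exists hpd D hD hdis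
  rw [hS] at hx hR
  classical
  have hU : (⋃ α ∈ Set.range (fun a : S.I => lineOf (S.M a)), α) = S.U := by
    rw [Set.biUnion_range]; rfl
  refine ⟨Set.range (fun a : S.I => lineOf (S.M a)), ?_, ?_, ?_, ?_, ?_, ?_⟩
  · rintro _ ⟨a, rfl⟩
    exact lineOf_geod _
  · rintro γ _ ⟨a, rfl⟩
    exact ⟨S.act γ a, (S.img_line γ a).symm⟩
  · rintro _ ⟨a, rfl⟩ _ ⟨b, rfl⟩ hne
    have hab : a ≠ b := fun h => hne (by rw [h])
    refine ⟨?_, S.endpoints hab⟩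
    rw [Set.eq_empty_iff_forall_notMem]
    rintro p ⟨⟨s, hs⟩, ⟨t, ht⟩⟩
    exact S.line_ne hab s t (ht.trans hs.symm)
  · intro K hK
    obtain ⟨C, hC⟩ := hK.isBounded.subset_closedBall (vert 0)
    refine ((S.local_fin (vert 0) C).image (fun a => lineOf (S.M a))).subset ?_
    rintro _ ⟨⟨a, rfl⟩, ⟨p, ⟨t, rfl⟩, hp⟩⟩
    refine ⟨a, ⟨t, ?_⟩, rfl⟩
    have := hC hp
    rwa [Metric.mem_closedBall, dist_comm] at this
  · rw [hU]
    exact S.trans_free hx hR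
  · let g : Set ℍ → PSL2 := fun α => if h : ∃ a, lineOf (S.M a) = α then S.g h.choose else 1
    have hg : ∀ a, g (lineOf (S.M a)) = S.g a := by
      intro a
      have h : ∃ b, lineOf (S.M b) = lineOf (S.M a) := ⟨a, rfl⟩
      have h1 : g (lineOf (S.M a)) = S.g h.choose := dif_pos h
      rw [h1, S.line_inj h.choose_spec]
    refine ⟨g, ?_, ?_⟩
    · rintro γ _ ⟨a, rfl⟩
      simp only
      rw [S.img_line, hg, hg, CS.g, CS.g, S.M_act, S.F_act]
      group
    · obtain ⟨K, hK, hd⟩ := S.uniform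
      refine ⟨K, hK, ?_⟩
      rintro _ ⟨a, rfl⟩ _ ⟨b, rfl⟩ hne _ ⟨s, rfl⟩ _ ⟨t, rfl⟩
      have hab : a ≠ b := fun h => hne (by rw [h])
      simp only
      rw [hg, hg, pslSMul_eq, pslSMul_eq, CS.g, CS.g, smul_smul, smul_smul, inv_mul_cancel_right,
        inv_mul_cancel_right]
      exact hd b a hab.symm t s

end
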